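/- Let D ⊂ ℂⁿ be a bounded hyperconvex domain, φ ∈ PSH⁻(D), and set u₀ = φ and u₁ = g_φ. Then the geodesic u_t converges to u_j in capacity as t → j, for j = 0 and j = 1; that is, any negative psh function can be connected to its Green–Poisson residual function by a plurisubharmonic geodesic. -/

import Mathlib

open MeasureTheory Filter Topology
open scoped ENNReal

noncomputable section

/-- Complex Euclidean space `ℂⁿ`. -/
abbrev Cn (n : ℕ) : Type := Fin n → ℂ

section Defs

variable {E : Type*} [NormedAddCommGroup E] [NormedSpace ℂ E]

/-- `u` is plurisubharmonic on `Ω`: it is upper semicontinuous on `Ω` (with values in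
`EReal`) and on every closed disc of every complex line contained in `Ω` it satisfies the
maximum principle with respect to real parts of complex polynomials (an equivalent form of
the sub-mean value property on complex lines). -/
def PlurisubharmonicOn (u : E → EReal) (Ω : Set E) : Prop :=
  UpperSemicontinuousOn u Ω ∧
  ∀ a b : E, ∀ r : ℝ, 0 < r →
    (∀ ζ : ℂ, ‖ζ‖ ≤ r → a + ζ • b ∈ Ω) →
    ∀ p : Polynomial ℂ,
      (∀ ζ : ℂ, ‖ζ‖ = r → u (a + ζ • b) ≤ ((Polynomial.eval ζ p).re : EReal)) →
      ∀ ζ : ℂ, ‖ζ‖ ≤ r → u (a + ζ • b) ≤ ((Polynomial.eval ζ p).re : EReal)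

/-- Negative plurisubharmonic functions on `Ω` : the class `PSH⁻(Ω)`. -/
def PSHNeg (u : E → EReal) (Ω : Set E) : Prop :=
  PlurisubharmonicOn u Ω ∧ ∀ z ∈ Ω, u z ≤ 0

/-- A set is pluripolar if it is contained in `{u = -∞}` for some psh `u ≢ -∞`
defined on a neighborhood of the set. -/
def Pluripolar (S : Set E) : Prop :=
  ∃ Ω : Set E, IsOpen Ω ∧ S ⊆ Ω ∧
    ∃ u : E → EReal, PlurisubharmonicOn u Ω ∧ (∃ z ∈ Ω, u z ≠ ⊥) ∧ ∀ z ∈ S, u z = ⊥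

/-- Upper semicontinuous regularization (relative to `Ω`) of a function. -/
def uscReg (f : E → EReal) (Ω : Set E) : E → EReal :=
  fun z => Filter.limsup f (nhdsWithin z Ω)

/-- The psh envelope `P(h)` of a function `h` on `Ω`: the usc regularization of the
supremum of all psh minorants of `h` on `Ω`. -/
def PEnv (h : E → EReal) (Ω : Set E) : E → EReal :=
  uscReg (fun z =>
    ⨆ v ∈ {v : E → EReal | PlurisubharmonicOn v Ω ∧ ∀ x ∈ Ω, v x ≤ h x}, v z) Ω

/-- The rooftop envelope `P(u,v) = P(min{u,v})`. -/
def Rooftop (u v : E → EReal) (Ω : Set E) : E → EReal :=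
  PEnv (fun z => min (u z) (v z)) Ω

/-- The Green–Poisson residual function `g_φ`: usc regularization of the supremum of all
negative psh `w` with `w ≤ φ + C_w` on `Ω` for some constant `C_w`. -/
def gp (φ : E → EReal) (Ω : Set E) : E → EReal :=
  uscReg (fun z =>
    ⨆ w ∈ {w : E → EReal | PSHNeg w Ω ∧ ∃ C : ℝ, ∀ x ∈ Ω, w x ≤ φ x + (C : EReal)}, w z) Ω

/-- The residual Green function `g_φ^o`: usc regularization of the supremum of all
negative psh `w` with `w ≤ φ + O(1)` locally in `Ω`. -/
def gpO (φ : E → EReal) (Ω : Set E) : E → EReal :=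
  uscReg (fun z =>
    ⨆ w ∈ {w : E → EReal | PSHNeg w Ω ∧
      ∀ a ∈ Ω, ∃ U ∈ nhds a, ∃ C : ℝ, ∀ x ∈ U ∩ Ω, w x ≤ φ x + (C : EReal)}, w z) Ω

/-- The residual Poisson function `g_φ^b`: usc regularization of the supremum of all
negative psh `w` with `w ≤ φ + O(1)` in a neighborhood of `∂Ω`. -/
def gpB (φ : E → EReal) (Ω : Set E) : E → EReal :=
  uscReg (fun z =>
    ⨆ w ∈ {w : E → EReal | PSHNeg w Ω ∧
      ∃ U : Set E, IsOpen U ∧ frontier Ω ⊆ U ∧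
        ∃ C : ℝ, ∀ x ∈ U ∩ Ω, w x ≤ φ x + (C : EReal)}, w z) Ω

/-- The asymptotic rooftop `P[φ](ψ) = lim*_{C→∞} P(ψ, φ+C)`. -/
def asympRooftop (ψ φ : E → EReal) (Ω : Set E) : E → EReal :=
  uscReg (fun z => ⨆ C : ℝ, Rooftop ψ (fun x => φ x + (C : EReal)) Ω z) Ω

/-- The unbounded locus `L(φ)` of `φ` in `Ω`: points of `Ω` having no neighborhood on
which `φ` is bounded. -/
def Lset (φ : E → EReal) (Ω : Set E) : Set E :=
  {a | a ∈ Ω ∧ ∀ U ∈ nhds a, ¬ ∃ M : ℝ, ∀ x ∈ U ∩ Ω, -(M : EReal) ≤ φ x ∧ φ x ≤ (M : EReal)}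

/-- The boundary unbounded locus `BL(φ)`: boundary points near which `φ` is unbounded. -/
def BLset (φ : E → EReal) (Ω : Set E) : Set E :=
  {b | b ∈ frontier Ω ∧
    ∀ U ∈ nhds b, ¬ ∃ M : ℝ, ∀ x ∈ U ∩ Ω, -(M : EReal) ≤ φ x ∧ φ x ≤ (M : EReal)}

/-- `PSH_s⁻(Ω)` : negative psh functions with small unbounded locus (both `L(φ)` and
`BL(φ)` pluripolar). -/
def PSHs (φ : E → EReal) (Ω : Set E) : Prop :=
  PSHNeg φ Ω ∧ Pluripolar (Lset φ Ω) ∧ Pluripolar (BLset φ Ω)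

/-- `u` is a maximal psh function on the set `U`: it is psh there and for every `G ⋐ U`
and every psh `v` on a neighborhood of `closure G` with `v ≤ u` on `∂G`, one has `v ≤ u`
on `G`. -/
def MaximalOn (u : E → EReal) (U : Set E) : Prop :=
  PlurisubharmonicOn u U ∧
  ∀ G : Set E, IsOpen G → IsCompact (closure G) → closure G ⊆ U →
    ∀ W : Set E, IsOpen W → closure G ⊆ W →
      ∀ v : E → EReal, PlurisubharmonicOn v W →
        (∀ z ∈ frontier G, v z ≤ u z) → ∀ z ∈ G, v z ≤ u z

/-- B-regularity of a domain: every continuous function on the boundary is the boundary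
value of a psh function continuous up to the closure. -/
def BRegular (Ω : Set E) : Prop :=
  ∀ η : E → ℝ, ContinuousOn η (frontier Ω) →
    ∃ u : E → ℝ, PlurisubharmonicOn (fun z => ((u z : ℝ) : EReal)) Ω ∧
      ContinuousOn u (closure Ω) ∧ ∀ ζ ∈ frontier Ω, u ζ = η ζ

/-- Pseudoconvexity: existence of a continuous psh exhaustion function. -/
def Pseudoconvex (Ω : Set E) : Prop :=
  IsOpen Ω ∧ ∃ u : E → ℝ, ContinuousOn u Ω ∧
    PlurisubharmonicOn (fun z => ((u z : ℝ) : EReal)) Ω ∧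
    ∀ c : ℝ, IsCompact {z | z ∈ Ω ∧ u z ≤ c}

/-- Hyperconvexity: existence of a negative psh exhaustion function. -/
def Hyperconvex (Ω : Set E) : Prop :=
  ∃ ρ : E → EReal, PlurisubharmonicOn ρ Ω ∧ (∀ z ∈ Ω, ρ z < 0) ∧
    ∀ c : ℝ, c < 0 →
      IsCompact (closure {z | z ∈ Ω ∧ ρ z ≤ (c : EReal)}) ∧
      closure {z | z ∈ Ω ∧ ρ z ≤ (c : EReal)} ⊆ Ω

/-- `H` is the least maximal psh majorant (`fb φ`) of `φ` on `Ω` (within `PSH⁻(Ω)`). -/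
def IsLeastMaxMajorant (φ H : E → EReal) (Ω : Set E) : Prop :=
  MaximalOn H Ω ∧ (∀ z ∈ Ω, H z ≤ 0) ∧ (∀ z ∈ Ω, φ z ≤ H z) ∧
  ∀ H' : E → EReal, MaximalOn H' Ω → (∀ z ∈ Ω, H' z ≤ 0) → (∀ z ∈ Ω, φ z ≤ H' z) →
    ∀ z ∈ Ω, H z ≤ H' z

/-- Extended-real logarithm, with `log 0 = -∞`. -/
def elog (x : ℝ) : EReal := if x ≤ 0 then (⊥ : EReal) else ((Real.log x : ℝ) : EReal)

end Defs

section MA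

/-- Real second directional derivative `D²u(z)(v,w)`. -/
def reB (n : ℕ) (u : Cn n → ℝ) (z v w : Cn n) : ℝ :=
  fderiv ℝ (fun x => fderiv ℝ u x w) z v

/-- Entry `∂²u/∂z_j∂z̄_k` of the complex Hessian of a (C²) function `u`. -/
def cHessEntry (n : ℕ) (u : Cn n → ℝ) (z : Cn n) (j k : Fin n) : ℂ :=
  (1 / 4 : ℂ) *
    ( ((reB n u z ((Pi.single j (1 : ℂ) : Cn n)) ((Pi.single k (1 : ℂ) : Cn n)) : ℝ) : ℂ)
    + ((reB n u z ((Pi.single j Complex.I : Cn n)) ((Pi.single k Complex.I : Cn n)) : ℝ) : ℂ)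
    + Complex.I *
      ( ((reB n u z ((Pi.single j (1 : ℂ) : Cn n)) ((Pi.single k Complex.I : Cn n)) : ℝ) : ℂ)
      - ((reB n u z ((Pi.single j Complex.I : Cn n)) ((Pi.single k (1 : ℂ) : Cn n)) : ℝ) : ℂ)))

/-- Density of the Monge–Ampère measure `(dd^c u)ⁿ` of a smooth function `u`. -/
def maDensity (n : ℕ) (u : Cn n → ℝ) (z : Cn n) : ℝ :=
  (4 : ℝ) ^ n * (n.factorial : ℝ) * (Matrix.det (Matrix.of fun j k => cHessEntry n u z j k)).re

/-- `μ` is the Bedford–Taylor Monge–Ampère measure `(dd^c u)ⁿ` of `u` on `Ω`: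
it is locally finite on `Ω`, carried by `Ω`, and for every open `U ⊆ Ω` and every
decreasing sequence of smooth psh functions on `U` converging pointwise to `u`, the
corresponding smooth Monge–Ampère measures converge to `μ` against test functions
supported in `U`. -/
def IsMAMeasure (n : ℕ) (u : Cn n → EReal) (Ω : Set (Cn n)) (μ : Measure (Cn n)) : Prop :=
  μ Ωᶜ = 0 ∧ (∀ K : Set (Cn n), IsCompact K → K ⊆ Ω → μ K ≠ ⊤) ∧
  ∀ U : Set (Cn n), IsOpen U → U ⊆ Ω →
    ∀ v : ℕ → Cn n → ℝ,
      (∀ k, ContDiffOn ℝ (⊤ : ℕ∞) (v k) U) →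
      (∀ k, PlurisubharmonicOn (fun z => ((v k z : ℝ) : EReal)) U) →
      (∀ k, ∀ z ∈ U, v (k + 1) z ≤ v k z) →
      (∀ z ∈ U, (⨅ k, ((v k z : ℝ) : EReal)) = u z) →
      ∀ f : Cn n → ℝ, Continuous f → HasCompactSupport f → tsupport f ⊆ U →
        Filter.Tendsto (fun k => ∫ z, f z * maDensity n (v k) z) Filter.atTop
          (nhds (∫ z, f z ∂μ))

/-- The Cegrell class `E₀(Ω)`: bounded negative psh functions with zero boundary values
and finite total Monge–Ampère mass. -/
def ClassE0 (n : ℕ) (Ω : Set (Cn n)) (φ : Cn n → EReal) : Prop :=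
  PSHNeg φ Ω ∧ (∃ M : ℝ, ∀ z ∈ Ω, -(M : EReal) ≤ φ z) ∧
  (∀ ζ ∈ frontier Ω, Filter.Tendsto φ (nhdsWithin ζ Ω) (nhds (0 : EReal))) ∧
  ∃ μ : Measure (Cn n), IsMAMeasure n φ Ω μ ∧ μ Ω ≠ ⊤

/-- The Cegrell class `E(Ω)`: negative psh functions that are locally decreasing limits
of functions of `E₀(Ω)` with uniformly bounded total Monge–Ampère masses. -/
def ClassE (n : ℕ) (Ω : Set (Cn n)) (φ : Cn n → EReal) : Prop :=
  PSHNeg φ Ω ∧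
  ∀ z ∈ Ω, ∃ U : Set (Cn n), IsOpen U ∧ z ∈ U ∧ U ⊆ Ω ∧
    ∃ h : ℕ → Cn n → EReal, ∃ M : ℝ≥0∞, M ≠ ⊤ ∧
      (∀ j, ClassE0 n Ω (h j)) ∧
      (∀ j, ∀ x ∈ Ω, h (j + 1) x ≤ h j x) ∧
      (∀ x ∈ U, (⨅ j, h j x) = φ x) ∧
      (∀ j, ∀ μ : Measure (Cn n), IsMAMeasure n (h j) Ω μ → μ Ω ≤ M)

/-- The Cegrell class `N(Ω) = {w ∈ E(Ω) : fb w = 0}`. -/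
def ClassN (n : ℕ) (Ω : Set (Cn n)) : Set (Cn n → EReal) :=
  {w | ClassE n Ω w ∧ IsLeastMaxMajorant w 0 Ω}

/-- The Cegrell class `F(Ω) = {w ∈ E(Ω) : ∫ (dd^c w)ⁿ < ∞ and fb w = 0}`. -/
def ClassF (n : ℕ) (Ω : Set (Cn n)) : Set (Cn n → EReal) :=
  {w | ClassE n Ω w ∧ IsLeastMaxMajorant w 0 Ω ∧
    ∀ μ : Measure (Cn n), IsMAMeasure n w Ω μ → μ Ω ≠ ⊤}

/-- Membership `φ ∈ K(Ω, H)`: `φ ∈ E(Ω)` and `H + w ≤ φ ≤ H` for some `w ∈ K`. -/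
def InClassRel (n : ℕ) (Ω : Set (Cn n)) (K : Set (Cn n → EReal)) (H φ : Cn n → EReal) : Prop :=
  ClassE n Ω φ ∧ ∃ w ∈ K, ∀ z ∈ Ω, H z + w z ≤ φ z ∧ φ z ≤ H z

/-- The annulus `A = {1 < |ζ| < e}`. -/
def annA : Set ℂ := {ζ : ℂ | 1 < ‖ζ‖ ∧ ‖ζ‖ < Real.exp 1}

/-- The class `W(u₀,u₁)` of subgeodesics: negative psh functions on `Ω × A` with boundary
limsups dominated by `u₀` on `|ζ| = 1` and by `u₁` on `|ζ| = e`. -/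
def geodClass (n : ℕ) (Ω : Set (Cn n)) (u0 u1 : Cn n → EReal) : Set (Cn n × ℂ → EReal) :=
  {u | PSHNeg u (Ω ×ˢ annA) ∧
    (∀ z ∈ Ω, Filter.limsup (fun ζ : ℂ => u (z, ζ))
        ((nhds (1 : ℝ)).comap (fun ζ : ℂ => ‖ζ‖) ⊓ Filter.principal annA) ≤ u0 z) ∧
    (∀ z ∈ Ω, Filter.limsup (fun ζ : ℂ => u (z, ζ))
        ((nhds (Real.exp 1)).comap (fun ζ : ℂ => ‖ζ‖) ⊓ Filter.principal annA) ≤ u1 z)}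

/-- The geodesic `u_t(z) = P_W(z, e^t)`, the Perron envelope of the class `W(u₀,u₁)`. -/
def geodesic (n : ℕ) (Ω : Set (Cn n)) (u0 u1 : Cn n → EReal) (t : ℝ) (z : Cn n) : EReal :=
  ⨆ u ∈ geodClass n Ω u0 u1, u (z, ((Real.exp t : ℝ) : ℂ))

/-- The Monge–Ampère capacity `Cap(S) = sup {∫_S (dd^c u)ⁿ : u psh, -1 ≤ u ≤ 0}`. -/
def MACap (n : ℕ) (Ω : Set (Cn n)) (S : Set (Cn n)) : ℝ≥0∞ :=
  ⨆ u ∈ {u : Cn n → EReal | PlurisubharmonicOn u Ω ∧ ∀ z ∈ Ω, -1 ≤ u z ∧ u z ≤ 0},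
    ⨆ μ ∈ {μ : Measure (Cn n) | IsMAMeasure n u Ω μ}, μ S

/-- Convergence `u t → g` in capacity as `t → t₀` within `(0,1)`. -/
def TendstoInCap (n : ℕ) (Ω : Set (Cn n)) (u : ℝ → Cn n → EReal) (g : Cn n → EReal)
    (t0 : ℝ) : Prop :=
  ∀ ε : ℝ, 0 < ε → ∀ K : Set (Cn n), IsCompact K → K ⊆ Ω →
    Filter.Tendsto
      (fun t => MACap n Ω
        {z | z ∈ K ∧ ¬ (u t z ≤ g z + (ε : EReal) ∧ g z ≤ u t z + (ε : EReal))})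
      (nhdsWithin t0 (Set.Ioo (0 : ℝ) 1)) (nhds (0 : ℝ≥0∞))

/-- Convergence `u t → g` in `L¹_loc(Ω)` as `t → t₀` within `(0,1)`. -/
def TendstoL1loc (n : ℕ) (Ω : Set (Cn n)) (u : ℝ → Cn n → EReal) (g : Cn n → EReal)
    (t0 : ℝ) : Prop :=
  ∀ K : Set (Cn n), IsCompact K → K ⊆ Ω →
    Filter.Tendsto (fun t => ∫⁻ z in K, ENNReal.ofReal |(u t z).toReal - (g z).toReal|)
      (nhdsWithin t0 (Set.Ioo (0 : ℝ) 1)) (nhds (0 : ℝ≥0∞))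

end MA

section
open Equiv in
/-- The mixed discriminant of `n` complex matrices of size `n`, normalized so that its value on
the diagonal is `n! det`. -/
def mixedDisc {n : ℕ} (A : Fin n → Matrix (Fin n) (Fin n) ℂ) : ℂ :=
  ∑ σ : Perm (Fin n), ∑ τ : Perm (Fin n),
    ((Perm.sign σ : ℤ) : ℂ) * ((Perm.sign τ : ℤ) : ℂ) * ∏ i, A i (σ i) (τ i)

theorem prod_update_apply {n : ℕ} (A : Fin n → Matrix (Fin n) (Fin n) ℂ) (p : Fin n)
    (X : Matrix (Fin n) (Fin n) ℂ) (σ τ : Equiv.Perm (Fin n)) :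
    ∏ i, Function.update A p X i (σ i) (τ i) =
      X (σ p) (τ p) * ∏ i ∈ Finset.univ.erase p, A i (σ i) (τ i) := by
  rw [← Finset.mul_prod_erase Finset.univ _ (Finset.mem_univ p)]
  congr 1
  · simp
  · refine Finset.prod_congr rfl fun i hi => ?_
    rw [Function.update_of_ne (Finset.ne_of_mem_erase hi)]

theorem mixedDisc_update {n : ℕ} (A : Fin n → Matrix (Fin n) (Fin n) ℂ) (p : Fin n)
    (X : Matrix (Fin n) (Fin n) ℂ) :
    mixedDisc (Function.update A p X) = ∑ σ : Equiv.Perm (Fin n), ∑ τ : Equiv.Perm (Fin n),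
      ((Equiv.Perm.sign σ : ℤ) : ℂ) * ((Equiv.Perm.sign τ : ℤ) : ℂ) *
        (X (σ p) (τ p) * ∏ i ∈ Finset.univ.erase p, A i (σ i) (τ i)) := by
  simp only [mixedDisc, prod_update_apply]

theorem mixedDisc_update_add {n : ℕ} (A : Fin n → Matrix (Fin n) (Fin n) ℂ) (p : Fin n)
    (X Y : Matrix (Fin n) (Fin n) ℂ) :
    mixedDisc (Function.update A p (X + Y)) =
      mixedDisc (Function.update A p X) + mixedDisc (Function.update A p Y) := by
  simp only [mixedDisc_update, ← Finset.sum_add_distrib, Matrix.add_apply]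
  exact Finset.sum_congr rfl fun σ _ => Finset.sum_congr rfl fun τ _ => by ring

theorem mixedDisc_update_smul {n : ℕ} (A : Fin n → Matrix (Fin n) (Fin n) ℂ) (p : Fin n)
    (c : ℂ) (X : Matrix (Fin n) (Fin n) ℂ) :
    mixedDisc (Function.update A p (c • X)) = c * mixedDisc (Function.update A p X) := by
  simp only [mixedDisc_update, Finset.mul_sum, Matrix.smul_apply, smul_eq_mul]
  exact Finset.sum_congr rfl fun σ _ => Finset.sum_congr rfl fun τ _ => by ring

theorem mixedDisc_comp_perm {n : ℕ} (A : Fin n → Matrix (Fin n) (Fin n) ℂ)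
    (e : Equiv.Perm (Fin n)) : mixedDisc (A ∘ e) = mixedDisc A := by
  unfold mixedDisc
  rw [← Equiv.sum_comp (Equiv.mulRight e)]
  refine Finset.sum_congr rfl fun σ _ => ?_
  rw [← Equiv.sum_comp (Equiv.mulRight e)]
  refine Finset.sum_congr rfl fun τ _ => ?_
  have h : ((Equiv.Perm.sign e : ℤ) : ℂ) * ((Equiv.Perm.sign e : ℤ) : ℂ) = 1 := by
    rw [← Int.cast_mul, ← Units.val_mul, Int.units_mul_self]; simp
  rw [← Equiv.prod_comp e (fun i => A i (σ i) (τ i))]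
  simp only [Equiv.coe_mulRight, Equiv.Perm.sign_mul, Units.val_mul, Int.cast_mul,
    Equiv.Perm.coe_mul, Function.comp_apply]
  linear_combination ((Equiv.Perm.sign σ : ℤ) : ℂ) * ((Equiv.Perm.sign τ : ℤ) : ℂ) *
    (∏ i, A (e i) (σ (e i)) (τ (e i))) * h

theorem mixedDisc_const {n : ℕ} (A : Matrix (Fin n) (Fin n) ℂ) :
    mixedDisc (fun _ => A) = (n.factorial : ℂ) * A.det := by
  have key : ∀ σ : Equiv.Perm (Fin n), ∑ τ : Equiv.Perm (Fin n),
      ((Equiv.Perm.sign σ : ℤ) : ℂ) * ((Equiv.Perm.sign τ : ℤ) : ℂ) * ∏ i, A (σ i) (τ i)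
        = A.det := by
    intro σ
    have h1 := Matrix.det_permute σ A
    have h2 : (A.submatrix σ id).det = ∑ τ : Equiv.Perm (Fin n),
        ((Equiv.Perm.sign τ : ℤ) : ℂ) * ∏ i, A (σ i) (τ i) := by
      rw [← Matrix.det_transpose, Matrix.det_apply']
      rfl
    have h : ((Equiv.Perm.sign σ : ℤ) : ℂ) * ((Equiv.Perm.sign σ : ℤ) : ℂ) = 1 := by
      rw [← Int.cast_mul, ← Units.val_mul, Int.units_mul_self]; simp
    simp only [mul_assoc, ← Finset.mul_sum]
    rw [← h2, h1, ← mul_assoc, h, one_mul]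
  unfold mixedDisc
  rw [Finset.sum_congr rfl fun σ _ => key σ]
  simp [Fintype.card_perm]

theorem star_mixedDisc {n : ℕ} (A : Fin n → Matrix (Fin n) (Fin n) ℂ) :
    star (mixedDisc A) = mixedDisc fun i => (A i).conjTranspose := by
  unfold mixedDisc
  rw [Finset.sum_comm]
  simp [star_sum, mul_comm]

open scoped ComplexOrder in
theorem mixedDisc_nonneg {n : ℕ} (A : Fin n → Matrix (Fin n) (Fin n) ℂ)
    (hA : ∀ i, (A i).PosSemidef) : 0 ≤ (mixedDisc A).re := by
  choose m v hv using fun i => Matrix.posSemidef_iff_eq_sum_vecMulVec.mp (hA i)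
  have h1 : mixedDisc A = ∑ l ∈ Fintype.piFinset (fun i => (Finset.univ : Finset (Fin (m i)))),
      ((Matrix.of fun i j => v i (l i) j).det) * star ((Matrix.of fun i j => v i (l i) j).det) := by
    have h2 : ∀ σ τ : Equiv.Perm (Fin n), ∏ i, A i (σ i) (τ i) =
        ∑ l ∈ Fintype.piFinset (fun i => (Finset.univ : Finset (Fin (m i)))),
          ∏ i, (v i (l i) (σ i) * star (v i (l i) (τ i))) := by
      intro σ τ
      refine Eq.trans ?_ (Finset.prod_univ_sum
        (fun i => (Finset.univ : Finset (Fin (m i))))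
        fun i k => v i k (σ i) * star (v i k (τ i)))
      refine Finset.prod_congr rfl fun i _ => ?_
      rw [hv i, Matrix.sum_apply]
      rfl
    unfold mixedDisc
    simp only [h2, Finset.mul_sum]
    rw [Finset.sum_congr rfl fun σ _ => Finset.sum_comm, Finset.sum_comm]
    refine Finset.sum_congr rfl fun l _ => ?_
    rw [← Matrix.det_transpose, Matrix.det_apply', star_sum, Finset.sum_mul]
    refine Finset.sum_congr rfl fun σ _ => ?_
    rw [Finset.mul_sum]
    refine Finset.sum_congr rfl fun τ _ => ?_
    simp only [Matrix.transpose_apply, Matrix.of_apply, Finset.prod_mul_distrib, star_mul',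
      star_prod, star_intCast]
    ring
  rw [h1, Complex.re_sum]
  refine Finset.sum_nonneg fun l _ => ?_
  rw [Complex.star_def, Complex.mul_conj, Complex.ofReal_re]
  exact Complex.normSq_nonneg _

end

section
variable {n : ℕ}

/-- Smoothness over the reals. -/
def Smooth {V W : Type*} [NormedAddCommGroup V] [NormedSpace ℝ V] [NormedAddCommGroup W]
    [NormedSpace ℝ W] (f : V → W) : Prop := ContDiff ℝ (⊤ : ℕ∞) f

/-- The first order operator `(∂/∂x_j + c ∂/∂y_j) / 2`; it is `∂/∂z_j` for `c = -i` and
`∂/∂z̄_j` for `c = i`. -/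
def wirt (c : ℂ) (j : Fin n) (F : Cn n → ℂ) (x : Cn n) : ℂ :=
  (1 / 2 : ℂ) * (fderiv ℝ F x (Pi.single j 1) + c * fderiv ℝ F x (Pi.single j Complex.I))

theorem Smooth.fderiv_apply {V W : Type*} [NormedAddCommGroup V] [NormedSpace ℝ V]
    [NormedAddCommGroup W] [NormedSpace ℝ W] {F : V → W} (hF : Smooth F) (v : V) :
    Smooth fun x => fderiv ℝ F x v :=
  (ContDiff.fderiv_right hF (by simp)).clm_apply contDiff_const

theorem Smooth.diff {V W : Type*} [NormedAddCommGroup V] [NormedSpace ℝ V]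
    [NormedAddCommGroup W] [NormedSpace ℝ W] {F : V → W} (hF : Smooth F) : Differentiable ℝ F :=
  ContDiff.differentiable hF (by simp)

theorem Smooth.wirt {F : Cn n → ℂ} (hF : Smooth F) (c : ℂ) (j : Fin n) :
    Smooth (wirt c j F) :=
  contDiff_const.mul ((hF.fderiv_apply _).add (contDiff_const.mul (hF.fderiv_apply _)))

theorem wirt_add {F G : Cn n → ℂ} (hF : Smooth F) (hG : Smooth G) (c : ℂ) (j : Fin n)
    (x : Cn n) : wirt c j (fun y => F y + G y) x = wirt c j F x + wirt c j G x := by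
  simp only [wirt]
  rw [fderiv_fun_add (hF.diff x) (hG.diff x)]
  simp only [add_apply]
  ring

theorem wirt_mul {F G : Cn n → ℂ} (hF : Smooth F) (hG : Smooth G) (c : ℂ) (j : Fin n)
    (x : Cn n) :
    wirt c j (fun y => F y * G y) x = F x * wirt c j G x + wirt c j F x * G x := by
  simp only [wirt]
  rw [fderiv_fun_mul (hF.diff x) (hG.diff x)]
  simp only [add_apply, smul_apply, smul_eq_mul]
  ring

theorem Smooth.finset_prod {ι : Type*} {s : Finset ι} {F : ι → Cn n → ℂ}
    (hF : ∀ i ∈ s, Smooth (F i)) : Smooth fun y => ∏ i ∈ s, F i y :=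
  contDiff_prod hF

theorem wirt_prod {ι : Type*} [DecidableEq ι] (s : Finset ι) {F : ι → Cn n → ℂ}
    (hF : ∀ i, Smooth (F i)) (c : ℂ) (j : Fin n) (x : Cn n) :
    wirt c j (fun y => ∏ i ∈ s, F i y) x =
      ∑ l ∈ s, wirt c j (F l) x * ∏ i ∈ s.erase l, F i x := by
  induction s using Finset.induction_on with
  | empty => simp [wirt]
  | insert a s ha ih =>
    simp only [Finset.prod_insert ha, Finset.sum_insert ha, Finset.erase_insert ha]
    rw [wirt_mul (hF a) (Smooth.finset_prod fun i _ => hF i), ih, Finset.mul_sum, add_comm]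
    congr 1
    refine Finset.sum_congr rfl fun l hl => ?_
    have hla : a ≠ l := fun h => ha (h ▸ hl)
    rw [Finset.erase_insert_of_ne hla, Finset.prod_insert (by simp [ha])]
    ring

theorem wirt_comm {F : Cn n → ℂ} (hF : Smooth F) (c d : ℂ) (j k : Fin n) (x : Cn n) :
    wirt c j (wirt d k F) x = wirt d k (wirt c j F) x := by
  have hsym : ∀ v w : Cn n, fderiv ℝ (fun y => fderiv ℝ F y w) x v =
      fderiv ℝ (fun y => fderiv ℝ F y v) x w := by
    intro v w
    have hd : DifferentiableAt ℝ (fderiv ℝ F) x :=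
      ((ContDiff.fderiv_right (m := 1) hF (by norm_cast)).differentiable (by simp)) x
    have h := (ContDiff.contDiffAt (x := x) hF).isSymmSndFDerivAt (by simp; norm_cast)
    rw [fderiv_clm_apply hd (differentiableAt_const _),
      fderiv_clm_apply hd (differentiableAt_const _)]
    simpa using h v w
  have key : ∀ (a b : ℂ) (p q : Fin n), wirt a p (wirt b q F) x =
      (1 / 2 : ℂ) * ((1 / 2 : ℂ) * (fderiv ℝ (fun y => fderiv ℝ F y (Pi.single q 1)) x
          (Pi.single p 1) + b * fderiv ℝ (fun y => fderiv ℝ F y (Pi.single q Complex.I)) x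
          (Pi.single p 1)) + a * ((1 / 2 : ℂ) * (fderiv ℝ (fun y => fderiv ℝ F y
          (Pi.single q 1)) x (Pi.single p Complex.I) +
          b * fderiv ℝ (fun y => fderiv ℝ F y (Pi.single q Complex.I)) x
          (Pi.single p Complex.I)))) := by
    intro a b p q
    have h1 : fderiv ℝ (wirt b q F) x = (1 / 2 : ℂ) • (fderiv ℝ (fun y => fderiv ℝ F y
        (Pi.single q 1)) x + b • fderiv ℝ (fun y => fderiv ℝ F y (Pi.single q Complex.I)) x) := by
      exact ((((hF.fderiv_apply _).diff x).hasFDerivAt.add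
        (((hF.fderiv_apply _).diff x).hasFDerivAt.const_mul b)).const_mul _).fderiv
    rw [wirt, h1]
    simp only [add_apply, smul_apply, smul_eq_mul]
  rw [key, key, hsym (Pi.single j 1) (Pi.single k Complex.I),
    hsym (Pi.single j Complex.I) (Pi.single k 1), hsym (Pi.single j 1) (Pi.single k 1),
    hsym (Pi.single j Complex.I) (Pi.single k Complex.I)]
  ring

theorem star_wirt {F : Cn n → ℂ} (hF : Smooth F) (c : ℂ) (j : Fin n) (x : Cn n) :
    star (wirt c j F x) = wirt (star c) j (fun y => star (F y)) x := by
  have h : fderiv ℝ (fun y => star (F y)) x =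
      (Complex.conjCLE : ℂ →L[ℝ] ℂ).comp (fderiv ℝ F x) :=
    ((Complex.conjCLE : ℂ →L[ℝ] ℂ).hasFDerivAt.comp x (hF.diff x).hasFDerivAt).fderiv
  simp only [wirt, h]
  simp

theorem HasCompactSupport.wirt {F : Cn n → ℂ} (hF : HasCompactSupport F) (c : ℂ) (j : Fin n) :
    HasCompactSupport (wirt c j F) := by
  have h := hF.fderiv (𝕜 := ℝ)
  refine h.mono ?_
  intro x hx hx'
  apply hx
  simp [_root_.wirt, hx']

theorem integral_mul_wirt {F G : Cn n → ℂ} (hF : Smooth F) (hG : Smooth G)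
    (hs : HasCompactSupport F ∨ HasCompactSupport G) (c : ℂ) (j : Fin n) :
    ∫ x, F x * wirt c j G x = -∫ x, wirt c j F x * G x := by
  have hc : ∀ {A B : Cn n → ℂ}, Smooth A → Smooth B →
      (HasCompactSupport A ∨ HasCompactSupport B) → Integrable fun x => A x * B x := by
    intro A B hA hB h
    refine (ContDiff.continuous hA |>.mul (ContDiff.continuous hB)).integrable_of_hasCompactSupport
      ?_
    rcases h with h | h
    · exact h.mul_right
    · exact h.mul_left
  have hv : ∀ v : Cn n, (∫ x, F x * fderiv ℝ G x v = -∫ x, fderiv ℝ F x v * G x) ∧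
      Integrable (fun x => F x * fderiv ℝ G x v) ∧
      Integrable (fun x => fderiv ℝ F x v * G x) := by
    intro v
    have i1 := hc hF (hG.fderiv_apply v) (hs.imp id fun h => h.fderiv_apply (𝕜 := ℝ) v)
    have i2 := hc (hF.fderiv_apply v) hG (hs.imp (fun h => h.fderiv_apply (𝕜 := ℝ) v) id)
    exact ⟨integral_mul_fderiv_eq_neg_fderiv_mul_of_integrable i2 i1 (hc hF hG hs)
      (fun x _ => hF.diff x) (fun x _ => hG.diff x), i1, i2⟩
  obtain ⟨e1, a1, b1⟩ := hv (Pi.single j 1)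
  obtain ⟨e2, a2, b2⟩ := hv (Pi.single j Complex.I)
  have l : ∀ x, F x * wirt c j G x = (1 / 2 : ℂ) * (F x * fderiv ℝ G x (Pi.single j 1) +
      c * (F x * fderiv ℝ G x (Pi.single j Complex.I))) := fun x => by rw [wirt]; ring
  have r : ∀ x, wirt c j F x * G x = (1 / 2 : ℂ) * (fderiv ℝ F x (Pi.single j 1) * G x +
      c * (fderiv ℝ F x (Pi.single j Complex.I) * G x)) := fun x => by rw [wirt]; ring
  simp only [l, r]
  rw [integral_const_mul, integral_const_mul, integral_add a1 (a2.const_mul c),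
    integral_add b1 (b2.const_mul c), integral_const_mul, integral_const_mul, e1, e2]
  ring

end

section
variable {n : ℕ}

/-- The complex Hessian of a complex valued function. -/
def cHess (G : Cn n → ℂ) (x : Cn n) : Matrix (Fin n) (Fin n) ℂ :=
  Matrix.of fun j k => wirt (-Complex.I) j (wirt Complex.I k G) x

/-- The complex Hessian of a real valued function. -/
def hess (u : Cn n → ℝ) (x : Cn n) : Matrix (Fin n) (Fin n) ℂ :=
  cHess (fun y => (u y : ℂ)) x

/-- The density of the mixed Monge–Ampère measure, up to the factor `4ⁿ`. -/
def mixedMA (T : Fin n → Cn n → ℝ) (x : Cn n) : ℝ := (mixedDisc fun i => hess (T i) x).re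

theorem Smooth.ofReal {V : Type*} [NormedAddCommGroup V] [NormedSpace ℝ V] {u : V → ℝ}
    (hu : Smooth u) : Smooth fun y => (u y : ℂ) :=
  Complex.ofRealCLM.contDiff.comp hu

theorem cHess_conjTranspose {G : Cn n → ℂ} (hG : Smooth G) (x : Cn n) :
    (cHess G x).conjTranspose = cHess (fun y => star (G y)) x := by
  ext j k
  simp only [cHess, Matrix.conjTranspose_apply, Matrix.of_apply]
  rw [star_wirt (hG.wirt _ _), wirt_comm (c := -Complex.I) (d := Complex.I)]
  · simp only [star_neg, Complex.star_def, Complex.conj_I, neg_neg]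
    congr 1
    funext y
    have := star_wirt hG Complex.I j y
    simpa using this
  · exact Complex.conjCLE.contDiff.comp hG

theorem hess_conjTranspose {u : Cn n → ℝ} (hu : Smooth u) (x : Cn n) :
    (hess u x).conjTranspose = hess u x := by
  rw [hess, cHess_conjTranspose hu.ofReal]
  simp

theorem Smooth.cHess_apply {G : Cn n → ℂ} (hG : Smooth G) (j k : Fin n) :
    Smooth fun x => cHess G x j k := (hG.wirt _ _).wirt _ _

theorem smooth_mixedMA {T : Fin n → Cn n → ℝ} (hT : ∀ i, Smooth (T i)) : Smooth (mixedMA T) := by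
  have : Smooth fun x => mixedDisc fun i => hess (T i) x := by
    refine ContDiff.sum fun σ _ => ContDiff.sum fun τ _ => contDiff_const.mul ?_
    exact Smooth.finset_prod fun i _ => (hT i).ofReal.cHess_apply _ _
  exact Complex.reCLM.contDiff.comp this

theorem cHessEntry_eq_hess {u : Cn n → ℝ} (hu : Smooth u) (x : Cn n) (j k : Fin n) :
    cHessEntry n u x j k = hess u x j k := by
  have hc : ∀ (w v y : Cn n), fderiv ℝ (fun y => (u y : ℂ)) y v = ((fderiv ℝ u y v : ℝ) : ℂ) := by
    intro _ v y
    have := (Complex.ofRealCLM.hasFDerivAt.comp y (hu.diff y).hasFDerivAt).fderiv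
    exact congrArg (fun L => L v) this
  have hc2 : ∀ v w : Cn n, fderiv ℝ (fun y => ((fderiv ℝ u y w : ℝ) : ℂ)) x v =
      ((reB n u x v w : ℝ) : ℂ) := by
    intro v w
    have := (Complex.ofRealCLM.hasFDerivAt.comp x ((hu.fderiv_apply w).diff x).hasFDerivAt).fderiv
    exact congrArg (fun L => L v) this
  have hd : ∀ w : Cn n, DifferentiableAt ℝ (fun y => ((fderiv ℝ u y w : ℝ) : ℂ)) x :=
    fun w => (hu.fderiv_apply w).ofReal.diff x
  have h1 : fderiv ℝ (wirt Complex.I k (fun y => (u y : ℂ))) x =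
      (1 / 2 : ℂ) • (fderiv ℝ (fun y => ((fderiv ℝ u y (Pi.single k 1) : ℝ) : ℂ)) x +
        Complex.I • fderiv ℝ (fun y => ((fderiv ℝ u y (Pi.single k Complex.I) : ℝ) : ℂ)) x) := by
    have : wirt Complex.I k (fun y => (u y : ℂ)) = fun y => (1 / 2 : ℂ) *
        (((fderiv ℝ u y (Pi.single k 1) : ℝ) : ℂ) +
          Complex.I * ((fderiv ℝ u y (Pi.single k Complex.I) : ℝ) : ℂ)) := by
      funext y
      rw [wirt, hc y, hc y]
    rw [this]
    exact (((hd _).hasFDerivAt.add ((hd _).hasFDerivAt.const_mul _)).const_mul _).fderiv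
  rw [hess, cHess, Matrix.of_apply, wirt, h1]
  simp only [add_apply, smul_apply, smul_eq_mul, hc2, cHessEntry]
  linear_combination (1 / 4 : ℂ) * ((reB n u x (Pi.single j Complex.I)
    (Pi.single k Complex.I) : ℝ) : ℂ) * Complex.I_mul_I

theorem maDensity_eq_mixedMA {u : Cn n → ℝ} (hu : Smooth u) (x : Cn n) :
    maDensity n u x = 4 ^ n * mixedMA (fun _ => u) x := by
  have h : (Matrix.of fun j k => cHessEntry n u x j k) = hess u x := by
    ext j k; exact cHessEntry_eq_hess hu x j k
  rw [maDensity, h, mixedMA, mixedDisc_const, ← Complex.ofReal_natCast, Complex.re_ofReal_mul,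
    mul_assoc]

/-- The product of Hessian entries over all slots other than `p`. -/
def cofac (T : Fin n → Cn n → ℂ) (p : Fin n) (σ τ : Equiv.Perm (Fin n)) (x : Cn n) : ℂ :=
  ∏ i ∈ Finset.univ.erase p, cHess (T i) x (σ i) (τ i)

theorem smooth_cofac {T : Fin n → Cn n → ℂ} (hT : ∀ i, Smooth (T i)) (p : Fin n)
    (σ τ : Equiv.Perm (Fin n)) : Smooth (cofac T p σ τ) :=
  Smooth.finset_prod fun i _ => (hT i).cHess_apply _ _

theorem sum_sign_wirt_cofac {T : Fin n → Cn n → ℂ} (hT : ∀ i, Smooth (T i)) (p : Fin n)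
    (τ : Equiv.Perm (Fin n)) (x : Cn n) :
    ∑ σ : Equiv.Perm (Fin n), ((Equiv.Perm.sign σ : ℤ) : ℂ) *
      wirt (-Complex.I) (σ p) (cofac T p σ τ) x = 0 := by
  have h1 : ∀ σ : Equiv.Perm (Fin n), wirt (-Complex.I) (σ p) (cofac T p σ τ) x =
      ∑ l ∈ Finset.univ.erase p, wirt (-Complex.I) (σ p)
        (fun y => cHess (T l) y (σ l) (τ l)) x *
        ∏ i ∈ (Finset.univ.erase p).erase l, cHess (T i) x (σ i) (τ i) := fun σ =>
    wirt_prod (Finset.univ.erase p) (F := fun i y => cHess (T i) y (σ i) (τ i))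
      (fun i => (hT i).cHess_apply _ _) _ _ x
  simp only [h1, Finset.mul_sum]
  rw [Finset.sum_comm]
  refine Finset.sum_eq_zero fun l hl => ?_
  have hlp : l ≠ p := Finset.ne_of_mem_erase hl
  refine Finset.sum_involution (fun σ _ => σ * Equiv.swap p l) ?_ ?_ (fun _ _ => Finset.mem_univ _)
    ?_
  · intro σ _
    have e1 : wirt (-Complex.I) (σ l) (fun y => cHess (T l) y (σ p) (τ l)) x =
        wirt (-Complex.I) (σ p) (fun y => cHess (T l) y (σ l) (τ l)) x :=
      wirt_comm ((hT l).wirt _ _) _ _ _ _ x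
    have e2 : ∏ i ∈ (Finset.univ.erase p).erase l,
        cHess (T i) x ((σ * Equiv.swap p l) i) (τ i) =
        ∏ i ∈ (Finset.univ.erase p).erase l, cHess (T i) x (σ i) (τ i) := by
      refine Finset.prod_congr rfl fun i hi => ?_
      simp only [Finset.mem_erase] at hi
      rw [Equiv.Perm.mul_apply, Equiv.swap_apply_of_ne_of_ne hi.2.1 hi.1]
    rw [e2]
    simp only [Equiv.Perm.mul_apply, Equiv.swap_apply_left, Equiv.swap_apply_right, e1,
      Equiv.Perm.sign_mul, Equiv.Perm.sign_swap hlp.symm]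
    push_cast
    ring
  · intro σ _ _ h
    have := congrArg (fun e : Equiv.Perm (Fin n) => e p) h
    simp only [Equiv.Perm.mul_apply, Equiv.swap_apply_left] at this
    exact hlp (σ.injective this)
  · intro σ _
    simp [mul_assoc]

/-- The mixed gradient form `∂F ∧ ∂̄G ∧ ⋀_{i ≠ p} ∂∂̄T_i`. -/
def gradForm (F G : Cn n → ℂ) (T : Fin n → Cn n → ℂ) (p : Fin n) (x : Cn n) : ℂ :=
  ∑ σ : Equiv.Perm (Fin n), ∑ τ : Equiv.Perm (Fin n),
    ((Equiv.Perm.sign σ : ℤ) : ℂ) * ((Equiv.Perm.sign τ : ℤ) : ℂ) *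
      (wirt (-Complex.I) (σ p) F x * wirt Complex.I (τ p) G x * cofac T p σ τ x)

theorem integral_mul_mixedDisc_update {F G : Cn n → ℂ} {T : Fin n → Cn n → ℂ} (hF : Smooth F)
    (hG : Smooth G) (hT : ∀ i, Smooth (T i)) (hs : HasCompactSupport F ∨ HasCompactSupport G)
    (p : Fin n) :
    ∫ x, F x * mixedDisc (Function.update (fun i => cHess (T i) x) p (cHess G x)) =
      -∫ x, gradForm F G T p x := by
  have hP := fun σ τ => smooth_cofac hT p σ τ
  have hInt : ∀ {A : Cn n → ℂ}, Smooth A → HasCompactSupport A → Integrable A :=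
    fun hA h => (ContDiff.continuous hA).integrable_of_hasCompactSupport h
  have s1 : ∀ σ τ : Equiv.Perm (Fin n), Smooth fun x => F x * cofac T p σ τ x *
      wirt (-Complex.I) (σ p) (wirt Complex.I (τ p) G) x :=
    fun σ τ => (hF.mul (hP σ τ)).mul ((hG.wirt _ _).wirt _ _)
  have s2 : ∀ σ τ : Equiv.Perm (Fin n), Smooth fun x => wirt (-Complex.I) (σ p) F x *
      wirt Complex.I (τ p) G x * cofac T p σ τ x :=
    fun σ τ => ((hF.wirt _ _).mul (hG.wirt _ _)).mul (hP σ τ)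
  have s3 : ∀ σ τ : Equiv.Perm (Fin n), Smooth fun x => F x *
      wirt (-Complex.I) (σ p) (cofac T p σ τ) x * wirt Complex.I (τ p) G x :=
    fun σ τ => (hF.mul ((hP σ τ).wirt _ _)).mul (hG.wirt _ _)
  have i1 : ∀ σ τ : Equiv.Perm (Fin n), Integrable fun x => F x * cofac T p σ τ x *
      wirt (-Complex.I) (σ p) (wirt Complex.I (τ p) G) x := by
    intro σ τ
    refine hInt (s1 σ τ) ?_
    rcases hs with h | h
    · exact (h.mul_right (f' := cofac T p σ τ)).mul_right
    · exact ((h.wirt _ _).wirt _ _).mul_left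
  have i2 : ∀ σ τ : Equiv.Perm (Fin n), Integrable fun x => wirt (-Complex.I) (σ p) F x *
      wirt Complex.I (τ p) G x * cofac T p σ τ x := by
    intro σ τ
    refine hInt (s2 σ τ) ?_
    rcases hs with h | h
    · exact ((h.wirt _ _).mul_right (f' := wirt Complex.I (τ p) G)).mul_right
    · exact ((h.wirt _ _).mul_left (f := wirt (-Complex.I) (σ p) F)).mul_right
  have i3 : ∀ σ τ : Equiv.Perm (Fin n), Integrable fun x => F x *
      wirt (-Complex.I) (σ p) (cofac T p σ τ) x * wirt Complex.I (τ p) G x := by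
    intro σ τ
    refine hInt (s3 σ τ) ?_
    rcases hs with h | h
    · exact (h.mul_right (f' := wirt (-Complex.I) (σ p) (cofac T p σ τ))).mul_right
    · exact (h.wirt _ _).mul_left
  have hibp : ∀ σ τ : Equiv.Perm (Fin n), ∫ x, F x * cofac T p σ τ x *
      wirt (-Complex.I) (σ p) (wirt Complex.I (τ p) G) x =
      -(∫ x, wirt (-Complex.I) (σ p) F x * wirt Complex.I (τ p) G x * cofac T p σ τ x) -
        ∫ x, F x * wirt (-Complex.I) (σ p) (cofac T p σ τ) x * wirt Complex.I (τ p) G x := by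
    intro σ τ
    have h0 := integral_mul_wirt (hF.mul (hP σ τ)) (hG.wirt Complex.I (τ p))
      (hs.imp (fun h => h.mul_right) fun h => h.wirt _ _) (-Complex.I) (σ p)
    rw [h0, ← neg_add', ← integral_add (i2 σ τ) (i3 σ τ)]
    congr 1
    refine integral_congr_ae (Eventually.of_forall fun x => ?_)
    simp only []
    rw [wirt_mul hF (hP σ τ)]
    ring
  have hl : ∀ x, F x * mixedDisc (Function.update (fun i => cHess (T i) x) p (cHess G x)) =
      ∑ τ : Equiv.Perm (Fin n), ∑ σ : Equiv.Perm (Fin n),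
        ((Equiv.Perm.sign σ : ℤ) : ℂ) * ((Equiv.Perm.sign τ : ℤ) : ℂ) *
        (F x * cofac T p σ τ x * wirt (-Complex.I) (σ p) (wirt Complex.I (τ p) G) x) := by
    intro x
    rw [mixedDisc_update, Finset.sum_comm, Finset.mul_sum]
    refine Finset.sum_congr rfl fun τ _ => ?_
    rw [Finset.mul_sum]
    refine Finset.sum_congr rfl fun σ _ => ?_
    simp only [cHess, cofac, Matrix.of_apply]
    ring
  have hz : ∀ τ : Equiv.Perm (Fin n), ∑ σ : Equiv.Perm (Fin n),
      ((Equiv.Perm.sign σ : ℤ) : ℂ) * ((Equiv.Perm.sign τ : ℤ) : ℂ) *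
      (∫ x, F x * wirt (-Complex.I) (σ p) (cofac T p σ τ) x * wirt Complex.I (τ p) G x) = 0 := by
    intro τ
    simp only [← integral_const_mul]
    rw [← integral_finsetSum _ fun σ _ => (i3 σ τ).const_mul _]
    refine (integral_congr_ae (Eventually.of_forall fun x => ?_)).trans (integral_zero' _ _)
    have := sum_sign_wirt_cofac hT p τ x
    simp only [Pi.zero_apply]
    rw [← mul_zero (((Equiv.Perm.sign τ : ℤ) : ℂ) * F x * wirt Complex.I (τ p) G x), ← this,
      Finset.mul_sum]
    exact Finset.sum_congr rfl fun σ _ => by ring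
  simp only [hl]
  rw [integral_finsetSum _ fun τ _ => integrable_finsetSum _ fun σ _ => (i1 σ τ).const_mul _]
  simp only [gradForm]
  rw [integral_finsetSum _ fun σ _ => integrable_finsetSum _ fun τ _ => (i2 σ τ).const_mul _]
  rw [Finset.sum_congr rfl fun σ _ => integral_finsetSum _ fun τ _ => (i2 σ τ).const_mul _,
    Finset.sum_congr rfl fun τ _ => integral_finsetSum _ fun σ _ => (i1 σ τ).const_mul _]
  simp only [integral_const_mul, hibp, mul_sub, Finset.sum_sub_distrib, hz]
  rw [Finset.sum_comm]
  simp

theorem mixedDisc_star_eq {S : Fin n → Cn n → ℝ} (hS : ∀ i, Smooth (S i)) (x : Cn n) :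
    star (mixedDisc fun i => hess (S i) x) = mixedDisc fun i => hess (S i) x := by
  rw [star_mixedDisc]
  simp only [hess_conjTranspose (hS _)]

theorem ofReal_mixedMA {S : Fin n → Cn n → ℝ} (hS : ∀ i, Smooth (S i)) (x : Cn n) :
    ((mixedMA S x : ℝ) : ℂ) = mixedDisc fun i => hess (S i) x :=
  Complex.conj_eq_iff_re.mp (mixedDisc_star_eq hS x)

theorem hess_update (T : Fin n → Cn n → ℝ) (p : Fin n) (g : Cn n → ℝ) (x : Cn n) :
    (fun i => hess (Function.update T p g i) x) =
      Function.update (fun i => hess (T i) x) p (hess g x) := by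
  funext i
  by_cases h : i = p
  · subst h; simp
  · simp [h]

theorem Smooth.update {T : Fin n → Cn n → ℝ} (hT : ∀ i, Smooth (T i)) {g : Cn n → ℝ}
    (hg : Smooth g) (p : Fin n) (i : Fin n) : Smooth (Function.update T p g i) := by
  by_cases h : i = p
  · subst h; simpa using hg
  · simpa [h] using hT i

/-- Integration by parts for mixed Monge–Ampère densities. -/
theorem integral_mul_mixedMA_update {f g : Cn n → ℝ} {T : Fin n → Cn n → ℝ} (hf : Smooth f)
    (hg : Smooth g) (hT : ∀ i, Smooth (T i)) (hs : HasCompactSupport f) (p : Fin n) :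
    ∫ x, f x * mixedMA (Function.update T p g) x =
      ∫ x, g x * mixedMA (Function.update T p f) x := by
  have hT' : ∀ i, Smooth fun y => (T i y : ℂ) := fun i => (hT i).ofReal
  have hs' : HasCompactSupport fun y => (f y : ℂ) := hs.comp_left Complex.ofReal_zero
  have e1 := integral_mul_mixedDisc_update hf.ofReal hg.ofReal hT' (Or.inl hs') p
  have e2 := integral_mul_mixedDisc_update hg.ofReal hf.ofReal hT' (Or.inr hs') p
  have l : ∀ {a b : Cn n → ℝ}, Smooth b → ((∫ x, a x * mixedMA (Function.update T p b) x : ℝ) : ℂ) =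
      ∫ x, (a x : ℂ) * mixedDisc (Function.update (fun i => cHess (fun y => (T i y : ℂ)) x) p
        (cHess (fun y => (b y : ℂ)) x)) := by
    intro a b hb
    rw [← integral_complex_ofReal]
    refine integral_congr_ae (Eventually.of_forall fun x => ?_)
    simp only [Complex.ofReal_mul]
    rw [ofReal_mixedMA (Smooth.update hT hb p), hess_update]
    rfl
  have key : ∫ x, gradForm (fun y => (g y : ℂ)) (fun y => (f y : ℂ)) (fun i y => (T i y : ℂ)) p x =
      star (∫ x, gradForm (fun y => (f y : ℂ)) (fun y => (g y : ℂ))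
        (fun i y => (T i y : ℂ)) p x) := by
    rw [Complex.star_def, ← integral_conj]
    refine integral_congr_ae (Eventually.of_forall fun x => ?_)
    simp only [gradForm]
    rw [Finset.sum_comm, ← Complex.star_def, star_sum]
    refine Finset.sum_congr rfl fun σ _ => ?_
    rw [star_sum]
    refine Finset.sum_congr rfl fun τ _ => ?_
    have c1 : star (cofac (fun i y => (T i y : ℂ)) p σ τ x) =
        cofac (fun i y => (T i y : ℂ)) p τ σ x := by
      simp only [cofac, star_prod]
      refine Finset.prod_congr rfl fun i _ => ?_
      have := congrFun (congrFun (hess_conjTranspose (hT i) x) (τ i)) (σ i)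
      rwa [Matrix.conjTranspose_apply] at this
    simp only [star_mul', c1, star_wirt hf.ofReal, star_wirt hg.ofReal, Complex.star_def,
      Complex.conj_ofReal, Complex.conj_I, map_neg, neg_neg, map_intCast]
    ring
  apply Complex.ofReal_injective
  rw [l hg, l hf, e1, e2, key, ← star_neg, ← e1, ← l hg, Complex.star_def, Complex.conj_ofReal]

end

section
variable {n : ℕ}

theorem cHess_add {F G : Cn n → ℂ} (hF : Smooth F) (hG : Smooth G) (x : Cn n) :
    cHess (fun y => F y + G y) x = cHess F x + cHess G x := by
  ext j k
  simp only [cHess, Matrix.of_apply, Matrix.add_apply]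
  rw [← wirt_add (hF.wirt _ _) (hG.wirt _ _)]
  congr 1
  funext y
  exact wirt_add hF hG _ _ y

theorem hess_add {u v : Cn n → ℝ} (hu : Smooth u) (hv : Smooth v) (x : Cn n) :
    hess (fun y => u y + v y) x = hess u x + hess v x := by
  rw [hess, hess, hess, ← cHess_add hu.ofReal hv.ofReal]
  simp

theorem wirt_ofReal_comp {F : ℝ → ℝ} (hF : Smooth F) {h : Cn n → ℝ} (hh : Smooth h) (c : ℂ)
    (j : Fin n) (x : Cn n) : wirt c j (fun y => ((F (h y) : ℝ) : ℂ)) x =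
      ((deriv F (h x) : ℝ) : ℂ) * wirt c j (fun y => (h y : ℂ)) x := by
  have e1 : fderiv ℝ (fun y => ((F (h y) : ℝ) : ℂ)) x =
      Complex.ofRealCLM.comp (deriv F (h x) • fderiv ℝ h x) :=
    (Complex.ofRealCLM.hasFDerivAt.comp x ((hF.diff (h x)).hasDerivAt.comp_hasFDerivAt x
      (hh.diff x).hasFDerivAt)).fderiv
  have e2 : fderiv ℝ (fun y => ((h y : ℝ) : ℂ)) x = Complex.ofRealCLM.comp (fderiv ℝ h x) :=
    (Complex.ofRealCLM.hasFDerivAt.comp x (hh.diff x).hasFDerivAt).fderiv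
  simp only [wirt, e1, e2, ContinuousLinearMap.comp_apply, smul_apply, smul_eq_mul,
    Complex.ofRealCLM_apply, Complex.ofReal_mul]
  ring

theorem Smooth.deriv {F : ℝ → ℝ} (hF : Smooth F) : Smooth (deriv F) :=
  (hF.fderiv_apply 1)

theorem Smooth.comp {V W X : Type*} [NormedAddCommGroup V] [NormedSpace ℝ V]
    [NormedAddCommGroup W] [NormedSpace ℝ W] [NormedAddCommGroup X] [NormedSpace ℝ X]
    {G : W → X} {F : V → W} (hG : Smooth G) (hF : Smooth F) : Smooth fun x => G (F x) :=
  ContDiff.comp hG hF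

/-- The complex gradient `(∂h/∂z_j)_j`. -/
def cGrad (h : Cn n → ℝ) (x : Cn n) : Fin n → ℂ :=
  fun j => wirt (-Complex.I) j (fun y => (h y : ℂ)) x

theorem hess_comp {F : ℝ → ℝ} (hF : Smooth F) {h : Cn n → ℝ} (hh : Smooth h) (x : Cn n) :
    hess (fun y => F (h y)) x = ((deriv F (h x) : ℝ) : ℂ) • hess h x +
      ((deriv (deriv F) (h x) : ℝ) : ℂ) • Matrix.vecMulVec (cGrad h x) (star (cGrad h x)) := by
  ext j k
  have e1 : wirt Complex.I k (fun y => ((F (h y) : ℝ) : ℂ)) = fun y =>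
      ((deriv F (h y) : ℝ) : ℂ) * wirt Complex.I k (fun y => (h y : ℂ)) y :=
    funext fun y => wirt_ofReal_comp hF hh _ _ y
  have e2 : star (cGrad h x k) = wirt Complex.I k (fun y => (h y : ℂ)) x := by
    rw [cGrad, star_wirt hh.ofReal]
    simp
  simp only [hess, cHess, Matrix.of_apply, Matrix.add_apply, Matrix.smul_apply, smul_eq_mul,
    Matrix.vecMulVec_apply, Pi.star_apply, e2]
  rw [e1, wirt_mul (hF.deriv.comp hh).ofReal (hh.ofReal.wirt _ _), wirt_ofReal_comp hF.deriv hh]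
  simp only [cGrad]
  ring

theorem hess_const_mul (c : ℝ) {u : Cn n → ℝ} (hu : Smooth u) (x : Cn n) :
    hess (fun y => c * u y) x = (c : ℂ) • hess u x := by
  have hF : Smooth fun t : ℝ => c * t := contDiff_const.mul contDiff_id
  have d : deriv (fun t : ℝ => c * t) = fun _ => c := by
    funext t; simp
  rw [hess_comp hF hu, d]
  simp

theorem hess_add_const (c : ℝ) {u : Cn n → ℝ} (hu : Smooth u) (x : Cn n) :
    hess (fun y => u y + c) x = hess u x := by
  have hF : Smooth fun t : ℝ => t + c := contDiff_id.add contDiff_const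
  have d : deriv (fun t : ℝ => t + c) = fun _ => 1 := by
    funext t; simp
  rw [hess_comp hF hu, d]
  simp

theorem hess_sub {u v : Cn n → ℝ} (hu : Smooth u) (hv : Smooth v) (x : Cn n) :
    hess (fun y => u y - v y) x = hess u x - hess v x := by
  have h := hess_add (hu.sub hv) hv x
  simp only [sub_add_cancel] at h
  exact eq_sub_of_add_eq h.symm

theorem hess_congr {u v : Cn n → ℝ} {x : Cn n} (h : u =ᶠ[𝓝 x] v) : hess u x = hess v x := by
  have key : ∀ {F G : Cn n → ℂ} (c : ℂ) (j : Fin n), F =ᶠ[𝓝 x] G →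
      wirt c j F =ᶠ[𝓝 x] wirt c j G := by
    intro F G c j hFG
    filter_upwards [hFG.fderiv (𝕜 := ℝ)] with y hy
    rw [wirt, wirt, hy]
  ext j k
  exact (key _ j (key _ k (h.fun_comp Complex.ofReal))).eq_of_nhds

theorem hess_eq_zero_of_notMem {h : Cn n → ℝ} {L : Set (Cn n)} (hL : IsClosed L)
    (h0 : ∀ x ∉ L, h x = 0) {x : Cn n} (hx : x ∉ L) : hess h x = 0 := by
  rw [hess_congr (v := fun _ => 0) (by
    filter_upwards [hL.isOpen_compl.mem_nhds hx] with y hy using h0 y hy)]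
  have h1 : ∀ (c : ℂ) (j : Fin n), wirt c j (fun _ => 0) = fun _ => 0 := by
    intro c j; funext y; simp [wirt]
  ext j k
  simp [hess, cHess, h1]

theorem mixedMA_update (T : Fin n → Cn n → ℝ) (p : Fin n) (g : Cn n → ℝ) (x : Cn n) :
    mixedMA (Function.update T p g) x =
      (mixedDisc (Function.update (fun i => hess (T i) x) p (hess g x))).re := by
  rw [mixedMA, hess_update]

theorem mixedMA_update_add (T : Fin n → Cn n → ℝ) (p : Fin n) {u v : Cn n → ℝ} (hu : Smooth u)
    (hv : Smooth v) (x : Cn n) : mixedMA (Function.update T p fun y => u y + v y) x =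
      mixedMA (Function.update T p u) x + mixedMA (Function.update T p v) x := by
  simp only [mixedMA_update, hess_add hu hv, mixedDisc_update_add, Complex.add_re]

theorem mixedMA_update_sub (T : Fin n → Cn n → ℝ) (p : Fin n) {u v : Cn n → ℝ} (hu : Smooth u)
    (hv : Smooth v) (x : Cn n) : mixedMA (Function.update T p fun y => u y - v y) x =
      mixedMA (Function.update T p u) x - mixedMA (Function.update T p v) x := by
  have h := mixedMA_update_add T p (hu.sub hv) hv x
  simp only [sub_add_cancel] at h
  exact eq_sub_of_add_eq h.symm

theorem mixedMA_update_add_const (T : Fin n → Cn n → ℝ) (p : Fin n) {u : Cn n → ℝ}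
    (hu : Smooth u) (c : ℝ) (x : Cn n) : mixedMA (Function.update T p fun y => u y + c) x =
      mixedMA (Function.update T p u) x := by
  simp only [mixedMA_update, hess_add_const c hu]

theorem mixedMA_update_zero (T : Fin n → Cn n → ℝ) (p : Fin n) {g : Cn n → ℝ} {x : Cn n}
    (hg : hess g x = 0) : mixedMA (Function.update T p g) x = 0 := by
  have h := mixedDisc_update_smul (fun i => hess (T i) x) p 0 0
  rw [mixedMA_update, hg, ← zero_smul ℂ (0 : Matrix (Fin n) (Fin n) ℂ), h]
  simp

open scoped ComplexOrder in
/-- Smooth functions whose complex Hessian is positive semidefinite at the points of `L`. -/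
def SPSH (L : Set (Cn n)) (u : Cn n → ℝ) : Prop :=
  Smooth u ∧ ∀ x ∈ L, (hess u x).PosSemidef

theorem mixedMA_nonneg {L : Set (Cn n)} {T : Fin n → Cn n → ℝ} (hT : ∀ i, SPSH L (T i))
    {x : Cn n} (hx : x ∈ L) : 0 ≤ mixedMA T x :=
  mixedDisc_nonneg _ fun i => (hT i).2 x hx

theorem SPSH.update {L : Set (Cn n)} {T : Fin n → Cn n → ℝ} (hT : ∀ i, SPSH L (T i))
    {g : Cn n → ℝ} (hg : SPSH L g) (p : Fin n) (i : Fin n) : SPSH L (Function.update T p g i) := by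
  by_cases h : i = p
  · subst h; simpa using hg
  · simpa [h] using hT i

open scoped ComplexOrder in
theorem mixedMA_update_mono {L : Set (Cn n)} {T : Fin n → Cn n → ℝ} (hT : ∀ i, SPSH L (T i))
    (p : Fin n) {u : Cn n → ℝ} {x : Cn n} (hx : x ∈ L) {c : ℝ} {g : Cn n → ℝ}
    (h : (hess u x - (c : ℂ) • hess g x).PosSemidef) :
    c * mixedMA (Function.update T p g) x ≤ mixedMA (Function.update T p u) x := by
  rw [mixedMA_update, mixedMA_update, ← Complex.re_ofReal_mul, ← mixedDisc_update_smul]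
  have h2 := mixedDisc_update_add (fun i => hess (T i) x) p (hess u x - (c : ℂ) • hess g x)
    ((c : ℂ) • hess g x)
  rw [sub_add_cancel] at h2
  rw [h2, Complex.add_re, le_add_iff_nonneg_left]
  refine mixedDisc_nonneg _ fun i => ?_
  by_cases hi : i = p
  · subst hi; simpa using h
  · simpa [hi] using (hT i).2 x hx

theorem integrable_mul_mixedMA {h : Cn n → ℝ} {L : Set (Cn n)} (hL : IsCompact L)
    (hh : Continuous h) (h0 : ∀ x ∉ L, h x = 0) {T : Fin n → Cn n → ℝ} (hT : ∀ i, Smooth (T i)) :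
    Integrable fun x => h x * mixedMA T x :=
  (hh.mul (ContDiff.continuous (smooth_mixedMA hT))).integrable_of_hasCompactSupport
    ((HasCompactSupport.intro hL h0).mul_right)

open scoped ComplexOrder in
theorem hess_comp_sub_posSemidef {F : ℝ → ℝ} (hF : Smooth F) {h : Cn n → ℝ} (hh : Smooth h)
    {x : Cn n} (hc : 0 ≤ deriv (deriv F) (h x)) :
    (hess (fun y => F (h y)) x - ((deriv F (h x) : ℝ) : ℂ) • hess h x).PosSemidef := by
  rw [hess_comp hF hh, add_sub_cancel_left]
  exact (Matrix.posSemidef_vecMulVec_self_star _).smul (Complex.zero_le_real.mpr hc)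

open scoped ComplexOrder in
theorem integral_pow_mul_mixedMA_step {L : Set (Cn n)} (hL : IsCompact L) {h w u : Cn n → ℝ}
    (hh : Smooth h) (hpos : ∀ x, 0 ≤ h x) (h0 : ∀ x ∉ L, h x = 0) (hw : SPSH L w)
    (hwh : SPSH L fun x => w x + h x) (hu : SPSH L u) {a b : ℝ}
    (hub : ∀ x ∈ L, a ≤ u x ∧ u x ≤ b)
    {T : Fin n → Cn n → ℝ} (hT : ∀ i, SPSH L (T i)) (q : Fin n) {p : ℕ} (hp : 1 ≤ p) :
    ∫ x, h x ^ (p + 1) * mixedMA (Function.update T q u) x ≤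
      (p + 1) * (b - a) * ∫ x, h x ^ p * mixedMA (Function.update T q w) x := by
  have hTs := fun i => (hT i).1
  have hF : Smooth fun t : ℝ => t ^ (p + 1) := contDiff_id.pow _
  have hpow : Smooth fun x => h x ^ (p + 1) := hF.comp hh
  have hpow0 : ∀ x ∉ L, h x ^ (p + 1) = 0 := fun x hx => by simp [h0 x hx]
  have hpow0' : ∀ x ∉ L, h x ^ p = 0 := fun x hx => by
    rw [h0 x hx, zero_pow (by omega)]
  have hub' : Smooth fun x => u x + (-b) := hu.1.add contDiff_const
  have hcs := HasCompactSupport.intro hL hpow0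
  have e1 : ∫ x, h x ^ (p + 1) * mixedMA (Function.update T q u) x =
      ∫ x, (u x + (-b)) * mixedMA (Function.update T q fun y => h y ^ (p + 1)) x := by
    rw [← integral_mul_mixedMA_update hpow hub' hTs hcs q]
    simp only [mixedMA_update_add_const T q hu.1]
  have d1 : deriv (fun t : ℝ => t ^ (p + 1)) = fun t => ((p + 1 : ℕ) : ℝ) * t ^ p := by
    funext t; simp
  have d2 : ∀ t, deriv (deriv fun t : ℝ => t ^ (p + 1)) t =
      ((p + 1 : ℕ) : ℝ) * (p * t ^ (p - 1)) := by
    intro t; rw [d1]; simp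
  rw [e1, ← integral_const_mul]
  have i1 : Integrable fun x => (u x + (-b)) *
      mixedMA (Function.update T q fun y => h y ^ (p + 1)) x := by
    refine ((ContDiff.continuous hub').mul (ContDiff.continuous (smooth_mixedMA
      (Smooth.update hTs hpow q)))).integrable_of_hasCompactSupport
        (HasCompactSupport.intro hL fun x hx => ?_)
    exact mul_eq_zero_of_right _
      (mixedMA_update_zero _ _ (hess_eq_zero_of_notMem hL.isClosed hpow0 hx))
  have i2 : Integrable fun x => (p + 1) * (b - a) * (h x ^ p *
      mixedMA (Function.update T q w) x) :=
    (integrable_mul_mixedMA hL ((ContDiff.continuous hh).pow p) hpow0'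
      (Smooth.update hTs hw.1 q)).const_mul _
  refine integral_mono i1 i2 fun x => ?_
  by_cases hx : x ∈ L
  · have h3 := mixedMA_update_mono hT q hx
      (hess_comp_sub_posSemidef hF hh (x := x) (by
        rw [d2]
        have := hpos x
        positivity))
    simp only [d1] at h3
    have h4 : mixedMA (Function.update T q h) x =
        mixedMA (Function.update T q fun y => w y + h y) x -
          mixedMA (Function.update T q w) x := by
      rw [mixedMA_update_add T q hw.1 hh]; ring
    have h5 := mixedMA_nonneg (SPSH.update hT hwh q) hx
    have h6 := mixedMA_nonneg (SPSH.update hT hw q) hx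
    have hp0 : (0 : ℝ) ≤ p + 1 := by positivity
    have h7 : 0 ≤ h x ^ p := pow_nonneg (hpos x) p
    obtain ⟨ha, hb⟩ := hub x hx
    rw [h4] at h3
    push_cast at h3
    have h8 : -((p + 1) * h x ^ p * mixedMA (Function.update T q w) x) ≤
        mixedMA (Function.update T q fun y => h y ^ (p + 1)) x := by
      have : 0 ≤ ((p : ℝ) + 1) * h x ^ p *
        mixedMA (Function.update T q fun y => w y + h y) x := mul_nonneg (mul_nonneg hp0 h7) h5
      linarith
    have h9 : 0 ≤ (p + 1) * h x ^ p * mixedMA (Function.update T q w) x :=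
      mul_nonneg (mul_nonneg hp0 h7) h6
    have h10 := mul_le_mul_of_nonpos_left h8 (by linarith : u x + -b ≤ 0)
    have h11 := mul_le_mul_of_nonneg_right (by linarith : b - u x ≤ b - a) h9
    linarith
  · simp only [hpow0' x hx, zero_mul, mul_zero]
    rw [mixedMA_update_zero _ _ (hess_eq_zero_of_notMem hL.isClosed hpow0 hx), mul_zero]

/-- The constant in Błocki's inequality. -/
def chainConst (n : ℕ) (M : ℝ) : ℝ := ((n + 1).descFactorial n : ℝ) * M ^ n

theorem chainConst_nonneg {M : ℝ} (hM : 0 ≤ M) : 0 ≤ chainConst n M := by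
  unfold chainConst; positivity

/-- Błocki's inequality: the mass of `hⁿ⁺¹` with respect to bounded psh functions is controlled
by the mass of `h` with respect to `w`. -/
theorem integral_pow_mul_mixedMA_le {L : Set (Cn n)} (hL : IsCompact L) {h w : Cn n → ℝ}
    (hh : Smooth h) (hpos : ∀ x, 0 ≤ h x) (h0 : ∀ x ∉ L, h x = 0) (hw : SPSH L w)
    (hwh : SPSH L fun x => w x + h x) {u : Fin n → Cn n → ℝ} (hu : ∀ i, SPSH L (u i)) {a b : ℝ}
    (hab : a ≤ b) (hub : ∀ i, ∀ x ∈ L, a ≤ u i x ∧ u i x ≤ b) :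
    ∫ x, h x ^ (n + 1) * mixedMA u x ≤
      chainConst n (b - a) * ∫ x, h x * mixedMA (fun _ => w) x := by
  have key : ∀ k, k ≤ n → ∫ x, h x ^ (n + 1) * mixedMA u x ≤
      ((n + 1).descFactorial k : ℝ) * (b - a) ^ k *
        ∫ x, h x ^ (n + 1 - k) * mixedMA (fun i => if (i : ℕ) < k then w else u i) x := by
    intro k
    induction k with
    | zero => intro _; simp
    | succ k ih =>
      intro hk
      refine (ih (by omega)).trans ?_
      let T : Fin n → Cn n → ℝ := fun i => if (i : ℕ) < k then w else u i
      let q : Fin n := ⟨k, by omega⟩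
      have hT : ∀ i, SPSH L (T i) := by
        intro i; simp only [T]; split_ifs
        · exact hw
        · exact hu i
      have e1 : T = Function.update T q (u q) := by
        rw [eq_comm, Function.update_eq_self_iff]
        simp [T, q]
      have e2 : (fun i : Fin n => if (i : ℕ) < k + 1 then w else u i) = Function.update T q w := by
        funext i
        by_cases hi : i = q
        · subst hi; simp [q]
        · have : (i : ℕ) ≠ k := fun h => hi (Fin.ext h)
          rw [Function.update_of_ne hi]
          simp only [T]
          have : (i : ℕ) < k + 1 ↔ (i : ℕ) < k := by omega
          simp [this]
      have st := integral_pow_mul_mixedMA_step hL hh hpos h0 hw hwh (hu q) (hub q) hT q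
        (p := n - k) (by omega)
      rw [← e1, ← e2] at st
      have n1 : n + 1 - k = n - k + 1 := by omega
      have n2 : n + 1 - (k + 1) = n - k := by omega
      rw [n1, n2, Nat.descFactorial_succ, n1]
      have hc : (0 : ℝ) ≤ ((n + 1).descFactorial k : ℝ) * (b - a) ^ k :=
        mul_nonneg (Nat.cast_nonneg _) (pow_nonneg (by linarith) _)
      refine (mul_le_mul_of_nonneg_left st hc).trans (le_of_eq ?_)
      push_cast
      ring
  have := key n le_rfl
  simpa [chainConst] using this

end

section
variable {n : ℕ}

/-- The sequence of slots `c, …, c, a, …, a, b, …, b`. -/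
def slots (a b c : Cn n → ℝ) (i m : ℕ) (l : Fin n) : Cn n → ℝ :=
  if (l : ℕ) < i then c else if (l : ℕ) < m then a else b

theorem mixedMA_comp_perm (T : Fin n → Cn n → ℝ) (e : Equiv.Perm (Fin n)) (x : Cn n) :
    mixedMA (T ∘ e) x = mixedMA T x := by
  unfold mixedMA
  rw [← mixedDisc_comp_perm (fun i => hess (T i) x) e]
  rfl

theorem smooth_slots {a b c : Cn n → ℝ} (ha : Smooth a) (hb : Smooth b) (hc : Smooth c)
    (i m : ℕ) (l : Fin n) : Smooth (slots a b c i m l) := by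
  unfold slots; split_ifs <;> assumption

theorem slots_update_self (a b c : Cn n → ℝ) {i m : ℕ} (him : i < m) (hm : m ≤ n) :
    Function.update (slots a b c i m) ⟨i, him.trans_le hm⟩ a = slots a b c i m := by
  rw [Function.update_eq_self_iff]
  simp [slots, him]

theorem slots_update_succ (a b c : Cn n → ℝ) {i m : ℕ} (him : i < m) (hm : m ≤ n) :
    Function.update (slots a b c i m) ⟨i, him.trans_le hm⟩ c = slots a b c (i + 1) m := by
  funext l
  by_cases hl : l = ⟨i, him.trans_le hm⟩
  · subst hl; simp [slots]
  · have : (l : ℕ) ≠ i := fun h => hl (Fin.ext h)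
    rw [Function.update_of_ne hl]
    have h2 : (l : ℕ) < i + 1 ↔ (l : ℕ) < i := by omega
    simp [slots, h2]

theorem mixedMA_slots_update_base (a b c : Cn n → ℝ) {i m : ℕ} (him : i < m + 1) (hm : m + 1 ≤ n)
    (x : Cn n) : mixedMA (Function.update (slots a b c i (m + 1)) ⟨i, him.trans_le hm⟩ b) x =
      mixedMA (slots a b c i m) x := by
  rw [← mixedMA_comp_perm (slots a b c i m)
    (Equiv.swap ⟨i, him.trans_le hm⟩ ⟨m, (Nat.lt_succ_self m).trans_le hm⟩)]
  congr 1
  funext l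
  rw [Function.comp_apply]
  by_cases hl : l = ⟨i, him.trans_le hm⟩
  · subst hl
    have : ¬ m < i := by omega
    simp [slots, this]
  · have hli : (l : ℕ) ≠ i := fun h => hl (Fin.ext h)
    rw [Function.update_of_ne hl]
    by_cases hl2 : l = ⟨m, (Nat.lt_succ_self m).trans_le hm⟩
    · subst hl2
      have h1 : i ≠ m := fun h => hli (by simp [h])
      have h2 : i < m := by omega
      have h3 : ¬ m < i := by omega
      simp [slots, h2, h3]
    · have hlm : (l : ℕ) ≠ m := fun h => hl2 (Fin.ext h)
      rw [Equiv.swap_apply_of_ne_of_ne hl hl2]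
      have h2 : (l : ℕ) < m + 1 ↔ (l : ℕ) < m := by omega
      simp [slots, h2]

theorem slots_zero (a b c : Cn n → ℝ) (m : ℕ) : slots a b c 0 m = slots b b a m m := by
  funext l; simp [slots]

theorem slots_self (a b c d : Cn n → ℝ) (m : ℕ) : slots a b c m m = slots d b c m m := by
  funext l
  by_cases h : (l : ℕ) < m <;> simp [slots, h]

theorem slots_full (a b c : Cn n → ℝ) : slots a b c n n = fun _ => c := by
  funext l; simp [slots]

/-- The Monge–Ampère energy of `W` relative to `ψ`. -/
def energy (ψ W : Cn n → ℝ) : ℝ :=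
  ∑ m ∈ Finset.range (n + 1), ∫ x, (W x - ψ x) * mixedMA (slots ψ ψ W m m) x

theorem energy_sub_energy {L : Set (Cn n)} (hL : IsCompact L) {ψ a c : Cn n → ℝ} (hψ : Smooth ψ)
    (ha : Smooth a) (hc : Smooth c) (haL : ∀ x ∉ L, a x = ψ x) (hcL : ∀ x ∉ L, c x = ψ x) :
    energy ψ c - energy ψ a =
      ∑ i ∈ Finset.range (n + 1), ∫ x, (c x - a x) * mixedMA (slots a ψ c i n) x := by
  have hT := fun i m => smooth_slots ha hψ hc i m
  have hY : Smooth fun x => c x - a x := hc.sub ha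
  have hZ : Smooth fun x => a x - ψ x := ha.sub hψ
  have hY0 : ∀ x ∉ L, c x - a x = 0 := fun x hx => by rw [haL x hx, hcL x hx, sub_self]
  have hZ0 : ∀ x ∉ L, a x - ψ x = 0 := fun x hx => by rw [haL x hx, sub_self]
  have hX0 : ∀ x ∉ L, c x - ψ x = 0 := fun x hx => by rw [hcL x hx, sub_self]
  have iY := fun i m => integrable_mul_mixedMA hL (ContDiff.continuous hY) hY0 (hT i m)
  have iZ := fun i m => integrable_mul_mixedMA hL (ContDiff.continuous hZ) hZ0 (hT i m)
  have iX := fun i m => integrable_mul_mixedMA hL (ContDiff.continuous (hc.sub hψ)) hX0 (hT i m)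
  let S : ℕ → ℝ := fun m =>
    ∑ i ∈ Finset.range (m + 1), ∫ x, (c x - a x) * mixedMA (slots a ψ c i m) x
  have hstep : ∀ m, m + 1 ≤ n → (∫ x, (c x - ψ x) * mixedMA (slots ψ ψ c (m + 1) (m + 1)) x) -
      (∫ x, (a x - ψ x) * mixedMA (slots ψ ψ a (m + 1) (m + 1)) x) = S (m + 1) - S m := by
    intro m hm
    have t1 : ∀ i (hi : i < m + 1), (∫ x, (a x - ψ x) * mixedMA (slots a ψ c (i + 1) (m + 1)) x) -
        (∫ x, (a x - ψ x) * mixedMA (slots a ψ c i (m + 1)) x) =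
        (∫ x, (c x - a x) * mixedMA (slots a ψ c i (m + 1)) x) -
        ∫ x, (c x - a x) * mixedMA (slots a ψ c i m) x := by
      intro i hi
      have h1 : ∀ x, mixedMA (Function.update (slots a ψ c i (m + 1)) ⟨i, hi.trans_le hm⟩
          fun y => c y - a y) x = mixedMA (slots a ψ c (i + 1) (m + 1)) x -
            mixedMA (slots a ψ c i (m + 1)) x := by
        intro x
        rw [mixedMA_update_sub _ _ hc ha, slots_update_succ a ψ c hi hm,
          slots_update_self a ψ c hi hm]
      have h2 : ∀ x, mixedMA (Function.update (slots a ψ c i (m + 1)) ⟨i, hi.trans_le hm⟩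
          fun y => a y - ψ y) x = mixedMA (slots a ψ c i (m + 1)) x -
            mixedMA (slots a ψ c i m) x := by
        intro x
        rw [mixedMA_update_sub _ _ ha hψ, mixedMA_slots_update_base a ψ c hi hm,
          slots_update_self a ψ c hi hm]
      have h3 := integral_mul_mixedMA_update hZ hY (hT i (m + 1)) (HasCompactSupport.intro hL hZ0)
        ⟨i, hi.trans_le hm⟩
      simp only [h1, h2, mul_sub] at h3
      rwa [integral_sub (iZ _ _) (iZ _ _), integral_sub (iY _ _) (iY _ _)] at h3
    have t2 : (∫ x, (a x - ψ x) * mixedMA (slots a ψ c (m + 1) (m + 1)) x) -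
        (∫ x, (a x - ψ x) * mixedMA (slots a ψ c 0 (m + 1)) x) =
        ∑ i ∈ Finset.range (m + 1), ((∫ x, (c x - a x) * mixedMA (slots a ψ c i (m + 1)) x) -
        ∫ x, (c x - a x) * mixedMA (slots a ψ c i m) x) := by
      rw [← Finset.sum_range_sub (fun i => ∫ x, (a x - ψ x) *
        mixedMA (slots a ψ c i (m + 1)) x) (m + 1)]
      exact Finset.sum_congr rfl fun i hi => t1 i (Finset.mem_range.mp hi)
    have t3 : (∫ x, (c x - ψ x) * mixedMA (slots a ψ c (m + 1) (m + 1)) x) =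
        (∫ x, (c x - a x) * mixedMA (slots a ψ c (m + 1) (m + 1)) x) +
        ∫ x, (a x - ψ x) * mixedMA (slots a ψ c (m + 1) (m + 1)) x := by
      rw [← integral_add (iY _ _) (iZ _ _)]
      congr 1
      funext x
      ring
    rw [slots_self ψ ψ c a, t3, ← slots_zero a ψ c]
    simp only [S]
    rw [Finset.sum_range_succ (n := m + 1)]
    rw [Finset.sum_sub_distrib] at t2
    linarith
  have hsum : ∀ m, m ≤ n → ∑ k ∈ Finset.range (m + 1),
      ((∫ x, (c x - ψ x) * mixedMA (slots ψ ψ c k k) x) -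
      (∫ x, (a x - ψ x) * mixedMA (slots ψ ψ a k k) x)) = S m := by
    intro m
    induction m with
    | zero =>
      intro _
      have e : ∀ d : Cn n → ℝ, slots ψ ψ d 0 0 = slots a ψ c 0 0 := fun d => by
        funext l; simp [slots]
      simp only [zero_add, Finset.range_one, Finset.sum_singleton, S]
      rw [e, e, ← integral_sub (iX _ _) (iZ _ _)]
      congr 1
      funext x
      ring
    | succ m ih =>
      intro hm
      rw [Finset.sum_range_succ, ih (by omega), hstep m hm]
      ring
  rw [energy, energy, ← Finset.sum_sub_distrib, hsum n le_rfl]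

/-- A compact set `L` with a smooth function `ψ`, psh on `L`, and a cut-off function `h0` that is a
difference of psh functions. -/
structure Frame (n : ℕ) where
  /-- The outer set. -/
  L : Set (Cn n)
  /-- The inner set. -/
  L' : Set (Cn n)
  /-- The base function. -/
  ψ : Cn n → ℝ
  /-- The cut-off. -/
  h0 : Cn n → ℝ
  /-- The lower bound. -/
  a : ℝ
  /-- The upper bound. -/
  b : ℝ
  cL : IsCompact L
  sub : L' ⊆ L
  psh : SPSH L ψ
  smooth_h0 : Smooth h0
  h0_nonneg : ∀ x, 0 ≤ h0 x
  h0_zero : ∀ x ∉ L, h0 x = 0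
  h0_one : ∀ x ∈ L', 1 ≤ h0 x
  psh_add : SPSH L fun x => ψ x + h0 x
  hab : a ≤ b
  bd : ∀ x ∈ L, a ≤ ψ x ∧ ψ x ≤ b

namespace Frame

variable (Fr : Frame n)

/-- Bounded smooth functions, psh on `L`. -/
def Bdd (u : Cn n → ℝ) : Prop := SPSH Fr.L u ∧ ∀ x ∈ Fr.L, Fr.a ≤ u x ∧ u x ≤ Fr.b

/-- Bounded smooth functions, psh on `L`, equal to `ψ` off `L'`. -/
def Adm (u : Cn n → ℝ) : Prop := Fr.Bdd u ∧ ∀ x ∉ Fr.L', u x = Fr.ψ x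

/-- The mass constant. -/
def Z : ℝ := chainConst n (Fr.b - Fr.a) * ∫ x, Fr.h0 x * mixedMA (fun _ => Fr.ψ) x

/-- The constant in Błocki's inequality. -/
def C : ℝ := chainConst n (Fr.b - Fr.a)

theorem C_nonneg : 0 ≤ Fr.C := chainConst_nonneg (by linarith [Fr.hab])

theorem integral_h0_le {T : Fin n → Cn n → ℝ} (hT : ∀ i, Fr.Bdd (T i)) :
    ∫ x, Fr.h0 x ^ (n + 1) * mixedMA T x ≤ Fr.Z :=
  integral_pow_mul_mixedMA_le Fr.cL Fr.smooth_h0 Fr.h0_nonneg Fr.h0_zero Fr.psh Fr.psh_add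
    (fun i => (hT i).1) Fr.hab fun i => (hT i).2

theorem integrable_h0 {T : Fin n → Cn n → ℝ} (hT : ∀ i, Fr.Bdd (T i)) :
    Integrable fun x => Fr.h0 x ^ (n + 1) * mixedMA T x :=
  integrable_mul_mixedMA Fr.cL ((ContDiff.continuous Fr.smooth_h0).pow _)
    (fun x hx => by simp [Fr.h0_zero x hx]) fun i => (hT i).1.1

theorem integrable {T : Fin n → Cn n → ℝ} (hT : ∀ i, Fr.Bdd (T i)) {f : Cn n → ℝ}
    (hf : Continuous f) (hf0 : ∀ x ∉ Fr.L', f x = 0) : Integrable fun x => f x * mixedMA T x :=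
  integrable_mul_mixedMA Fr.cL hf (fun x hx => hf0 x fun h => hx (Fr.sub h)) fun i => (hT i).1.1

theorem Z_nonneg : 0 ≤ Fr.Z := by
  have hT : ∀ i : Fin n, Fr.Bdd ((fun _ => Fr.ψ) i) := fun _ => ⟨Fr.psh, Fr.bd⟩
  refine le_trans (integral_nonneg fun x => ?_) (Fr.integral_h0_le hT)
  by_cases hx : x ∈ Fr.L
  · exact mul_nonneg (pow_nonneg (Fr.h0_nonneg x) _) (mixedMA_nonneg (fun i => (hT i).1) hx)
  · simp [Fr.h0_zero x hx]

theorem integral_le {T : Fin n → Cn n → ℝ} (hT : ∀ i, Fr.Bdd (T i)) {f : Cn n → ℝ}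
    (hf : Continuous f) (hf0 : ∀ x ∉ Fr.L', f x = 0) {A : ℝ} (hA : 0 ≤ A)
    (hfA : ∀ x ∈ Fr.L', f x ≤ A) : ∫ x, f x * mixedMA T x ≤ A * Fr.Z := by
  refine le_trans ?_ (mul_le_mul_of_nonneg_left (Fr.integral_h0_le hT) hA)
  rw [← integral_const_mul]
  refine integral_mono (Fr.integrable hT hf hf0) ((Fr.integrable_h0 hT).const_mul A) fun x => ?_
  by_cases hx : x ∈ Fr.L'
  · have h1 := mixedMA_nonneg (fun i => (hT i).1) (Fr.sub hx)
    have h2 : f x ≤ A * Fr.h0 x ^ (n + 1) :=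
      (hfA x hx).trans (le_mul_of_one_le_right hA (one_le_pow₀ (Fr.h0_one x hx)))
    simpa [mul_assoc] using mul_le_mul_of_nonneg_right h2 h1
  · simp only [hf0 x hx, zero_mul]
    by_cases hx' : x ∈ Fr.L
    · exact mul_nonneg hA (mul_nonneg (pow_nonneg (Fr.h0_nonneg x) _)
        (mixedMA_nonneg (fun i => (hT i).1) hx'))
    · simp [Fr.h0_zero x hx']

variable {Fr}

theorem Adm.smooth {W : Cn n → ℝ} (hW : Fr.Adm W) : Smooth W := hW.1.1.1

theorem Adm.cont {W : Cn n → ℝ} (hW : Fr.Adm W) : Continuous W := ContDiff.continuous hW.smooth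

theorem Adm.sub_eq_zero {W W' : Cn n → ℝ} (hW : Fr.Adm W) (hW' : Fr.Adm W') :
    ∀ x ∉ Fr.L', W' x - W x = 0 := fun x hx => by rw [hW.2 x hx, hW'.2 x hx, sub_self]

theorem Adm.sub_le {W W' : Cn n → ℝ} (hW : Fr.Adm W) (hW' : Fr.Adm W') :
    ∀ x ∈ Fr.L', W' x - W x ≤ Fr.b - Fr.a := fun x hx => by
  linarith [(hW.1.2 x (Fr.sub hx)).1, (hW'.1.2 x (Fr.sub hx)).2]

theorem bdd_slots {a b c : Cn n → ℝ} (ha : Fr.Bdd a) (hb : Fr.Bdd b) (hc : Fr.Bdd c)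
    (i m : ℕ) (l : Fin n) : Fr.Bdd (slots a b c i m l) := by
  unfold slots; split_ifs <;> assumption

theorem bdd_ψ : Fr.Bdd Fr.ψ := ⟨Fr.psh, Fr.bd⟩

theorem integral_nonneg {T : Fin n → Cn n → ℝ} (hT : ∀ i, Fr.Bdd (T i)) {f : Cn n → ℝ}
    (hf0 : ∀ x ∉ Fr.L', f x = 0) (hf : ∀ x, 0 ≤ f x) : 0 ≤ ∫ x, f x * mixedMA T x := by
  refine MeasureTheory.integral_nonneg fun x => ?_
  by_cases hx : x ∈ Fr.L'
  · exact mul_nonneg (hf x) (mixedMA_nonneg (fun i => (hT i).1) (Fr.sub hx))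
  · simp [hf0 x hx]

theorem Adm.energy_le {W : Cn n → ℝ} (hW : Fr.Adm W) :
    energy Fr.ψ W ≤ (n + 1) * ((Fr.b - Fr.a) * Fr.Z) := by
  have hψ : Fr.Adm Fr.ψ := ⟨bdd_ψ, fun _ _ => rfl⟩
  have : ∀ m ∈ Finset.range (n + 1), ∫ x, (W x - Fr.ψ x) * mixedMA (slots Fr.ψ Fr.ψ W m m) x ≤
      (Fr.b - Fr.a) * Fr.Z := fun m _ =>
    Fr.integral_le (bdd_slots bdd_ψ bdd_ψ hW.1 m m) (hW.cont.sub hψ.cont) (hψ.sub_eq_zero hW)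
      (by linarith [Fr.hab]) (hψ.sub_le hW)
  refine (Finset.sum_le_sum this).trans (le_of_eq ?_)
  simp

theorem Adm.energy_nonneg {W : Cn n → ℝ} (hW : Fr.Adm W) (h : ∀ x, Fr.ψ x ≤ W x) :
    0 ≤ energy Fr.ψ W :=
  Finset.sum_nonneg fun m _ => integral_nonneg (bdd_slots bdd_ψ bdd_ψ hW.1 m m)
    (Adm.sub_eq_zero ⟨bdd_ψ, fun _ _ => rfl⟩ hW) fun x => sub_nonneg.mpr (h x)

theorem Adm.integral_sub_le {W W' : Cn n → ℝ} (hW : Fr.Adm W) (hW' : Fr.Adm W')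
    (h : ∀ x, W x ≤ W' x) :
    ∫ x, (W' x - W x) * mixedMA (fun _ => W) x ≤ energy Fr.ψ W' - energy Fr.ψ W := by
  have hn : ∀ {V : Cn n → ℝ}, Fr.Adm V → ∀ x ∉ Fr.L, V x = Fr.ψ x :=
    fun hV x hx => hV.2 x fun h => hx (Fr.sub h)
  rw [energy_sub_energy Fr.cL Fr.psh.1 hW.smooth hW'.smooth (hn hW) (hn hW')]
  have e : (fun _ : Fin n => W) = slots W Fr.ψ W' 0 n := by
    rw [slots_zero, slots_full]
  rw [e]
  exact Finset.single_le_sum (f := fun i => ∫ x, (W' x - W x) * mixedMA (slots W Fr.ψ W' i n) x)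
    (fun i _ => integral_nonneg (bdd_slots hW.1 bdd_ψ hW'.1 i n) (hW.sub_eq_zero hW')
      fun x => sub_nonneg.mpr (h x)) (Finset.mem_range.mpr (Nat.succ_pos n))

theorem Adm.energy_mono {W W' : Cn n → ℝ} (hW : Fr.Adm W) (hW' : Fr.Adm W')
    (h : ∀ x, W x ≤ W' x) : energy Fr.ψ W ≤ energy Fr.ψ W' :=
  sub_nonneg.mp ((integral_nonneg (fun _ => hW.1) (hW.sub_eq_zero hW')
    fun x => sub_nonneg.mpr (h x)).trans (hW.integral_sub_le hW' h))

theorem Adm.integral_pow_le {W W' : Cn n → ℝ} (hW : Fr.Adm W) (hW' : Fr.Adm W')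
    (h : ∀ x, W x ≤ W' x) {T : Fin n → Cn n → ℝ} (hT : ∀ i, Fr.Bdd (T i)) :
    ∫ x, (W' x - W x) ^ (n + 1) * mixedMA T x ≤
      Fr.C * ∫ x, (W' x - W x) * mixedMA (fun _ => W) x :=
  integral_pow_mul_mixedMA_le Fr.cL (hW'.smooth.sub hW.smooth) (fun x => sub_nonneg.mpr (h x))
    (fun x hx => hW.sub_eq_zero hW' x fun h => hx (Fr.sub h)) hW.1.1
    (by simpa using hW'.1.1) (fun i => (hT i).1) Fr.hab fun i => (hT i).2

theorem Adm.integral_le_energy {W W' : Cn n → ℝ} (hW : Fr.Adm W) (hW' : Fr.Adm W')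
    (h : ∀ x, W x ≤ W' x) {T : Fin n → Cn n → ℝ} (hT : ∀ i, Fr.Bdd (T i)) {ε : ℝ} (hε : 0 < ε) :
    ∫ x, (W' x - W x) * mixedMA T x ≤
      ε * Fr.Z + Fr.C / ε ^ n * (energy Fr.ψ W' - energy Fr.ψ W) := by
  have h0 := hW.sub_eq_zero hW'
  have c1 : Continuous fun x => W' x - W x := hW'.cont.sub hW.cont
  have i1 : Integrable fun x => (W' x - W x) ^ (n + 1) * mixedMA T x :=
    Fr.integrable hT (c1.pow (n + 1)) fun x hx => by simp [h0 x hx]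
  have h1 : ∫ x, (W' x - W x) * mixedMA T x ≤
      ∫ x, (ε * (Fr.h0 x ^ (n + 1) * mixedMA T x) +
        (1 / ε ^ n) * ((W' x - W x) ^ (n + 1) * mixedMA T x)) := by
    refine integral_mono (Fr.integrable hT c1 h0)
      (((Fr.integrable_h0 hT).const_mul ε).add (i1.const_mul _)) fun x => ?_
    by_cases hx : x ∈ Fr.L
    · have hm := mixedMA_nonneg (fun i => (hT i).1) hx
      have ht : 0 ≤ W' x - W x := sub_nonneg.mpr (h x)
      have key : W' x - W x ≤ ε * Fr.h0 x ^ (n + 1) + (1 / ε ^ n) * (W' x - W x) ^ (n + 1) := by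
        have p1 : 0 ≤ (1 / ε ^ n) * (W' x - W x) ^ (n + 1) := by positivity
        have p2 : 0 ≤ ε * Fr.h0 x ^ (n + 1) :=
          mul_nonneg hε.le (pow_nonneg (Fr.h0_nonneg x) _)
        by_cases hx' : x ∈ Fr.L'
        · rcases le_total (W' x - W x) ε with hle | hle
          · have := le_mul_of_one_le_right hε.le (one_le_pow₀ (n := n + 1) (Fr.h0_one x hx'))
            linarith
          · have : W' x - W x ≤ (1 / ε ^ n) * (W' x - W x) ^ (n + 1) := by
              rw [one_div, inv_mul_eq_div, le_div_iff₀ (by positivity), pow_succ, mul_comm]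
              exact mul_le_mul_of_nonneg_right (pow_le_pow_left₀ hε.le hle n) ht
            linarith
        · rw [h0 x hx'] at p1 ⊢
          linarith
      have := mul_le_mul_of_nonneg_right key hm
      simp only []
      linarith
    · have hx' : x ∉ Fr.L' := fun h => hx (Fr.sub h)
      simp [h0 x hx', Fr.h0_zero x hx]
  refine h1.trans ?_
  rw [integral_add ((Fr.integrable_h0 hT).const_mul ε) (i1.const_mul _), integral_const_mul,
    integral_const_mul]
  refine add_le_add (mul_le_mul_of_nonneg_left (Fr.integral_h0_le hT) hε.le) ?_
  have h2 := (hW.integral_pow_le hW' h hT).trans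
    (mul_le_mul_of_nonneg_left (hW.integral_sub_le hW' h) Fr.C_nonneg)
  rw [one_div, div_mul_eq_mul_div, inv_mul_eq_div]
  exact div_le_div_of_nonneg_right h2 (by positivity)

theorem Adm.integral_sub_mixedMA_le {A B G V : Cn n → ℝ} (hA : Fr.Adm A) (hB : Fr.Adm B)
    (hG : Fr.Adm G) (hV : Fr.Adm V) (hAB : ∀ x, A x ≤ B x) {ε : ℝ} (hε : 0 < ε) :
    (∫ x, (G x - V x) * mixedMA (fun _ => A) x) - ∫ x, (G x - V x) * mixedMA (fun _ => B) x ≤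
      n * (ε * Fr.Z + Fr.C / ε ^ n * (energy Fr.ψ B - energy Fr.ψ A)) := by
  have hT := fun i => bdd_slots (Fr := Fr) hB.1 hB.1 hA.1 i n
  have hTs := fun i l => (hT i l).1.1
  have e1 : (fun _ : Fin n => A) = slots B B A n n := (slots_full B B A).symm
  have e2 : (fun _ : Fin n => B) = slots B B A 0 n := by rw [slots_zero, slots_full]
  have h0 := hV.sub_eq_zero hG
  have c1 : Continuous fun x => G x - V x := hG.cont.sub hV.cont
  rw [e1, e2, ← Finset.sum_range_sub (fun i => ∫ x, (G x - V x) * mixedMA (slots B B A i n) x) n]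
  have key : ∀ i ∈ Finset.range n, (∫ x, (G x - V x) * mixedMA (slots B B A (i + 1) n) x) -
      (∫ x, (G x - V x) * mixedMA (slots B B A i n) x) ≤
      ε * Fr.Z + Fr.C / ε ^ n * (energy Fr.ψ B - energy Fr.ψ A) := by
    intro i hi
    have hi := Finset.mem_range.mp hi
    have hq : ∀ {U : Cn n → ℝ}, Fr.Bdd U → ∀ l, Fr.Bdd
        (Function.update (slots B B A i n) ⟨i, hi⟩ U l) := by
      intro U hU l
      by_cases hl : l = ⟨i, hi⟩
      · subst hl; simpa using hU
      · simpa [hl] using hT i l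
    have h1 : ∀ x, mixedMA (Function.update (slots B B A i n) ⟨i, hi⟩
        fun y => A y - B y) x = mixedMA (slots B B A (i + 1) n) x -
          mixedMA (slots B B A i n) x := by
      intro x
      rw [mixedMA_update_sub _ _ hA.smooth hB.smooth, slots_update_succ B B A hi le_rfl,
        slots_update_self B B A hi le_rfl]
    have h3 := integral_mul_mixedMA_update (hG.smooth.sub hV.smooth) (hA.smooth.sub hB.smooth)
      (hTs i) (HasCompactSupport.intro Fr.cL fun x hx => h0 x fun h => hx (Fr.sub h)) ⟨i, hi⟩
    simp only [h1, mul_sub, mixedMA_update_sub _ _ hG.smooth hV.smooth] at h3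
    rw [integral_sub (Fr.integrable (hT _) c1 h0) (Fr.integrable (hT _) c1 h0)] at h3
    rw [h3]
    refine le_trans ?_ (hA.integral_le_energy hB hAB (hq hV.1) hε)
    have c2 : Continuous fun x => A x - B x := hA.cont.sub hB.cont
    have c3 : Continuous fun x => B x - A x := hB.cont.sub hA.cont
    refine integral_mono ((Fr.integrable (hq hG.1) c2 (hB.sub_eq_zero hA)).sub
      (Fr.integrable (hq hV.1) c2 (hB.sub_eq_zero hA)))
      (Fr.integrable (hq hV.1) c3 (hA.sub_eq_zero hB)) fun x => ?_
    simp only []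
    by_cases hx : x ∈ Fr.L'
    · have := mul_nonneg (sub_nonneg.mpr (hAB x))
        (mixedMA_nonneg (fun l => (hq hG.1 l).1) (Fr.sub hx))
      linarith
    · simp [hA.sub_eq_zero hB x hx, hB.sub_eq_zero hA x hx]
  refine (Finset.sum_le_sum key).trans (le_of_eq ?_)
  rw [Finset.sum_const, Finset.card_range, nsmul_eq_mul]

/-- The quantitative estimate behind quasi-continuity. -/
theorem Adm.integral_pow_le_of_chain {A B G V : Cn n → ℝ} (hA : Fr.Adm A) (hB : Fr.Adm B)
    (hG : Fr.Adm G) (hV : Fr.Adm V) (hAB : ∀ x, A x ≤ B x) (hAV : ∀ x, A x ≤ V x)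
    (hVG : ∀ x, V x ≤ G x) {ε : ℝ} (hε : 0 < ε) {T : Fin n → Cn n → ℝ}
    (hT : ∀ i, Fr.Bdd (T i)) :
    ∫ x, (G x - A x) ^ (n + 1) * mixedMA T x ≤ Fr.C * ((energy Fr.ψ V - energy Fr.ψ A) +
      n * (ε * Fr.Z + Fr.C / ε ^ n * (energy Fr.ψ B - energy Fr.ψ A)) +
      ∫ x, (G x - V x) * mixedMA (fun _ => B) x) := by
  refine (hA.integral_pow_le hG (fun x => (hAV x).trans (hVG x)) hT).trans
    (mul_le_mul_of_nonneg_left ?_ Fr.C_nonneg)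
  have h1 := hA.integral_sub_le hV hAV
  have h2 := hA.integral_sub_mixedMA_le hB hG hV hAB hε
  have i1 : Integrable fun x => (V x - A x) * mixedMA (fun _ => A) x :=
    Fr.integrable (fun _ => hA.1) (hV.cont.sub hA.cont)
    (hA.sub_eq_zero hV)
  have i2 : Integrable fun x => (G x - V x) * mixedMA (fun _ => A) x :=
    Fr.integrable (fun _ => hA.1) (hG.cont.sub hV.cont)
    (hV.sub_eq_zero hG)
  have h3 : ∫ x, (G x - A x) * mixedMA (fun _ => A) x =
      (∫ x, (V x - A x) * mixedMA (fun _ => A) x) +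
        ∫ x, (G x - V x) * mixedMA (fun _ => A) x := by
    rw [← integral_add i1 i2]
    congr 1
    funext x
    ring
  linarith

end Frame

end

section
variable {n : ℕ}

local instance : Fact ((0 : ℝ) < 1) := ⟨one_pos⟩

/-- The standard map of the circle `ℝ / ℤ` onto the unit circle. -/
def ev (θ : UnitAddCircle) : ℂ := fourier 1 θ

theorem continuous_ev : Continuous ev := (fourier (1 : ℤ)).continuous

theorem norm_ev (θ : UnitAddCircle) : ‖ev θ‖ = 1 := by
  rw [ev, fourier_apply]; exact Circle.norm_coe _

theorem fourier_natCast (k : ℕ) (θ : UnitAddCircle) : fourier (k : ℤ) θ = ev θ ^ k := by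
  induction k with
  | zero => simp
  | succ k ih => rw [Nat.cast_succ, fourier_add, ih, pow_succ, ev]

theorem integral_ev_pow {k : ℕ} (hk : k ≠ 0) : ∫ θ, ev θ ^ k ∂AddCircle.haarAddCircle = 0 := by
  simp_rw [← fourier_natCast]
  exact integral_eq_zero_of_add_right_eq_neg
    (fourier_add_half_inv_index (T := 1) (Int.natCast_ne_zero.2 hk) one_pos)

theorem integrable_circle {f : UnitAddCircle → ℝ} (hf : Continuous f) :
    Integrable f AddCircle.haarAddCircle :=
  (BoundedContinuousFunction.mkOfCompact ⟨f, hf⟩).integrable _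

theorem integrable_circle' {f : UnitAddCircle → ℂ} (hf : Continuous f) :
    Integrable f AddCircle.haarAddCircle :=
  (BoundedContinuousFunction.mkOfCompact ⟨f, hf⟩).integrable _

theorem integral_eval_circle (p : Polynomial ℂ) (t : ℂ) :
    ∫ θ, (p.eval (t * ev θ)).re ∂AddCircle.haarAddCircle = (p.eval 0).re := by
  have hc : Continuous fun θ => p.eval (t * ev θ) :=
    p.continuous.comp (continuous_const.mul continuous_ev)
  have h1 : ∫ θ, p.eval (t * ev θ) ∂AddCircle.haarAddCircle = p.eval 0 := by
    simp_rw [Polynomial.eval_eq_sum_range]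
    have hI : ∀ i ∈ Finset.range (p.natDegree + 1), Integrable
        (fun θ : UnitAddCircle => p.coeff i * (t * ev θ) ^ i) AddCircle.haarAddCircle := fun i _ =>
      integrable_circle' (continuous_const.mul ((continuous_const.mul continuous_ev).pow i))
    rw [integral_finsetSum _ hI]
    refine Finset.sum_congr rfl fun i _ => ?_
    simp_rw [mul_pow, ← mul_assoc]
    rw [integral_const_mul]
    rcases eq_or_ne i 0 with rfl | hi
    · simp
    · rw [integral_ev_pow hi, zero_pow hi]; simp
  rw [← h1]
  exact integral_re (integrable_circle' hc)

theorem exists_trig_approx (q : C(UnitAddCircle, ℝ)) {ε : ℝ} (hε : 0 < ε) :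
    ∃ p : Polynomial ℂ, ∀ θ, |q θ - (p.eval (ev θ)).re| ≤ ε := by
  set Q : C(UnitAddCircle, ℂ) := ⟨fun θ => (q θ : ℂ), by fun_prop⟩
  have hQ : Q ∈ (Submodule.span ℂ (Set.range (@fourier 1))).topologicalClosure := by
    rw [span_fourier_closure_eq_top]; trivial
  rw [← SetLike.mem_coe, Submodule.topologicalClosure_coe, Metric.mem_closure_iff] at hQ
  obtain ⟨P, hP, hPQ⟩ := hQ ε hε
  have key : ∀ P ∈ Submodule.span ℂ (Set.range (@fourier 1)), ∃ p r : Polynomial ℂ,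
      ∀ θ : UnitAddCircle, P θ = p.eval (ev θ) + (starRingEnd ℂ) (r.eval (ev θ)) := by
    intro P hP
    induction hP using Submodule.span_induction with
    | mem x hx =>
      obtain ⟨k, rfl⟩ := hx
      rcases le_total 0 k with hk | hk
      · lift k to ℕ using hk
        exact ⟨Polynomial.X ^ k, 0, fun θ => by rw [fourier_natCast]; simp⟩
      · obtain ⟨m, rfl⟩ : ∃ m : ℕ, k = -(m : ℤ) := ⟨k.natAbs, by omega⟩
        exact ⟨0, Polynomial.X ^ m, fun θ => by rw [fourier_neg, fourier_natCast]; simp⟩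
    | zero => exact ⟨0, 0, fun θ => by simp⟩
    | add x y _ _ hx hy =>
      obtain ⟨p, r, h⟩ := hx
      obtain ⟨p', r', h'⟩ := hy
      exact ⟨p + p', r + r', fun θ => by
        rw [ContinuousMap.add_apply, h, h', Polynomial.eval_add, Polynomial.eval_add, map_add]; ring⟩
    | smul c x _ hx =>
      obtain ⟨p, r, h⟩ := hx
      exact ⟨Polynomial.C c * p, Polynomial.C ((starRingEnd ℂ) c) * r, fun θ => by
        rw [ContinuousMap.smul_apply, h, Polynomial.eval_mul, Polynomial.eval_mul, Polynomial.eval_C,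
          Polynomial.eval_C, map_mul, Complex.conj_conj, smul_eq_mul]; ring⟩
  obtain ⟨p, r, h⟩ := key P hP
  refine ⟨p + r, fun θ => ?_⟩
  have h1 : ‖Q θ - P θ‖ ≤ ε := by
    rw [← dist_eq_norm]
    exact (ContinuousMap.dist_apply_le_dist θ).trans hPQ.le
  have h2 : (Q θ - P θ).re = q θ - ((p + r).eval (ev θ)).re := by
    rw [h θ]; simp [Q]
  rw [← h2]
  exact (Complex.abs_re_le_norm _).trans h1

theorem exists_continuous_ge_integral_le {g : UnitAddCircle → ℝ} (hg : UpperSemicontinuous g)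
    (hi : Integrable g AddCircle.haarAddCircle) {ε : ℝ} (hε : 0 < ε) :
    ∃ q : C(UnitAddCircle, ℝ), (∀ θ, g θ ≤ q θ) ∧
      ∫ θ, q θ ∂AddCircle.haarAddCircle ≤ ∫ θ, g θ ∂AddCircle.haarAddCircle + ε := by
  obtain ⟨G, hlt, hG, hGi, hfin, hInt⟩ :=
    exists_lt_lowerSemicontinuous_integral_lt g hi hε
  obtain ⟨q, hq⟩ := exists_continuous_forall_mem_convex_of_local_const
    (t := fun θ => {c : ℝ | g θ ≤ c ∧ (c : EReal) ≤ G θ}) (fun θ => by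
      refine Set.OrdConnected.convex ⟨fun x hx y hy z hz => ?_⟩
      exact ⟨hx.1.trans hz.1, (EReal.coe_le_coe_iff.2 hz.2).trans hy.2⟩) (fun θ => by
      obtain ⟨c, h1, h2⟩ := EReal.lt_iff_exists_real_btwn.1 (hlt θ)
      refine ⟨c, ?_⟩
      filter_upwards [hg θ c (EReal.coe_lt_coe_iff.1 h1), hG θ c h2] with y hy hy'
      exact ⟨hy.le, hy'.le⟩)
  refine ⟨q, fun θ => (hq θ).1, (le_trans ?_ hInt.le)⟩
  refine integral_mono_ae (integrable_circle q.continuous) hGi ?_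
  filter_upwards [hfin] with θ h
  exact EReal.toReal_le_toReal (hq θ).2 (EReal.coe_ne_bot _) h.ne

/-- The mean of `f` over the circle `a + ζ b`, `‖ζ‖ = 1`. -/
def cm (f : Cn n → ℝ) (a b : Cn n) : ℝ := ∫ θ, f (a + ev θ • b) ∂AddCircle.haarAddCircle

/-- Bounded measurable functions vanishing off `Ω` whose means over circles are increasing in the
radius along discs in `Ω`. -/
structure SubMean (Ω : Set (Cn n)) (s : ℝ) (f : Cn n → ℝ) : Prop where
  meas : Measurable f
  low : ∀ z, -s ≤ f z
  high : ∀ z, f z ≤ 0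
  off : ∀ z ∉ Ω, f z = 0
  mean : ∀ a b : Cn n, (∀ ζ : ℂ, ‖ζ‖ ≤ 1 → a + ζ • b ∈ Ω) →
    ∀ t : ℝ, 0 ≤ t → t ≤ 1 → cm f a (t • b) ≤ cm f a b

theorem measurable_circle_map (a b : Cn n) : Measurable fun θ : UnitAddCircle => a + ev θ • b :=
  (continuous_const.add (continuous_ev.smul continuous_const)).measurable

theorem integrable_cm {f : Cn n → ℝ} (hf : Measurable f) {s : ℝ} (hs : ∀ z, |f z| ≤ s)
    (a b : Cn n) : Integrable (fun θ => f (a + ev θ • b)) AddCircle.haarAddCircle :=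
  Integrable.of_bound (hf.comp (measurable_circle_map a b)).aestronglyMeasurable s
    (Eventually.of_forall fun _ => hs _)

/-- The real valued version of a function bounded on `Ω`, extended by zero. -/
def rl (Ω : Set (Cn n)) (u : Cn n → EReal) : Cn n → ℝ :=
  open Classical in fun z => if z ∈ Ω then (u z).toReal else 0

theorem measurable_of_usc {X Y : Type*} [TopologicalSpace X] [MeasurableSpace X] [BorelSpace X]
    [LinearOrder Y] [TopologicalSpace Y] [OrderTopology Y] [SecondCountableTopology Y]
    [MeasurableSpace Y] [BorelSpace Y] {Ω : Set X} (hΩ : IsOpen Ω) {f : X → Y}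
    (hf : UpperSemicontinuousOn f Ω) {c : Y} (hc : ∀ z ∉ Ω, f z = c) : Measurable f := by
  refine measurable_of_Iio fun y => ?_
  have h1 : IsOpen (Ω ∩ f ⁻¹' Set.Iio y) := by
    rw [isOpen_iff_mem_nhds]
    rintro z ⟨hz, hz'⟩
    have := hf z hz y hz'
    rw [hΩ.nhdsWithin_eq hz] at this
    exact Filter.inter_mem (hΩ.mem_nhds hz) this
  have h2 : f ⁻¹' Set.Iio y = (Ω ∩ f ⁻¹' Set.Iio y) ∪ (Ωᶜ ∩ {z | c < y}) := by
    ext z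
    by_cases hz : z ∈ Ω
    · simp [hz]
    · simp [hz, hc z hz]
  rw [h2]
  exact h1.measurableSet.union (hΩ.measurableSet.compl.inter (MeasurableSet.const _))

theorem SubMean.abs_le {Ω : Set (Cn n)} {s : ℝ} {f : Cn n → ℝ} (hf : SubMean Ω s f) (z : Cn n) :
    |f z| ≤ s := _root_.abs_le.2 ⟨hf.low z, by linarith [hf.low z, hf.high z]⟩

theorem SubMean.integrable {Ω : Set (Cn n)} {s : ℝ} {f : Cn n → ℝ} (hf : SubMean Ω s f)
    (a b : Cn n) : Integrable (fun θ => f (a + ev θ • b)) AddCircle.haarAddCircle :=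
  integrable_cm hf.meas hf.abs_le a b

theorem upperSemicontinuousOn_rl {Ω : Set (Cn n)} {s : ℝ} {u : Cn n → EReal}
    (hu : UpperSemicontinuousOn u Ω) (hb : ∀ z ∈ Ω, ((-s : ℝ) : EReal) ≤ u z ∧ u z ≤ 0) :
    UpperSemicontinuousOn (rl Ω u) Ω ∧ ∀ z ∈ Ω, ((rl Ω u z : ℝ) : EReal) = u z := by
  have h1 : ∀ z ∈ Ω, ((rl Ω u z : ℝ) : EReal) = u z := fun z hz => by
    simp only [rl, if_pos hz]
    exact EReal.coe_toReal (ne_top_of_le_ne_top EReal.zero_ne_top (hb z hz).2)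
      (ne_bot_of_le_ne_bot (EReal.coe_ne_bot _) (hb z hz).1)
  refine ⟨fun z hz c hc => ?_, h1⟩
  have := hu z hz c (by change u z < _; rw [← h1 z hz]; exact_mod_cast hc)
  filter_upwards [this, self_mem_nhdsWithin] with y hy hy'
  rw [← h1 y hy'] at hy
  exact_mod_cast hy

theorem subMean_rl {Ω : Set (Cn n)} (hΩ : IsOpen Ω) {s : ℝ} (hs : 0 ≤ s) {u : Cn n → EReal}
    (hu : PlurisubharmonicOn u Ω) (hb : ∀ z ∈ Ω, ((-s : ℝ) : EReal) ≤ u z ∧ u z ≤ 0) :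
    SubMean Ω s (rl Ω u) := by
  obtain ⟨husc, hcoe⟩ := upperSemicontinuousOn_rl hu.1 hb
  have hoff : ∀ z ∉ Ω, rl Ω u z = 0 := fun z hz => by simp only [rl, if_neg hz]
  have hmeas := measurable_of_usc hΩ husc hoff
  have hlow : ∀ z, -s ≤ rl Ω u z := fun z => by
    by_cases hz : z ∈ Ω
    · have := (hb z hz).1
      rw [← hcoe z hz] at this
      exact_mod_cast this
    · rw [hoff z hz]; linarith
  have hhigh : ∀ z, rl Ω u z ≤ 0 := fun z => by
    by_cases hz : z ∈ Ω
    · have := (hb z hz).2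
      rw [← hcoe z hz] at this
      exact_mod_cast this
    · rw [hoff z hz]
  have habs : ∀ z, |rl Ω u z| ≤ s := fun z => abs_le.2 ⟨hlow z, by linarith [hlow z, hhigh z]⟩
  refine ⟨hmeas, hlow, hhigh, hoff, fun a b hab t ht0 ht1 => ?_⟩
  refine le_of_forall_pos_le_add fun ε hε => ?_
  have hmem : ∀ θ, a + ev θ • b ∈ Ω := fun θ => hab _ (norm_ev θ).le
  have hg : UpperSemicontinuous fun θ => rl Ω u (a + ev θ • b) := fun θ c hc => by
    have h1 := husc _ (hmem θ) c hc
    rw [hΩ.nhdsWithin_eq (hmem θ)] at h1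
    have h2 : Continuous fun θ : UnitAddCircle => a + ev θ • b :=
      continuous_const.add (continuous_ev.smul continuous_const)
    exact (h2.tendsto θ).eventually h1
  obtain ⟨q, hq1, hq2⟩ := exists_continuous_ge_integral_le hg (integrable_cm hmeas habs a b)
    (half_pos hε)
  obtain ⟨p, hp⟩ := exists_trig_approx q (ε := ε / 4) (by linarith)
  set P : Polynomial ℂ := p + Polynomial.C ((ε / 4 : ℝ) : ℂ) with hP
  have hPe : ∀ w, (P.eval w).re = (p.eval w).re + ε / 4 := fun w => by simp [hP]
  have hdisc := hu.2 a b 1 one_pos hab P (fun ζ hζ => by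
    obtain ⟨θ, rfl⟩ : ∃ θ, ev θ = ζ := by
      obtain ⟨x, hx⟩ := (AddCircle.homeomorphCircle (T := 1) one_ne_zero).surjective
        (⟨ζ, mem_sphere_zero_iff_norm.2 hζ⟩ : Circle)
      refine ⟨x, ?_⟩
      rw [ev, fourier_apply, one_zsmul]
      rw [AddCircle.homeomorphCircle_apply] at hx
      rw [hx]
    rw [← hcoe _ (hmem θ), EReal.coe_le_coe_iff, hPe]
    have := (abs_le.1 (hp θ)).2
    linarith [hq1 θ])
  have hd : ∀ θ, rl Ω u (a + ev θ • (t • b)) ≤ (P.eval ((t : ℂ) * ev θ)).re := fun θ => by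
    have hn : ‖(t : ℂ) * ev θ‖ ≤ 1 := by
      rw [norm_mul, norm_ev, mul_one, Complex.norm_real, Real.norm_of_nonneg ht0]; exact ht1
    have h1 := hdisc _ hn
    rw [← hcoe _ (hab _ hn), EReal.coe_le_coe_iff] at h1
    have h2 : a + ev θ • (t • b) = a + ((t : ℂ) * ev θ) • b := by
      rw [mul_comm, mul_smul, ← Complex.coe_smul]
    rw [h2]; exact h1
  have hcont : ∀ (R : Polynomial ℂ) (c : ℂ), Integrable (fun θ => (R.eval (c * ev θ)).re)
      AddCircle.haarAddCircle := fun R c => integrable_circle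
    (Complex.continuous_re.comp (R.continuous.comp (continuous_const.mul continuous_ev)))
  have h1 : cm (rl Ω u) a (t • b) ≤ (P.eval 0).re := by
    rw [← integral_eval_circle P t]
    exact integral_mono (integrable_cm hmeas habs a _) (hcont P t) hd
  have h2 : (p.eval 0).re ≤ ∫ θ, (q θ + ε / 4) ∂AddCircle.haarAddCircle := by
    rw [← integral_eval_circle p 1]
    refine integral_mono (hcont p 1) (integrable_circle (q.continuous.add continuous_const))
      fun θ => ?_
    have := (abs_le.1 (hp θ)).1
    simp only [one_mul]
    linarith
  rw [integral_add (integrable_circle q.continuous) (integrable_const _)] at h2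
  rw [hPe] at h1
  simp only [integral_const, probReal_univ, one_smul] at h2
  change _ ≤ cm (rl Ω u) a b + ε
  change _ ≤ cm (rl Ω u) a b + ε / 2 at hq2
  linarith

/-- The squared Euclidean norm. -/
def sqn (z : Cn n) : ℝ := ∑ j, Complex.normSq (z j)

theorem smooth_sqn : Smooth (sqn : Cn n → ℝ) := by
  refine ContDiff.sum fun j _ => ?_
  simp only [Complex.normSq_apply]
  have h1 : Smooth fun z : Cn n => (z j).re := Complex.reCLM.contDiff.comp (contDiff_apply ℝ ℂ j)
  have h2 : Smooth fun z : Cn n => (z j).im := Complex.imCLM.contDiff.comp (contDiff_apply ℝ ℂ j)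
  exact (h1.mul h1).add (h2.mul h2)

theorem sqn_nonneg (z : Cn n) : 0 ≤ sqn z := Finset.sum_nonneg fun _ _ => Complex.normSq_nonneg _

theorem norm_sq_le_sqn (z : Cn n) : ‖z‖ ^ 2 ≤ sqn z := by
  rcases isEmpty_or_nonempty (Fin n) with h | h
  · rw [Subsingleton.elim z 0]; simpa using sqn_nonneg (0 : Cn n)
  · obtain ⟨j, hj⟩ := (Finite.exists_max fun j => ‖z j‖)
    have : ‖z‖ = ‖z j‖ := le_antisymm ((pi_norm_le_iff_of_nonneg (norm_nonneg _)).2 hj)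
      (norm_le_pi_norm z j)
    rw [this, ← Complex.normSq_eq_norm_sq]
    exact Finset.single_le_sum (f := fun j => Complex.normSq (z j))
      (fun i _ => Complex.normSq_nonneg _) (Finset.mem_univ j)

theorem sqn_smul (c : ℂ) (z : Cn n) : sqn (c • z) = Complex.normSq c * sqn z := by
  simp [sqn, Finset.mul_sum, Complex.normSq_mul]

/-- The unnormalized mollifier. -/
def rho0 (z : Cn n) : ℝ := Real.smoothTransition (1 - sqn z)

theorem smooth_rho0 : Smooth (rho0 : Cn n → ℝ) :=
  Real.smoothTransition.contDiff.comp (contDiff_const.sub smooth_sqn)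

theorem rho0_eq_zero {z : Cn n} (hz : 1 ≤ ‖z‖) : rho0 z = 0 := by
  refine Real.smoothTransition.zero_of_nonpos ?_
  nlinarith [norm_sq_le_sqn z]

theorem hasCompactSupport_rho0 : HasCompactSupport (rho0 : Cn n → ℝ) :=
  HasCompactSupport.of_support_subset_isCompact (isCompact_closedBall 0 1) fun z hz => by
    rw [mem_closedBall_zero_iff]
    by_contra h
    exact hz (rho0_eq_zero (not_le.1 h).le)

theorem integral_rho0_pos : 0 < ∫ z : Cn n, rho0 z :=
  Continuous.integral_pos_of_hasCompactSupport_nonneg_nonzero (x := 0)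
    (ContDiff.continuous smooth_rho0) hasCompactSupport_rho0
    (fun _ => Real.smoothTransition.nonneg _)
    (by simp [rho0, sqn, Real.smoothTransition.one])

/-- The normalized rotation invariant mollifier, supported in the unit ball. -/
def rho (z : Cn n) : ℝ := (∫ z : Cn n, rho0 z)⁻¹ * rho0 z

theorem smooth_rho : Smooth (rho : Cn n → ℝ) := contDiff_const.mul smooth_rho0

theorem rho_nonneg (z : Cn n) : 0 ≤ rho z :=
  mul_nonneg (inv_nonneg.2 integral_rho0_pos.le) (Real.smoothTransition.nonneg _)

theorem rho_eq_zero {z : Cn n} (hz : 1 ≤ ‖z‖) : rho z = 0 := by rw [rho, rho0_eq_zero hz, mul_zero]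

theorem integral_rho : ∫ z : Cn n, rho z = 1 := by
  simp only [rho]
  rw [integral_const_mul, inv_mul_cancel₀ integral_rho0_pos.ne']

theorem hasCompactSupport_rho : HasCompactSupport (rho : Cn n → ℝ) :=
  hasCompactSupport_rho0.mul_left

theorem rho_smul {c : ℂ} (hc : ‖c‖ = 1) (z : Cn n) : rho (c • z) = rho z := by
  rw [rho, rho, rho0, rho0, sqn_smul, Complex.normSq_eq_norm_sq, hc]; simp

theorem continuous_rho : Continuous (rho : Cn n → ℝ) := ContDiff.continuous smooth_rho

theorem integrable_rho : Integrable (rho : Cn n → ℝ) :=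
  continuous_rho.integrable_of_hasCompactSupport hasCompactSupport_rho

theorem measurePreserving_smul {c : ℂ} (hc : ‖c‖ = 1) :
    MeasurePreserving fun z : Cn n => c • z := by
  have h : MeasurePreserving fun w : ℂ => c * w :=
    (rotation ⟨c, mem_sphere_zero_iff_norm.2 hc⟩).measurePreserving
  exact volume_preserving_pi fun _ => h

/-- Mollification at scale `δ`. -/
def moll (f : Cn n → ℝ) (δ : ℝ) (z : Cn n) : ℝ := ∫ ζ, f (z + δ • ζ) * rho ζ

/-- The rescaled mollifier. -/
def kern (δ : ℝ) (z : Cn n) : ℝ := |(δ ^ Module.finrank ℝ (Cn n))⁻¹| * rho ((-δ⁻¹) • z)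

theorem moll_eq (f : Cn n → ℝ) {δ : ℝ} (hδ : 0 < δ) (z : Cn n) :
    moll f δ z = ∫ y, f y * kern δ (z - y) := by
  have h1 : ∀ ζ : Cn n, f (z + δ • ζ) * rho ζ =
      (fun y => f (z + y) * rho (δ⁻¹ • y)) (δ • ζ) := fun ζ => by
    simp only [smul_smul, inv_mul_cancel₀ hδ.ne', one_smul]
  rw [moll, integral_congr_ae (Eventually.of_forall h1), 
    Measure.integral_comp_smul volume (fun y => f (z + y) * rho (δ⁻¹ • y)) δ,
    ← integral_add_left_eq_self (fun y => f y * kern δ (z - y)) z, ← integral_smul]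
  refine integral_congr_ae (Eventually.of_forall fun y => ?_)
  simp only [kern, smul_eq_mul]
  rw [show (-δ⁻¹) • (z - (z + y)) = δ⁻¹ • y by rw [neg_smul, ← smul_neg]; congr 1; abel]
  ring

theorem smooth_kern (δ : ℝ) : Smooth (kern δ : Cn n → ℝ) :=
  contDiff_const.mul (ContDiff.comp (g := rho) smooth_rho (contDiff_const_smul _))

theorem hasCompactSupport_kern {δ : ℝ} (hδ : 0 < δ) : HasCompactSupport (kern δ : Cn n → ℝ) :=
  HasCompactSupport.mul_left (hasCompactSupport_rho.comp_smul (neg_ne_zero.2 (inv_ne_zero hδ.ne')))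

theorem kern_nonneg (δ : ℝ) (z : Cn n) : 0 ≤ kern δ z := mul_nonneg (abs_nonneg _) (rho_nonneg _)

theorem integral_kern {δ : ℝ} (hδ : 0 < δ) : ∫ z : Cn n, kern δ z = 1 := by
  have h := moll_eq (n := n) (fun _ => 1) hδ 0
  simp only [moll, one_mul, integral_rho] at h
  rw [h, ← integral_neg_eq_self]
  simp

theorem moll_eq_convolution (f : Cn n → ℝ) {δ : ℝ} (hδ : 0 < δ) :
    moll f δ = convolution f (kern δ) (ContinuousLinearMap.mul ℝ ℝ) volume := by
  ext z
  rw [moll_eq f hδ]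
  rfl

theorem locallyIntegrable_of_bound {f : Cn n → ℝ} (hf : Measurable f) {s : ℝ}
    (hs : ∀ z, |f z| ≤ s) : LocallyIntegrable f :=
  (locallyIntegrable_const s).mono hf.aestronglyMeasurable
    (Eventually.of_forall fun z => (hs z).trans (le_abs_self s))

theorem smooth_moll {f : Cn n → ℝ} (hf : Measurable f) {s : ℝ} (hs : ∀ z, |f z| ≤ s) {δ : ℝ}
    (hδ : 0 < δ) : Smooth (moll f δ) := by
  rw [moll_eq_convolution f hδ]
  exact (hasCompactSupport_kern hδ).contDiff_convolution_right _ (locallyIntegrable_of_bound hf hs)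
    (smooth_kern δ)

theorem integral_moll {f : Cn n → ℝ} (hf : Integrable f) {δ : ℝ} (hδ : 0 < δ) :
    ∫ z, moll f δ z = ∫ z, f z := by
  rw [moll_eq_convolution f hδ, integral_convolution _ hf
    ((ContDiff.continuous (smooth_kern δ)).integrable_of_hasCompactSupport
      (hasCompactSupport_kern hδ)), integral_kern hδ]
  simp

theorem integrable_moll {f : Cn n → ℝ} (hf : Integrable f) {δ : ℝ} (hδ : 0 < δ) :
    Integrable (moll f δ) := by
  rw [moll_eq_convolution f hδ]
  exact hf.integrable_convolution _
    ((ContDiff.continuous (smooth_kern δ)).integrable_of_hasCompactSupport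
      (hasCompactSupport_kern hδ))

theorem integrable_mul_rho {f : Cn n → ℝ} (hf : Measurable f) {s : ℝ} (hs : ∀ z, |f z| ≤ s) :
    Integrable fun ζ => f ζ * rho ζ :=
  integrable_rho.bdd_mul hf.aestronglyMeasurable (Eventually.of_forall fun z => hs z)

theorem measurable_shift (z : Cn n) (δ : ℝ) : Measurable fun ζ : Cn n => z + δ • ζ :=
  (continuous_const.add (continuous_const_smul δ)).measurable

theorem integrable_moll_aux {f : Cn n → ℝ} (hf : Measurable f) {s : ℝ} (hs : ∀ z, |f z| ≤ s)
    (z : Cn n) (δ : ℝ) : Integrable fun ζ => f (z + δ • ζ) * rho ζ :=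
  integrable_mul_rho (hf.comp (measurable_shift z δ)) fun _ => hs _

theorem moll_le_of_le {f : Cn n → ℝ} (hf : Measurable f) {s : ℝ} (hs : ∀ z, |f z| ≤ s)
    {z : Cn n} {δ c : ℝ} (h : ∀ ζ : Cn n, ‖ζ‖ ≤ 1 → f (z + δ • ζ) ≤ c) : moll f δ z ≤ c := by
  calc moll f δ z ≤ ∫ ζ : Cn n, c * rho ζ := by
        refine integral_mono (integrable_moll_aux hf hs z δ) (integrable_rho.const_mul c) fun ζ => ?_
        rcases le_total 1 ‖ζ‖ with hζ | hζ
        · simp [rho_eq_zero hζ]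
        · exact mul_le_mul_of_nonneg_right (h ζ hζ) (rho_nonneg _)
    _ = c := by rw [integral_const_mul, integral_rho, mul_one]

theorem moll_mono {f g : Cn n → ℝ} (hf : Measurable f) {s : ℝ} (hs : ∀ z, |f z| ≤ s)
    (hg : Measurable g) {s' : ℝ} (hs' : ∀ z, |g z| ≤ s') (h : ∀ z, f z ≤ g z) (δ : ℝ) (z : Cn n) :
    moll f δ z ≤ moll g δ z :=
  integral_mono (integrable_moll_aux hf hs z δ) (integrable_moll_aux hg hs' z δ) fun _ =>
    mul_le_mul_of_nonneg_right (h _) (rho_nonneg _)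

theorem moll_const (c δ : ℝ) (z : Cn n) : moll (fun _ => c) δ z = c := by
  rw [moll, integral_const_mul, integral_rho, mul_one]

theorem moll_zero (f : Cn n → ℝ) (z : Cn n) : moll f 0 z = f z := by
  simp only [moll, zero_smul, add_zero]
  rw [integral_const_mul, integral_rho, mul_one]

theorem moll_mono_ae {f g : Cn n → ℝ} (hf : Measurable f) {s : ℝ} (hs : ∀ z, |f z| ≤ s)
    (hg : Measurable g) {s' : ℝ} (hs' : ∀ z, |g z| ≤ s') (h : ∀ᵐ z, f z ≤ g z) {δ : ℝ} (hδ : 0 < δ)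
    (z : Cn n) : moll f δ z ≤ moll g δ z := by
  rw [moll_eq f hδ, moll_eq g hδ]
  have hk : Integrable fun y : Cn n => kern δ (z - y) :=
    ((ContDiff.continuous (smooth_kern δ)).integrable_of_hasCompactSupport
      (hasCompactSupport_kern hδ)).comp_sub_left z
  refine integral_mono_ae (hk.bdd_mul hf.aestronglyMeasurable (Eventually.of_forall fun z => hs z))
    (hk.bdd_mul hg.aestronglyMeasurable (Eventually.of_forall fun z => hs' z)) ?_
  filter_upwards [h] with y hy
  exact mul_le_mul_of_nonneg_right hy (kern_nonneg _ _)

theorem moll_sub {f g : Cn n → ℝ} (hf : Measurable f) {s : ℝ} (hs : ∀ z, |f z| ≤ s)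
    (hg : Measurable g) {s' : ℝ} (hs' : ∀ z, |g z| ≤ s') (δ : ℝ) (z : Cn n) :
    moll f δ z - moll g δ z = moll (fun x => f x - g x) δ z := by
  simp only [moll]
  rw [← integral_sub (integrable_moll_aux hf hs z δ) (integrable_moll_aux hg hs' z δ)]
  simp only [sub_mul]

theorem moll_eq_cm {f : Cn n → ℝ} (hf : Measurable f) {s : ℝ} (hs : ∀ z, |f z| ≤ s)
    (δ : ℝ) (z : Cn n) : moll f δ z = ∫ ζ, cm f z (δ • ζ) * rho ζ := by
  have h1 : ∀ θ : UnitAddCircle, moll f δ z = ∫ ζ, f (z + ev θ • (δ • ζ)) * rho ζ := fun θ => by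
    have h := (measurePreserving_smul (n := n) (norm_ev θ)).integral_comp'
      (f := MeasurableEquiv.smul₀ (ev θ) (by rw [← norm_ne_zero_iff, norm_ev]; exact one_ne_zero))
      (fun ζ => f (z + δ • ζ) * rho ζ)
    rw [moll, ← h]
    refine integral_congr_ae (Eventually.of_forall fun ζ => ?_)
    simp only [MeasurableEquiv.coe_smul₀, rho_smul (norm_ev θ), smul_comm (ev θ) δ]
  have h2 : moll f δ z = ∫ _θ : UnitAddCircle, moll f δ z ∂AddCircle.haarAddCircle := by simp
  rw [h2, integral_congr_ae (Eventually.of_forall h1), integral_integral_swap]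
  · simp only [cm, integral_mul_const]
  · refine (Integrable.comp_snd integrable_rho AddCircle.haarAddCircle).bdd_mul (c := s)
      (Measurable.aestronglyMeasurable ?_) (Eventually.of_forall fun p => hs _)
    refine hf.comp (Continuous.measurable ?_)
    exact continuous_const.add ((continuous_ev.comp continuous_fst).smul
      (continuous_snd.const_smul δ))

theorem integrable_prod_cm {f : Cn n → ℝ} (hf : Measurable f) {s : ℝ} (hs : ∀ z, |f z| ≤ s)
    {A B : Cn n → Cn n} (hA : Continuous A) (hB : Continuous B) :
    Integrable (fun p : UnitAddCircle × Cn n => f (A p.2 + ev p.1 • B p.2) * rho p.2)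
      (AddCircle.haarAddCircle.prod volume) := by
  refine (Integrable.comp_snd integrable_rho AddCircle.haarAddCircle).bdd_mul (c := s)
    (Measurable.aestronglyMeasurable ?_) (Eventually.of_forall fun p => hs _)
  refine hf.comp (Continuous.measurable ?_)
  exact (hA.comp continuous_snd).add ((continuous_ev.comp continuous_fst).smul
    (hB.comp continuous_snd))

theorem integrable_cm_mul_rho {f : Cn n → ℝ} (hf : Measurable f) {s : ℝ} (hs : ∀ z, |f z| ≤ s)
    {A B : Cn n → Cn n} (hA : Continuous A) (hB : Continuous B) :
    Integrable fun ζ => cm f (A ζ) (B ζ) * rho ζ := by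
  have := (integrable_prod_cm hf hs hA hB).integral_prod_right
  simpa only [cm, integral_mul_const] using this

theorem cm_moll {f : Cn n → ℝ} (hf : Measurable f) {s : ℝ} (hs : ∀ z, |f z| ≤ s) (δ : ℝ)
    (a b : Cn n) : cm (moll f δ) a b = ∫ ζ, cm f (a + δ • ζ) b * rho ζ := by
  simp only [cm, moll]
  have h := integral_integral_swap (f := fun θ ζ => f (a + δ • ζ + ev θ • b) * rho ζ)
    (integrable_prod_cm hf hs
    (A := fun ζ => a + δ • ζ) (B := fun _ => b) (by fun_prop) continuous_const)
  simp only [integral_mul_const] at h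
  rw [← h]
  refine integral_congr_ae (Eventually.of_forall fun θ => ?_)
  refine integral_congr_ae (Eventually.of_forall fun ζ => ?_)
  simp only [add_right_comm]

variable {Ω : Set (Cn n)} {s : ℝ} {f : Cn n → ℝ}

theorem SubMean.moll_le_moll (hf : SubMean Ω s f) {δ δ' : ℝ} (h0 : 0 ≤ δ') (h1 : δ' ≤ δ) {z : Cn n}
    (hz : Metric.closedBall z δ ⊆ Ω) : moll f δ' z ≤ moll f δ z := by
  rcases (h0.trans h1).eq_or_lt with hδ | hδ
  · rw [← hδ] at h1 ⊢
    rw [le_antisymm h1 h0]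
  rw [moll_eq_cm hf.meas hf.abs_le, moll_eq_cm hf.meas hf.abs_le]
  refine integral_mono
    (integrable_cm_mul_rho hf.meas hf.abs_le continuous_const (continuous_const_smul δ'))
    (integrable_cm_mul_rho hf.meas hf.abs_le continuous_const (continuous_const_smul δ)) fun ζ => ?_
  rcases le_total 1 ‖ζ‖ with hζ | hζ
  · simp [rho_eq_zero hζ]
  refine mul_le_mul_of_nonneg_right ?_ (rho_nonneg _)
  have h2 : δ' • ζ = (δ' / δ) • (δ • ζ) := by rw [smul_smul, div_mul_cancel₀ _ hδ.ne']
  rw [h2]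
  refine hf.mean z (δ • ζ) (fun ξ hξ => hz ?_) _ (by positivity) (div_le_one_of_le₀ h1 hδ.le)
  rw [mem_closedBall_iff_norm, add_sub_cancel_left, norm_smul, norm_smul, Real.norm_of_nonneg hδ.le]
  calc ‖ξ‖ * (δ * ‖ζ‖) ≤ 1 * (δ * 1) := by gcongr
    _ = δ := by ring

theorem SubMean.le_moll (hf : SubMean Ω s f) {δ : ℝ} (h0 : 0 ≤ δ) {z : Cn n}
    (hz : Metric.closedBall z δ ⊆ Ω) : f z ≤ moll f δ z := by
  rw [← moll_zero f z]; exact hf.moll_le_moll le_rfl h0 hz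

theorem SubMean.moll_nonpos (hf : SubMean Ω s f) (δ : ℝ) (z : Cn n) : moll f δ z ≤ 0 :=
  moll_le_of_le hf.meas hf.abs_le fun _ _ => hf.high _

theorem SubMean.le_moll_const (hf : SubMean Ω s f) (δ : ℝ) (z : Cn n) : -s ≤ moll f δ z := by
  rw [← moll_const (-s) δ z]
  exact moll_mono measurable_const (fun _ => le_rfl) hf.meas hf.abs_le hf.low δ z

theorem SubMean.smooth (hf : SubMean Ω s f) {δ : ℝ} (hδ : 0 < δ) : Smooth (moll f δ) :=
  smooth_moll hf.meas hf.abs_le hδ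

theorem SubMean.moll_le_cm (hf : SubMean Ω s f) {δ : ℝ} (hδ : 0 ≤ δ) {a b : Cn n}
    (h : ∀ ζ : ℂ, ‖ζ‖ ≤ 1 → Metric.closedBall (a + ζ • b) δ ⊆ Ω) :
    moll f δ a ≤ cm (moll f δ) a b := by
  have h0 : moll f δ a = cm (moll f δ) a ((0 : ℝ) • b) := by simp [cm]
  rw [h0, cm_moll hf.meas hf.abs_le, cm_moll hf.meas hf.abs_le]
  refine integral_mono
    (integrable_cm_mul_rho hf.meas hf.abs_le (by fun_prop) continuous_const)
    (integrable_cm_mul_rho hf.meas hf.abs_le (by fun_prop) continuous_const) fun x => ?_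
  rcases le_total 1 ‖x‖ with hx | hx
  · simp [rho_eq_zero hx]
  refine mul_le_mul_of_nonneg_right ?_ (rho_nonneg _)
  refine hf.mean _ _ (fun ζ hζ => h ζ hζ ?_) 0 le_rfl zero_le_one
  rw [mem_closedBall_iff_norm, show a + δ • x + ζ • b - (a + ζ • b) = δ • x by abel, norm_smul,
    Real.norm_of_nonneg hδ]
  exact mul_le_of_le_one_right hδ hx

theorem eventually_moll_le (hΩ : IsOpen Ω) (hf : SubMean Ω s f) (husc : UpperSemicontinuousOn f Ω)
    {z : Cn n} (hz : z ∈ Ω) {c : ℝ} (hc : f z < c) :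
    ∃ δ0 > 0, ∀ δ, 0 ≤ δ → δ ≤ δ0 → moll f δ z ≤ c := by
  have h1 := husc z hz c hc
  rw [hΩ.nhdsWithin_eq hz] at h1
  obtain ⟨r, hr, hball⟩ := Metric.eventually_nhds_iff_ball.1 h1
  refine ⟨r / 2, by positivity, fun δ h0 hδ => moll_le_of_le hf.meas hf.abs_le fun ζ hζ => ?_⟩
  refine (hball _ ?_).le
  rw [mem_ball_iff_norm, add_sub_cancel_left, norm_smul, Real.norm_of_nonneg h0]
  nlinarith [norm_nonneg ζ]

theorem SubMean.of_tendsto {w : ℕ → Cn n → ℝ} (hw : ∀ k, SubMean Ω s (w k)) {W : Cn n → ℝ}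
    (h : ∀ z, Tendsto (fun k => w k z) atTop (𝓝 (W z))) : SubMean Ω s W where
  meas := measurable_of_tendsto_metrizable (fun k => (hw k).meas) (tendsto_pi_nhds.2 h)
  low z := ge_of_tendsto' (h z) fun k => (hw k).low z
  high z := le_of_tendsto' (h z) fun k => (hw k).high z
  off z hz := tendsto_nhds_unique (h z) (by simp only [(hw _).off z hz]; exact tendsto_const_nhds)
  mean a b hab t h0 h1 := by
    have key : ∀ a b, Tendsto (fun k => cm (w k) a b) atTop (𝓝 (cm W a b)) := fun a b =>
      tendsto_integral_of_dominated_convergence (fun _ => s)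
        (fun k => ((hw k).integrable a b).aestronglyMeasurable) (integrable_const _)
        (fun k => Eventually.of_forall fun θ => (hw k).abs_le _)
        (Eventually.of_forall fun θ => h _)
    exact le_of_tendsto_of_tendsto' (key _ _) (key _ _) fun k => (hw k).mean a b hab t h0 h1

theorem integral_quadratic_circle (l : Cn n →L[ℝ] ℝ) (B : Cn n →L[ℝ] Cn n →L[ℝ] ℝ) (b : Cn n) :
    ∫ θ, (l (ev θ • b) + B (ev θ • b) (ev θ • b)) ∂AddCircle.haarAddCircle =
      (B b b + B (Complex.I • b) (Complex.I • b)) / 2 := by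
  have hev : ∀ θ, ev θ • b = (ev θ).re • b + (ev θ).im • (Complex.I • b) := fun θ => by
    conv_lhs => rw [← Complex.re_add_im (ev θ)]
    rw [add_smul, mul_smul, Complex.coe_smul, Complex.coe_smul]
  have hsq : ∀ θ, (ev θ).re ^ 2 + (ev θ).im ^ 2 = 1 := fun θ => by
    have := Complex.sq_norm (ev θ)
    rw [norm_ev, Complex.normSq_apply] at this
    nlinarith
  have hc1 : Continuous fun θ => (ev θ).re := Complex.continuous_re.comp continuous_ev
  have hc2 : Continuous fun θ => (ev θ).im := Complex.continuous_im.comp continuous_ev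
  have hi1 := integral_ev_pow (k := 1) one_ne_zero
  have hi2 := integral_ev_pow (k := 2) two_ne_zero
  simp only [pow_one] at hi1
  have hre1 : ∫ θ, (ev θ).re ∂AddCircle.haarAddCircle = 0 := by
    have := integral_re (integrable_circle' (f := fun θ => ev θ) continuous_ev)
    simp only [RCLike.re_eq_complex_re] at this
    rw [this, hi1]; rfl
  have him1 : ∫ θ, (ev θ).im ∂AddCircle.haarAddCircle = 0 := by
    have := integral_im (integrable_circle' (f := fun θ => ev θ) continuous_ev)
    simp only [RCLike.im_eq_complex_im] at this
    rw [this, hi1]; rfl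
  have hre2 : ∫ θ, ((ev θ) ^ 2).re ∂AddCircle.haarAddCircle = 0 := by
    have := integral_re (integrable_circle' (f := fun θ => ev θ ^ 2) (continuous_ev.pow 2))
    simp only [RCLike.re_eq_complex_re] at this
    rw [this, hi2]; rfl
  have him2 : ∫ θ, ((ev θ) ^ 2).im ∂AddCircle.haarAddCircle = 0 := by
    have := integral_im (integrable_circle' (f := fun θ => ev θ ^ 2) (continuous_ev.pow 2))
    simp only [RCLike.im_eq_complex_im] at this
    rw [this, hi2]; rfl
  set p := B b b
  set q := B (Complex.I • b) (Complex.I • b)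
  set r := B b (Complex.I • b) + B (Complex.I • b) b
  have key : ∀ θ, l (ev θ • b) + B (ev θ • b) (ev θ • b) =
      (((ev θ).re * l b + (ev θ).im * l (Complex.I • b)) +
        (((ev θ) ^ 2).re * ((p - q) / 2) + ((ev θ) ^ 2).im * (r / 2))) + (p + q) / 2 := fun θ => by
    rw [hev θ]
    simp only [map_add, map_smul, add_apply, smul_apply, smul_eq_mul, p, q, r, sq, Complex.mul_re,
      Complex.mul_im]
    have := hsq θ
    linear_combination ((B b) b + (B (Complex.I • b)) (Complex.I • b)) / 2 * this
  simp_rw [key]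
  have hq1 : Continuous fun θ => ((ev θ) ^ 2).re := Complex.continuous_re.comp (continuous_ev.pow 2)
  have hq2 : Continuous fun θ => ((ev θ) ^ 2).im := Complex.continuous_im.comp (continuous_ev.pow 2)
  have i : ∀ {g : UnitAddCircle → ℝ} (_ : Continuous g) (c : ℝ),
      Integrable (fun θ => g θ * c) AddCircle.haarAddCircle := fun hg c =>
    integrable_circle (hg.mul continuous_const)
  have i5 : Integrable (fun θ => (ev θ).re * l b + (ev θ).im * l (Complex.I • b))
    AddCircle.haarAddCircle := (i hc1 _).add (i hc2 _)
  have i6 : Integrable (fun θ => (ev θ ^ 2).re * ((p - q) / 2) + (ev θ ^ 2).im * (r / 2))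
    AddCircle.haarAddCircle := (i hq1 _).add (i hq2 _)
  have i7 : Integrable (fun θ => ((ev θ).re * l b + (ev θ).im * l (Complex.I • b)) +
    ((ev θ ^ 2).re * ((p - q) / 2) + (ev θ ^ 2).im * (r / 2))) AddCircle.haarAddCircle := i5.add i6
  rw [integral_add i7 (integrable_const _), integral_add i5 i6, integral_add (i hc1 _) (i hc2 _),
    integral_add (i hq1 _) (i hq2 _)]
  simp only [integral_mul_const, hre1, him1, hre2, him2]
  simp

theorem Smooth.sndDeriv_symm {v : Cn n → ℝ} (hv : Smooth v) (x a b : Cn n) :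
    fderiv ℝ (fderiv ℝ v) x a b = fderiv ℝ (fderiv ℝ v) x b a :=
  (ContDiffAt.isSymmSndFDerivAt (n := (⊤ : ℕ∞)) hv.contDiffAt (by simp; norm_cast)) a b

theorem Smooth.taylor_two {v : Cn n → ℝ} (hv : Smooth v) (x : Cn n) {ε : ℝ} (hε : 0 < ε) :
    ∃ δ > 0, ∀ h : Cn n, ‖h‖ < δ →
      |v (x + h) - v x - (fderiv ℝ v x h + 1 / 2 * fderiv ℝ (fderiv ℝ v) x h h)| ≤ ε * ‖h‖ ^ 2 := by
  have hD : DifferentiableAt ℝ (fderiv ℝ v) x :=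
    (ContDiff.differentiable (ContDiff.fderiv_right hv (m := 1) (by
      norm_cast)) (by simp)) x
  obtain ⟨δ, hδ, hball⟩ := Metric.eventually_nhds_iff_ball.1
    ((Asymptotics.isLittleO_iff.1 (hasFDerivAt_iff_isLittleO_nhds_zero.1 hD.hasFDerivAt)) hε)
  refine ⟨δ, hδ, fun h hh => ?_⟩
  set B := fderiv ℝ (fderiv ℝ v) x with hB
  set R : Cn n → ℝ := fun y => v (x + y) - v x - (fderiv ℝ v x y + 1 / 2 * B y y) with hR
  have hder : ∀ y, HasFDerivAt R (fderiv ℝ v (x + y) - fderiv ℝ v x - B y) y := fun y => by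
    have h1 : HasFDerivAt (fun y => v (x + y)) (fderiv ℝ v (x + y)) y := by
      have := (hv.diff (x + y)).hasFDerivAt.comp y ((hasFDerivAt_id y).const_add x)
      exact this.congr_fderiv (by ext w; rfl)
    have h2 : HasFDerivAt (fun y => B y y) ((2 : ℝ) • B y) y := by
      have := (B.hasFDerivAt (x := y)).clm_apply (hasFDerivAt_id y)
      refine this.congr_fderiv ?_
      ext w
      change B y w + B w y = (2 : ℝ) * B y w
      rw [hB, hv.sndDeriv_symm x w y, two_mul]
    have h3 := (h1.sub_const (v x)).sub
      (((fderiv ℝ v x).hasFDerivAt (x := y)).add (h2.const_mul (1 / 2)))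
    refine h3.congr_fderiv ?_
    rw [smul_smul]
    norm_num
    abel
  have hmv := (convex_closedBall (0 : Cn n) ‖h‖).norm_image_sub_le_of_norm_hasFDerivWithin_le
    (f := R) (C := ε * ‖h‖) (fun y _ => (hder y).hasFDerivWithinAt) (fun y hy => ?_)
    (Metric.mem_closedBall_self (norm_nonneg h)) (y := h) (by simp)
  · have h0 : R 0 = 0 := by simp [hR]
    rw [h0, sub_zero, sub_zero, Real.norm_eq_abs] at hmv
    refine hmv.trans (by rw [sq, mul_assoc])
  · have hy' : ‖y‖ ≤ ‖h‖ := by simpa using hy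
    refine (hball y (by simpa using hy'.trans_lt hh)).trans (by gcongr)

theorem Smooth.laplacian_nonneg {v : Cn n → ℝ} (hv : Smooth v) {x b : Cn n}
    (h : ∃ t0 > 0, ∀ t : ℝ, 0 < t → t < t0 → v x ≤ cm v x (t • b)) :
    0 ≤ fderiv ℝ (fderiv ℝ v) x b b +
      fderiv ℝ (fderiv ℝ v) x (Complex.I • b) (Complex.I • b) := by
  set B := fderiv ℝ (fderiv ℝ v) x with hB
  obtain ⟨t0, ht0, hle⟩ := h
  by_contra! hneg
  set c := B b b + B (Complex.I • b) (Complex.I • b) with hc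
  set ε := -c / (8 * (‖b‖ ^ 2 + 1)) with hεd
  have hb0 : 0 < ‖b‖ ^ 2 + 1 := by positivity
  have hε : 0 < ε := div_pos (by linarith) (by linarith)
  have hεb : ε * ‖b‖ ^ 2 ≤ -c / 8 := by
    have : ε * (‖b‖ ^ 2 + 1) = -c / 8 := by rw [hεd]; field_simp
    nlinarith
  obtain ⟨δ, hδ, hT⟩ := hv.taylor_two x hε
  obtain ⟨t, ht, ht1⟩ : ∃ t : ℝ, 0 < t ∧ t < min t0 (δ / (‖b‖ + 1)) :=
    exists_between (lt_min ht0 (by positivity))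
  have htδ : t * ‖b‖ < δ := by
    have h1 := (lt_min_iff.1 ht1).2
    rw [lt_div_iff₀ (by positivity)] at h1
    nlinarith [norm_nonneg b]
  have hcont : Continuous v := ContDiff.continuous hv
  have hmap : Continuous fun θ => ev θ • (t • b) := continuous_ev.smul continuous_const
  have hbound : ∀ θ, v (x + ev θ • (t • b)) ≤ (fderiv ℝ v x (ev θ • (t • b)) +
      ((1 / 2 : ℝ) • B) (ev θ • (t • b)) (ev θ • (t • b))) + (v x + ε * (t * ‖b‖) ^ 2) := fun θ => by
    have hn : ‖ev θ • (t • b)‖ = t * ‖b‖ := by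
      rw [norm_smul, norm_ev, one_mul, norm_smul, Real.norm_of_nonneg ht.le]
    have h1 := (abs_le.1 (hT (ev θ • (t • b)) (by rw [hn]; exact htδ))).2
    rw [hn] at h1
    simp only [smul_apply, smul_eq_mul]
    linarith
  have hi1 : Integrable (fun θ => fderiv ℝ v x (ev θ • (t • b)) +
      ((1 / 2 : ℝ) • B) (ev θ • (t • b)) (ev θ • (t • b))) AddCircle.haarAddCircle := by
    refine integrable_circle (Continuous.add ((fderiv ℝ v x).continuous.comp hmap) ?_)
    exact (((1 / 2 : ℝ) • B).continuous.comp hmap).clm_apply hmap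
  have h1 : cm v x (t • b) ≤ _ := integral_mono
    (integrable_circle (hcont.comp (continuous_const.add hmap))) (hi1.add (integrable_const _)) hbound
  have h2 := hle t ht (lt_min_iff.1 ht1).1
  rw [integral_add' hi1 (integrable_const _), integral_quadratic_circle] at h1
  have h4 : ((1 / 2 : ℝ) • B) (t • b) (t • b) +
      ((1 / 2 : ℝ) • B) (Complex.I • t • b) (Complex.I • t • b) = t ^ 2 / 2 * c := by
    rw [smul_comm Complex.I t b]
    simp only [smul_apply, map_smul, smul_eq_mul, hc]
    ring
  rw [h4] at h1
  simp only [integral_const, probReal_univ, one_smul] at h1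
  have h5 : 0 < t ^ 2 := by positivity
  have h6 : ε * (t * ‖b‖) ^ 2 ≤ t ^ 2 * (-c / 8) := by
    calc ε * (t * ‖b‖) ^ 2 = t ^ 2 * (ε * ‖b‖ ^ 2) := by ring
      _ ≤ _ := mul_le_mul_of_nonneg_left hεb h5.le
  nlinarith

theorem reB_eq {v : Cn n → ℝ} (hv : Smooth v) (x a b : Cn n) :
    reB n v x a b = fderiv ℝ (fderiv ℝ v) x a b := by
  have hD : DifferentiableAt ℝ (fderiv ℝ v) x :=
    (ContDiff.differentiable (ContDiff.fderiv_right hv (m := 1) (by norm_cast)) (by simp)) x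
  rw [reB, fderiv_clm_apply hD (differentiableAt_const b)]
  simp

open scoped ComplexOrder in
theorem posSemidef_of_laplacian {v : Cn n → ℝ} (hv : Smooth v) {x : Cn n}
    (h : ∀ b, 0 ≤ fderiv ℝ (fderiv ℝ v) x b b +
      fderiv ℝ (fderiv ℝ v) x (Complex.I • b) (Complex.I • b)) : (hess v x).PosSemidef := by
  have hH : (hess v x).IsHermitian := hess_conjTranspose hv x
  refine Matrix.PosSemidef.of_dotProduct_mulVec_nonneg hH fun c => ?_
  rw [Complex.nonneg_iff]
  refine ⟨?_, (hH.im_star_dotProduct_mulVec_self c).symm⟩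
  set B := fderiv ℝ (fderiv ℝ v) x with hB
  set b : Cn n := star c with hb
  obtain ⟨α, hα⟩ : ∃ α : Fin n → ℝ, ∀ j, (b j).re = α j := ⟨_, fun _ => rfl⟩
  obtain ⟨β, hβ⟩ : ∃ β : Fin n → ℝ, ∀ j, (b j).im = β j := ⟨_, fun _ => rfl⟩
  have hbe : b = ∑ j, (α j • (Pi.single j 1 : Cn n) + β j • (Pi.single j Complex.I : Cn n)) := by
    ext k
    simp only [Finset.sum_apply, Pi.add_apply, Pi.smul_apply, Pi.single_apply, smul_ite, smul_zero]
    rw [Finset.sum_add_distrib]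
    simp [← hα, ← hβ, Complex.re_add_im]
  have hIbe : Complex.I • b =
      ∑ j, ((-β j) • (Pi.single j 1 : Cn n) + α j • (Pi.single j Complex.I : Cn n)) := by
    ext k
    simp only [Finset.sum_apply, Pi.add_apply, Pi.smul_apply, Pi.single_apply, smul_ite, smul_zero]
    rw [Finset.sum_add_distrib]
    simp only [← hα, ← hβ]
    apply Complex.ext <;> simp
  have key : (star c ⬝ᵥ (hess v x).mulVec c).re =
      1 / 4 * (B b b + B (Complex.I • b) (Complex.I • b)) := by
    rw [hIbe, hbe]
    simp only [map_sum, sum_apply, ← Finset.sum_add_distrib, Finset.mul_sum, dotProduct,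
      Matrix.mulVec, Complex.re_sum]
    refine Finset.sum_congr rfl fun j _ => Finset.sum_congr rfl fun k _ => ?_
    have hc1 : star c j = ⟨α j, β j⟩ := Complex.ext (hα j) (hβ j)
    have hc2 : c k = ⟨α k, -β k⟩ := by
      have h1 := hα k
      have h2 := hβ k
      simp only [hb, Pi.star_apply, RCLike.star_def, Complex.conj_re, Complex.conj_im] at h1 h2
      exact Complex.ext h1 (by simp [← h2])
    rw [hc1, hc2, ← cHessEntry_eq_hess hv, cHessEntry]
    simp only [reB_eq hv, ← hB, map_add, map_smul, add_apply, smul_apply, smul_eq_mul]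
    have hs := hv.sndDeriv_symm x
    rw [← hB] at hs
    rw [hs (Pi.single k 1) (Pi.single j 1), hs (Pi.single k 1) (Pi.single j Complex.I),
      hs (Pi.single k Complex.I) (Pi.single j 1),
      hs (Pi.single k Complex.I) (Pi.single j Complex.I)]
    simp
    ring
  rw [key]
  have := h b
  linarith

end

section
variable {n : ℕ} {Ω : Set (Cn n)} {s : ℝ} {f : Cn n → ℝ}

theorem le_cm_of_re_eval_le {v : Cn n → ℝ} (hv : Continuous v) {x b : Cn n} (p : Polynomial ℂ) (t : ℂ)
    (h : ∀ θ, (p.eval (t * ev θ)).re ≤ v (x + ev θ • b)) : (p.eval 0).re ≤ cm v x b := by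
  rw [← integral_eval_circle p t]
  exact integral_mono (integrable_circle (Complex.continuous_re.comp
    (p.continuous.comp (continuous_const.mul continuous_ev))))
    (integrable_circle (hv.comp (continuous_const.add (continuous_ev.smul continuous_const)))) h

theorem cm_le_of_le_re_eval {v : Cn n → ℝ} (hv : Continuous v) {x b : Cn n} (p : Polynomial ℂ) (t : ℂ)
    (h : ∀ θ, v (x + ev θ • b) ≤ (p.eval (t * ev θ)).re) : cm v x b ≤ (p.eval 0).re := by
  rw [← integral_eval_circle p t]
  exact integral_mono (integrable_circle (hv.comp (continuous_const.add
    (continuous_ev.smul continuous_const)))) (integrable_circle (Complex.continuous_re.comp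
    (p.continuous.comp (continuous_const.mul continuous_ev)))) h

theorem normSq_add_eq (a b : ℂ) : Complex.normSq (a + b) =
    Complex.normSq a + Complex.normSq b + 2 * (star a * b).re := by
  simp [Complex.normSq_apply]; ring

open scoped ComplexOrder in
theorem posSemidef_hess_sqn (a x : Cn n) {A c : ℝ} (hA : 0 ≤ A) :
    Smooth (fun z : Cn n => A * (sqn (z - a) - c)) ∧
      (hess (fun z => A * (sqn (z - a) - c)) x).PosSemidef := by
  have hs : Smooth fun z : Cn n => A * (sqn (z - a) - c) :=
    contDiff_const.mul ((ContDiff.comp (g := sqn) smooth_sqn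
      (contDiff_id.sub contDiff_const)).sub contDiff_const)
  refine ⟨hs, posSemidef_of_laplacian hs fun b => hs.laplacian_nonneg ⟨1, one_pos, fun t _ _ => ?_⟩⟩
  have h1 : ∀ w, sqn (x + w - a) = sqn (x - a) + sqn w + 2 * (∑ j, star (x j - a j) * w j).re :=
    fun w => by
      simp only [sqn, Complex.re_sum, Finset.mul_sum, ← Finset.sum_add_distrib]
      refine Finset.sum_congr rfl fun j _ => ?_
      simp only [Pi.add_apply, Pi.sub_apply]
      rw [← normSq_add_eq]
      congr 1
      ring
  have := le_cm_of_re_eval_le (ContDiff.continuous hs) (x := x) (b := t • b)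
    (Polynomial.C ((A * (sqn (x - a) - c) : ℝ) : ℂ) +
      Polynomial.C (A * 2 * ∑ j, star (x j - a j) * (t • b) j) * Polynomial.X) 1 fun θ => by
    rw [h1]
    have h2 : ∑ j, star (x j - a j) * (ev θ • t • b) j =
        (∑ j, star (x j - a j) * (t • b) j) * ev θ := by
      rw [Finset.sum_mul]
      refine Finset.sum_congr rfl fun j _ => ?_
      rw [Pi.smul_apply, smul_eq_mul]; ring
    rw [h2]
    simp only [Polynomial.eval_add, Polynomial.eval_C, Polynomial.eval_mul, Polynomial.eval_X,
      one_mul, Complex.add_re, Complex.ofReal_re]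
    rw [mul_assoc (A * 2 : ℂ)]
    have h3 : ∀ w : ℂ, ((A : ℂ) * 2 * w).re = A * 2 * w.re := fun w => by
      rw [mul_assoc, Complex.re_ofReal_mul, mul_assoc]; simp
    rw [h3]
    nlinarith [mul_nonneg hA (sqn_nonneg (ev θ • t • b))]
  simpa using this

theorem plurisubharmonicOn_of_le_cm {U : Set (Cn n)} {v : Cn n → ℝ} (hv : Continuous v)
    (h : ∀ x ∈ U, ∀ b, ∃ t0 > 0, ∀ t : ℝ, 0 < t → t < t0 → v x ≤ cm v x (t • b)) :
    PlurisubharmonicOn (fun z => ((v z : ℝ) : EReal)) U := by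
  refine ⟨(continuous_coe_real_ereal.comp hv).upperSemicontinuous.upperSemicontinuousOn _,
    fun a b r hr hd p hp ζ hζ => ?_⟩
  simp only [EReal.coe_le_coe_iff] at hp ⊢
  by_contra! hlt
  set g : ℂ → ℝ := fun ζ => v (a + ζ • b) - (p.eval ζ).re with hg
  have hgc : Continuous g := (hv.comp (continuous_const.add
    (continuous_id.smul continuous_const))).sub (Complex.continuous_re.comp p.continuous)
  have hgζ : 0 < g ζ := sub_pos.2 hlt
  obtain ⟨ε, hε, hεr⟩ : ∃ ε > 0, ε * r ^ 2 < g ζ := by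
    refine ⟨g ζ / (2 * r ^ 2), by positivity, ?_⟩
    rw [div_mul_eq_mul_div, div_lt_iff₀ (by positivity)]
    nlinarith [mul_pos hgζ (pow_pos hr 2)]
  obtain ⟨y, hy, hmax⟩ := (isCompact_closedBall (0 : ℂ) r).exists_isMaxOn
    (Metric.nonempty_closedBall.2 hr.le)
    (f := fun ζ => g ζ + ε * Complex.normSq ζ) (by fun_prop)
  have hmax' : ∀ w : ℂ, ‖w‖ ≤ r → g w + ε * Complex.normSq w ≤ g y + ε * Complex.normSq y :=
    fun w hw => hmax (mem_closedBall_zero_iff.2 hw)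
  have hyr : ‖y‖ < r := by
    refine lt_of_le_of_ne (mem_closedBall_zero_iff.1 hy) fun he => ?_
    have h1 := hmax' ζ hζ
    have h2 := hp y he
    rw [Complex.normSq_eq_norm_sq y, he] at h1
    have h3 : g y ≤ 0 := sub_nonpos.2 h2
    nlinarith [mul_nonneg hε.le (Complex.normSq_nonneg ζ)]
  obtain ⟨t0, ht0, hmean⟩ := h (a + y • b) (hd y hyr.le) b
  obtain ⟨t, ht, htlt⟩ := exists_between (lt_min ht0 (sub_pos.2 hyr))
  have h1 := hmean t ht (lt_min_iff.1 htlt).1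
  have h2 := cm_le_of_le_re_eval hv (x := a + y • b) (b := t • b)
    (Polynomial.C ((g y - ε * t ^ 2 : ℝ) : ℂ) + p.comp (Polynomial.C y + Polynomial.X) -
      Polynomial.C (ε * (2 * star y)) * Polynomial.X) t fun θ => by
    have he : a + y • b + ev θ • t • b = a + (y + t * ev θ) • b := by
      rw [add_smul, ← add_assoc, mul_comm, mul_smul, Complex.coe_smul]
    have h3 := hmax' (y + t * ev θ) (by
      refine (norm_add_le _ _).trans ?_
      rw [norm_mul, norm_ev, mul_one, Complex.norm_real, Real.norm_of_nonneg ht.le]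
      linarith [(lt_min_iff.1 htlt).2])
    rw [normSq_add_eq, Complex.normSq_mul, Complex.normSq_eq_norm_sq (ev θ), norm_ev,
      Complex.normSq_ofReal] at h3
    simp only [Polynomial.eval_sub, Polynomial.eval_add, Polynomial.eval_C, Polynomial.eval_mul,
      Polynomial.eval_X, Polynomial.eval_comp, Complex.sub_re, Complex.add_re, Complex.ofReal_re]
    rw [he, mul_assoc (ε : ℂ), Complex.re_ofReal_mul, mul_assoc (2 : ℂ)]
    have h4 : ((2 : ℂ) * (star y * (t * ev θ))).re = 2 * (star y * (t * ev θ)).re := by simp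
    rw [h4]
    have h5 : g (y + t * ev θ) = v (a + (y + t * ev θ) • b) - (p.eval (y + t * ev θ)).re := rfl
    nlinarith
  simp at h2
  rw [← Complex.ofReal_pow, Complex.ofReal_re] at h2
  have h5 : g y = v (a + y • b) - (p.eval y).re := rfl
  nlinarith [mul_pos hε (pow_pos ht 2)]

theorem SubMean.exists_le_cm (hf : SubMean Ω s f) (hΩ : IsOpen Ω) {δ : ℝ} (hδ : 0 ≤ δ) {x : Cn n}
    (hx : Metric.closedBall x δ ⊆ Ω) (b : Cn n) :
    ∃ t0 > 0, ∀ t : ℝ, 0 < t → t < t0 → moll f δ x ≤ cm (moll f δ) x (t • b) := by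
  obtain ⟨η, hη, hsub⟩ := (isCompact_closedBall x δ).exists_cthickening_subset_open hΩ hx
  refine ⟨η / (‖b‖ + 1), by positivity, fun t ht ht1 => hf.moll_le_cm hδ fun ζ hζ => ?_⟩
  refine Set.Subset.trans ?_ hsub
  rw [cthickening_closedBall hη.le hδ]
  refine Metric.closedBall_subset_closedBall' ?_
  rw [dist_eq_norm, add_sub_cancel_left, norm_smul, norm_smul, Real.norm_of_nonneg ht.le]
  rw [lt_div_iff₀ (by positivity)] at ht1
  have : ‖ζ‖ * (t * ‖b‖) ≤ 1 * (t * ‖b‖) := by gcongr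
  nlinarith [norm_nonneg b]

open scoped ComplexOrder in
theorem SubMean.posSemidef (hf : SubMean Ω s f) (hΩ : IsOpen Ω) {δ : ℝ} (hδ : 0 < δ) {x : Cn n}
    (hx : Metric.closedBall x δ ⊆ Ω) : (hess (moll f δ) x).PosSemidef :=
  posSemidef_of_laplacian (hf.smooth hδ) fun b =>
    (hf.smooth hδ).laplacian_nonneg (hf.exists_le_cm hΩ hδ.le hx b)

theorem SubMean.plurisubharmonicOn (hf : SubMean Ω s f) (hΩ : IsOpen Ω) {δ : ℝ} (hδ : 0 < δ)
    {U : Set (Cn n)} (hU : ∀ x ∈ U, Metric.closedBall x δ ⊆ Ω) :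
    PlurisubharmonicOn (fun z => ((moll f δ z : ℝ) : EReal)) U :=
  plurisubharmonicOn_of_le_cm (ContDiff.continuous (hf.smooth hδ)) fun x hx b =>
    hf.exists_le_cm hΩ hδ.le (hU x hx) b

end

section
variable {n : ℕ} {Ω : Set (Cn n)} {s : ℝ}

/-- A smooth convex regularization of the positive part. -/
def mu (t : ℝ) : ℝ := ∫ x in (0 : ℝ)..t, Real.smoothTransition x

theorem hasDerivAt_mu (t : ℝ) : HasDerivAt mu (Real.smoothTransition t) t :=
  Real.smoothTransition.continuous.integral_hasStrictDerivAt 0 t |>.hasDerivAt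

theorem deriv_mu : deriv mu = Real.smoothTransition := funext fun t => (hasDerivAt_mu t).deriv

theorem smooth_mu : Smooth mu :=
  contDiff_infty_iff_deriv.2 ⟨fun t => (hasDerivAt_mu t).differentiableAt, by
    rw [deriv_mu]; exact Real.smoothTransition.contDiff⟩

theorem deriv_smoothTransition_nonneg (t : ℝ) : 0 ≤ deriv Real.smoothTransition t :=
  Real.smoothTransition.monotone.deriv_nonneg

theorem mu_sub (x y : ℝ) : mu y - mu x = ∫ t in x..y, Real.smoothTransition t :=
  intervalIntegral.integral_interval_sub_left
    (Real.smoothTransition.continuous.intervalIntegrable _ _)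
    (Real.smoothTransition.continuous.intervalIntegrable _ _)

theorem mu_mono : Monotone mu := fun x y hxy => by
  rw [← sub_nonneg, mu_sub]
  exact intervalIntegral.integral_nonneg hxy fun _ _ => Real.smoothTransition.nonneg _

theorem mu_sub_le {x y : ℝ} (hxy : x ≤ y) : mu y - mu x ≤ y - x := by
  rw [mu_sub]
  have h := intervalIntegral.integral_mono_on (μ := volume) hxy
    (Real.smoothTransition.continuous.intervalIntegrable x y)
    (continuous_const (y := (1 : ℝ)).intervalIntegrable x y) fun t _ =>
      Real.smoothTransition.le_one t
  simpa using h

theorem mu_sub_eq {x y : ℝ} (hx : 1 ≤ x) (hy : 1 ≤ y) : mu y - mu x = y - x := by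
  rw [mu_sub, intervalIntegral.integral_congr (g := fun _ => (1 : ℝ)) fun t ht => ?_]
  · simp
  · exact Real.smoothTransition.one_of_one_le ((le_inf hx hy).trans ht.1)

theorem mu_zero : mu 0 = 0 := intervalIntegral.integral_same

theorem mu_of_nonpos {t : ℝ} (ht : t ≤ 0) : mu t = 0 := by
  rw [mu, intervalIntegral.integral_congr (g := fun _ => (0 : ℝ)) fun x hx => ?_]
  · simp
  · exact Real.smoothTransition.zero_of_nonpos (hx.2.trans (by simp [ht]))

theorem mu_nonneg (t : ℝ) : 0 ≤ mu t := by
  rcases le_total t 0 with h | h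
  · rw [mu_of_nonpos h]
  · rw [← mu_zero]; exact mu_mono h

theorem mu_le {t : ℝ} (ht : 0 ≤ t) : mu t ≤ t := by
  simpa [mu_zero] using mu_sub_le ht

theorem one_le_mu {t : ℝ} (ht : 2 ≤ t) : 1 ≤ mu t := by
  have h1 := mu_sub_eq le_rfl (one_le_two.trans ht)
  have h2 := mu_nonneg 1
  linarith

open scoped ComplexOrder in
theorem SPSH.add_mu_sub {L : Set (Cn n)} {ψ w : Cn n → ℝ} (hψ : SPSH L ψ) (hw : SPSH L w) :
    SPSH L fun x => ψ x + mu (w x - ψ x) := by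
  have hh : Smooth fun x => w x - ψ x := hw.1.sub hψ.1
  have hm : Smooth fun x => mu (w x - ψ x) := smooth_mu.comp hh
  refine ⟨hψ.1.add hm, fun x hx => ?_⟩
  rw [hess_add hψ.1 hm]
  have h1 := hess_comp_sub_posSemidef smooth_mu hh (x := x) (by
    rw [deriv_mu]; exact deriv_smoothTransition_nonneg _)
  set c := deriv mu (w x - ψ x) with hc
  have hc0 : 0 ≤ c := by rw [hc, deriv_mu]; exact Real.smoothTransition.nonneg _
  have hc1 : 0 ≤ 1 - c := by rw [hc, deriv_mu]; exact sub_nonneg.2 (Real.smoothTransition.le_one _)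
  have e : hess ψ x + hess (fun x => mu (w x - ψ x)) x =
      (hess (fun x => mu (w x - ψ x)) x - (c : ℂ) • hess (fun x => w x - ψ x) x) +
      ((c : ℂ) • hess w x + ((1 - c : ℝ) : ℂ) • hess ψ x) := by
    rw [hess_sub hw.1 hψ.1, smul_sub]
    push_cast
    rw [sub_smul, one_smul]
    abel
  rw [e]
  exact h1.add (((hw.2 x hx).smul (Complex.zero_le_real.mpr hc0)).add
    ((hψ.2 x hx).smul (Complex.zero_le_real.mpr hc1)))

open scoped ComplexOrder in
theorem SPSH.add_mu_const {L : Set (Cn n)} {ψ : Cn n → ℝ} (hψ : SPSH L ψ) (c : ℝ) :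
    SPSH L fun x => ψ x + mu (c - ψ x) := by
  refine hψ.add_mu_sub (w := fun _ => c) ⟨contDiff_const, fun x _ => ?_⟩
  have := hess_const_mul 0 (hψ.1) x
  rw [show hess (fun _ : Cn n => c) x = 0 from ?_]
  · exact Matrix.PosSemidef.zero
  · have h1 := hess_add_const c (contDiff_const (c := (0 : ℝ)) : Smooth fun _ : Cn n => (0 : ℝ)) x
    simp only [zero_mul, zero_add] at this h1
    rw [h1, this]
    simp

/-- The local strictly psh quadratic exhaustion. -/
def quad (a : Cn n) (R s : ℝ) (z : Cn n) : ℝ := (8 * (s + 2) / R ^ 2) * (sqn (z - a) - R ^ 2 / 4)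

variable {a : Cn n} {R : ℝ}

theorem norm_le_of_quad_le (hR : 0 < R) (hs : 0 ≤ s) {z : Cn n} (hz : quad a R s z ≤ 2) :
    ‖z - a‖ ≤ 3 / 4 * R := by
  have h1 := norm_sq_le_sqn (z - a)
  rw [quad, div_mul_eq_mul_div, div_le_iff₀ (by positivity)] at hz
  have h2 : sqn (z - a) ≤ (3 / 4 * R) ^ 2 := by
    by_contra! h
    nlinarith [pow_pos hR 2]
  nlinarith [norm_nonneg (z - a)]

theorem quad_le_of_sqn_le (hR : 0 < R) (hs : 0 ≤ s) {z : Cn n} (hz : sqn (z - a) ≤ R ^ 2 / 8) :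
    quad a R s z ≤ -s - 2 := by
  rw [quad, div_mul_eq_mul_div, div_le_iff₀ (by positivity)]
  nlinarith [pow_pos hR 2]

theorem le_quad (hR : 0 < R) (hs : 0 ≤ s) (z : Cn n) : -(2 * (s + 2)) ≤ quad a R s z := by
  rw [quad, div_mul_eq_mul_div, le_div_iff₀ (by positivity)]
  nlinarith [pow_pos hR 2, sqn_nonneg (z - a)]

theorem spsh_quad (L : Set (Cn n)) (hR : 0 < R) (hs : 0 ≤ s) : SPSH L (quad a R s) := by
  have hA : 0 ≤ 8 * (s + 2) / R ^ 2 := by positivity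
  exact ⟨(posSemidef_hess_sqn a a (c := R ^ 2 / 4) hA).1, fun x _ => (posSemidef_hess_sqn a x hA).2⟩

/-- The frame associated with `quad`. -/
def locFrame (a : Cn n) (R s : ℝ) (hR : 0 < R) (hs : 0 ≤ s) : Frame n where
  L := {z | quad a R s z ≤ 2}
  L' := {z | quad a R s z ≤ 0}
  ψ := quad a R s
  h0 z := mu (2 - quad a R s z)
  a := -(2 * (s + 2))
  b := 2
  cL := (isCompact_closedBall a (3 / 4 * R)).of_isClosed_subset
    (isClosed_le (ContDiff.continuous (spsh_quad ∅ hR hs).1) continuous_const) fun z hz => by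
      rw [Metric.mem_closedBall, dist_eq_norm]; exact norm_le_of_quad_le hR hs hz
  sub z hz := le_trans (show quad a R s z ≤ 0 from hz) zero_le_two
  psh := spsh_quad _ hR hs
  smooth_h0 := smooth_mu.comp (contDiff_const.sub (spsh_quad ∅ hR hs).1)
  h0_nonneg _ := mu_nonneg _
  h0_zero z hz := mu_of_nonpos (by linarith [not_le.1 (show ¬ quad a R s z ≤ 2 from hz)])
  h0_one z hz := one_le_mu (by linarith [show quad a R s z ≤ 0 from hz])
  psh_add := (spsh_quad _ hR hs).add_mu_const 2
  hab := by linarith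
  bd z hz := ⟨le_quad hR hs z, hz⟩

/-- The modification of `w` equal to the quadratic near the boundary. -/
def glue (a : Cn n) (R s : ℝ) (w : Cn n → ℝ) (z : Cn n) : ℝ :=
  quad a R s z + mu (w z - quad a R s z)

theorem glue_mono {w w' : Cn n → ℝ} (z : Cn n) (h : w z ≤ w' z) :
    glue a R s w z ≤ glue a R s w' z := by
  have := mu_mono (sub_le_sub_right h (quad a R s z))
  simp only [glue]; linarith

theorem glue_sub_le {w w' : Cn n → ℝ} (z : Cn n) (h : w z ≤ w' z) :
    glue a R s w' z - glue a R s w z ≤ w' z - w z := by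
  have := mu_sub_le (sub_le_sub_right h (quad a R s z))
  simp only [glue]; linarith

theorem glue_sub_eq (hR : 0 < R) (hs : 0 ≤ s) {w w' : Cn n → ℝ} {z : Cn n}
    (hz : sqn (z - a) ≤ R ^ 2 / 8) (hw : -s ≤ w z) (hw' : -s ≤ w' z) :
    glue a R s w' z - glue a R s w z = w' z - w z := by
  have h := quad_le_of_sqn_le hR hs hz
  have := mu_sub_eq (x := w z - quad a R s z) (y := w' z - quad a R s z) (by linarith) (by linarith)
  simp only [glue]; linarith

theorem quad_le_glue (w : Cn n → ℝ) (z : Cn n) : quad a R s z ≤ glue a R s w z := by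
  have := mu_nonneg (w z - quad a R s z)
  simp only [glue]; linarith

theorem adm_glue (hR : 0 < R) (hs : 0 ≤ s) {w : Cn n → ℝ} (hw0 : ∀ z, w z ≤ 0)
    (hw : SPSH (locFrame a R s hR hs).L w) : (locFrame a R s hR hs).Adm (glue a R s w) := by
  refine ⟨⟨(spsh_quad _ hR hs).add_mu_sub hw, fun x hx =>
    ⟨(le_quad hR hs x).trans (quad_le_glue w x), ?_⟩⟩, fun x hx => ?_⟩
  · change glue a R s w x ≤ 2
    have hx : quad a R s x ≤ 2 := hx
    rcases le_total (w x) (quad a R s x) with h | h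
    · rw [glue, mu_of_nonpos (sub_nonpos.2 h)]; linarith
    · rw [glue]
      linarith [mu_le (sub_nonneg.2 h), hw0 x]
  · have hx : 0 < quad a R s x := not_le.1 hx
    change glue a R s w x = quad a R s x
    rw [glue, mu_of_nonpos (by linarith [hw0 x]), add_zero]

theorem closedBall_subset_of_mem_L (hR : 0 < R) (hs : 0 ≤ s) {z : Cn n}
    (hz : z ∈ (locFrame a R s hR hs).L) :
    Metric.closedBall z (R / 4) ⊆ Metric.closedBall a R :=
  Metric.closedBall_subset_closedBall' (by
    rw [dist_eq_norm]; linarith [norm_le_of_quad_le hR hs hz])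

theorem SubMean.spsh (hR : 0 < R) (hs : 0 ≤ s) (hΩ : IsOpen Ω) (ha : Metric.closedBall a R ⊆ Ω)
    {s' : ℝ} {f : Cn n → ℝ} (hf : SubMean Ω s' f) {δ : ℝ} (hδ : 0 < δ) (hδR : δ ≤ R / 4) :
    SPSH (locFrame a R s hR hs).L (moll f δ) :=
  ⟨hf.smooth hδ, fun _ hx => hf.posSemidef hΩ hδ
    ((Metric.closedBall_subset_closedBall hδR).trans
      ((closedBall_subset_of_mem_L hR hs hx).trans ha))⟩

end

section
variable {n : ℕ} {Ω : Set (Cn n)} {s : ℝ} {a : Cn n} {R : ℝ}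

theorem SubMean.adm (hR : 0 < R) (hs : 0 ≤ s) (hΩ : IsOpen Ω) (ha : Metric.closedBall a R ⊆ Ω)
    {f : Cn n → ℝ} (hf : SubMean Ω s f) {δ : ℝ} (hδ : 0 < δ) (hδR : δ ≤ R / 4) :
    (locFrame a R s hR hs).Adm (glue a R s (moll f δ)) :=
  adm_glue hR hs (hf.moll_nonpos δ) (hf.spsh hR hs hΩ ha hδ hδR)

theorem SubMean.glue_moll_mono (hR : 0 < R) (hs : 0 ≤ s) (hΩ : IsOpen Ω)
    (ha : Metric.closedBall a R ⊆ Ω) {f : Cn n → ℝ} (hf : SubMean Ω s f) {δ δ' : ℝ} (hδ' : 0 < δ')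
    (hδ : δ' ≤ δ) (hδR : δ ≤ R / 4) (x : Cn n) :
    glue a R s (moll f δ') x ≤ glue a R s (moll f δ) x := by
  by_cases hx : x ∈ (locFrame a R s hR hs).L
  · exact glue_mono x (hf.moll_le_moll hδ'.le hδ ((Metric.closedBall_subset_closedBall hδR).trans
      ((closedBall_subset_of_mem_L hR hs hx).trans ha)))
  · have hx' := fun h => hx ((locFrame a R s hR hs).sub h)
    rw [(hf.adm hR hs hΩ ha hδ' (hδ.trans hδR)).2 x hx',
      (hf.adm hR hs hΩ ha (hδ'.trans_le hδ) hδR).2 x hx']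

theorem integrable_of_bound_off {f : Cn n → ℝ} (hb : Bornology.IsBounded Ω)
    (hf : Measurable f) {c : ℝ} (hc : ∀ z, |f z| ≤ c) (h0 : ∀ z ∉ Ω, f z = 0) : Integrable f := by
  rw [← integrableOn_iff_integrable_of_support_subset (s := Ω) fun z hz => by
    by_contra h; exact hz (h0 z h)]
  exact IntegrableOn.of_bound hb.measure_lt_top hf.aestronglyMeasurable c
    (Eventually.of_forall fun z => hc z)

theorem SubMean.integrable_volume (hb : Bornology.IsBounded Ω) {f : Cn n → ℝ}
    (hf : SubMean Ω s f) : Integrable f := integrable_of_bound_off hb hf.meas hf.abs_le hf.off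

theorem SubMean.tendsto_integral (hΩ : IsOpen Ω) (hb : Bornology.IsBounded Ω)
    {w : ℕ → Cn n → ℝ} {W : Cn n → ℝ} (hw : ∀ j, SubMean Ω s (w j))
    (hW : ∀ z, Tendsto (fun k => w k z) atTop (𝓝 (W z))) :
    Tendsto (fun k => ∫ z, (W z - w k z)) atTop (𝓝 0) := by
  have hWs := SubMean.of_tendsto hw hW
  have h1 : Tendsto (fun k => ∫ z, w k z) atTop (𝓝 (∫ z, W z)) := by
    refine tendsto_integral_of_dominated_convergence (Ω.indicator fun _ => s)
      (fun k => (hw k).meas.aestronglyMeasurable) ?_ (fun k => Eventually.of_forall fun z => ?_)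
      (Eventually.of_forall hW)
    · exact (integrable_indicator_iff hΩ.measurableSet).2 (integrableOn_const hb.measure_lt_top.ne)
    · by_cases hz : z ∈ Ω
      · simpa [hz] using (hw k).abs_le z
      · simp [hz, (hw k).off z hz]
  have h2 := (tendsto_const_nhds (x := ∫ z, W z)).sub h1
  rw [sub_self] at h2
  refine h2.congr fun k => ?_
  rw [integral_sub (hWs.integrable_volume hb) ((hw k).integrable_volume hb)]

theorem SubMean.integral_glue_sub_mul_le (hR : 0 < R) (hs : 0 ≤ s) (hΩ : IsOpen Ω)
    (hb : Bornology.IsBounded Ω) (ha : Metric.closedBall a R ⊆ Ω) {g : Cn n → ℝ}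
    (hg : SubMean Ω s g) {B : Cn n → ℝ}
    (hB : (locFrame a R s hR hs).Adm B) :
    ∃ M, 0 ≤ M ∧ ∀ δ, 0 < δ → δ ≤ R / 4 → ∀ f, SubMean Ω s f → (∀ z, f z ≤ g z) →
      ∫ x, (glue a R s (moll g δ) x - glue a R s (moll f δ) x) * mixedMA (fun _ => B) x ≤
      M * ∫ z, (g z - f z) := by
  have hc : Continuous (mixedMA fun _ : Fin n => B) :=
    ContDiff.continuous (smooth_mixedMA fun _ => hB.smooth)
  obtain ⟨M, hM⟩ := (locFrame a R s hR hs).cL.exists_bound_of_continuousOn hc.continuousOn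
  refine ⟨|M|, abs_nonneg M, fun δ hδ hδR f hf hfg => ?_⟩
  have hi := ((hg.integrable_volume hb).sub (hf.integrable_volume hb))
  have hi' : Integrable (fun z => g z - f z) := hi
  rw [← integral_moll hi' hδ, ← integral_const_mul]
  have hA := hf.adm hR hs hΩ ha hδ hδR
  have hG := hg.adm hR hs hΩ ha hδ hδR
  have hle : ∀ x, moll f δ x ≤ moll g δ x := moll_mono hf.meas hf.abs_le hg.meas hg.abs_le hfg δ
  refine integral_mono ((locFrame a R s hR hs).integrable (fun _ => hB.1) (hG.cont.sub hA.cont)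
    (hA.sub_eq_zero hG)) ((integrable_moll hi' hδ).const_mul _) fun x => ?_
  simp only []
  rw [← moll_sub hg.meas hg.abs_le hf.meas hf.abs_le]
  by_cases hx : x ∈ (locFrame a R s hR hs).L
  · have h1 : mixedMA (fun _ => B) x ≤ |M| :=
      (le_abs_self _).trans ((hM x hx).trans (le_abs_self M))
    have h2 := glue_sub_le (a := a) (R := R) (s := s) x (hle x)
    have h3 := glue_mono (a := a) (R := R) (s := s) x (hle x)
    have h4 := mixedMA_nonneg (fun _ : Fin n => hB.1.1) hx
    calc _ ≤ (moll g δ x - moll f δ x) * mixedMA (fun _ => B) x := by gcongr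
      _ ≤ (moll g δ x - moll f δ x) * |M| := by
        gcongr
        exact sub_nonneg.2 (hle x)
      _ = _ := mul_comm _ _
  · rw [hA.sub_eq_zero hG x fun h => hx ((locFrame a R s hR hs).sub h), zero_mul]
    exact mul_nonneg (abs_nonneg M) (sub_nonneg.2 (hle x))

theorem exists_forall_ge_sub_le {e : ℕ → ℝ} (he : Monotone e) {M : ℝ} (hM : ∀ j, e j ≤ M) {η : ℝ}
    (hη : 0 < η) : ∃ j0, ∀ j k, j0 ≤ j → e k - e j ≤ η := by
  have hb : BddAbove (Set.range e) := ⟨M, by rintro _ ⟨j, rfl⟩; exact hM j⟩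
  obtain ⟨j0, hj0⟩ := exists_lt_of_lt_ciSup (f := e) (show (⨆ j, e j) - η < ⨆ j, e j by linarith)
  exact ⟨j0, fun j k hj => by linarith [he hj, le_ciSup hb k]⟩

theorem exists_pow_mul_mixedMA_le (hR : 0 < R) (hs : 0 ≤ s) (hΩ : IsOpen Ω)
    (hb : Bornology.IsBounded Ω) (ha : Metric.closedBall a R ⊆ Ω) {w : ℕ → Cn n → ℝ}
    {W : Cn n → ℝ} (hw : ∀ j, SubMean Ω s (w j)) (hmono : ∀ z, Monotone fun j => w j z)
    (hW : ∀ z, Tendsto (fun k => w k z) atTop (𝓝 (W z))) {η : ℝ} (hη : 0 < η) :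
    ∃ j0, ∀ j, j0 ≤ j → ∃ δ0 > 0, ∀ δ, 0 < δ → δ ≤ δ0 → ∀ T : Cn n → ℝ,
      (locFrame a R s hR hs).Bdd T →
      ∫ x, (glue a R s (moll W δ) x - glue a R s (moll (w j) δ) x) ^ (n + 1) *
        mixedMA (fun _ => T) x ≤ η := by
  set Fr := locFrame a R s hR hs with hFr
  have hWs := SubMean.of_tendsto hw hW
  have hwW : ∀ j z, w j z ≤ W z := fun j z => (hmono z).ge_of_tendsto (hW z) j
  set E : ℕ → ℝ → ℝ := fun j δ => energy Fr.ψ (glue a R s (moll (w j) δ)) with hE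
  have hadm := fun j δ (h : 0 < δ) (h' : δ ≤ R / 4) => (hw j).adm hR hs hΩ ha h h'
  have hglue : ∀ j k δ x, j ≤ k → glue a R s (moll (w j) δ) x ≤ glue a R s (moll (w k) δ) x :=
    fun j k δ x hjk => glue_mono x (moll_mono (hw j).meas (hw j).abs_le (hw k).meas (hw k).abs_le
      (fun z => hmono z hjk) δ x)
  have hEj : ∀ j k δ, 0 < δ → δ ≤ R / 4 → j ≤ k → E j δ ≤ E k δ := fun j k δ h h' hjk =>
    (hadm j δ h h').energy_mono (hadm k δ h h') fun x => hglue j k δ x hjk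
  have hEδ : ∀ j δ' δ, 0 < δ' → δ' ≤ δ → δ ≤ R / 4 → E j δ' ≤ E j δ := fun j δ' δ h h' h'' =>
    (hadm j δ' h (h'.trans h'')).energy_mono (hadm j δ (h.trans_le h') h'')
      ((hw j).glue_moll_mono hR hs hΩ ha h h' h'')
  have hE0 : ∀ j δ, 0 < δ → δ ≤ R / 4 → 0 ≤ E j δ := fun j δ h h' =>
    (hadm j δ h h').energy_nonneg (quad_le_glue _)
  set I : Set ℝ := Set.Ioc 0 (R / 4) with hI
  have hIne : (R / 4) ∈ I := ⟨by positivity, le_rfl⟩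
  set e : ℕ → ℝ := fun j => sInf (E j '' I) with he
  have hbdd : ∀ j, BddBelow (E j '' I) := fun j =>
    ⟨0, by rintro _ ⟨δ, hδ, rfl⟩; exact hE0 j δ hδ.1 hδ.2⟩
  have hle : ∀ j δ, 0 < δ → δ ≤ R / 4 → e j ≤ E j δ := fun j δ h h' =>
    csInf_le (hbdd j) ⟨δ, ⟨h, h'⟩, rfl⟩
  have hex : ∀ j ν, 0 < ν → ∃ δ, 0 < δ ∧ δ ≤ R / 4 ∧ E j δ ≤ e j + ν := fun j ν hν => by
    obtain ⟨_, ⟨δ, hδ, rfl⟩, h⟩ := exists_lt_of_csInf_lt (s := E j '' I) ⟨_, ⟨_, hIne, rfl⟩⟩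
      (show sInf (E j '' I) < e j + ν by simp [he, hν])
    exact ⟨δ, hδ.1, hδ.2, h.le⟩
  have hemono : Monotone e := fun j k hjk => by
    refine le_csInf ⟨_, ⟨_, hIne, rfl⟩⟩ ?_
    rintro _ ⟨δ, hδ, rfl⟩
    exact (hle j δ hδ.1 hδ.2).trans (hEj j k δ hδ.1 hδ.2 hjk)
  obtain ⟨η', hη', hη'C⟩ : ∃ η' > 0, Fr.C * (5 * η') ≤ η := by
    have hC := Fr.C_nonneg
    refine ⟨η / (5 * (Fr.C + 1)), by positivity, ?_⟩
    rw [show Fr.C * (5 * (η / (5 * (Fr.C + 1)))) = η * (Fr.C / (Fr.C + 1)) by field_simp]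
    exact mul_le_of_le_one_right hη.le ((div_le_one (by linarith)).2 (by linarith))
  obtain ⟨ε, hε, hεZ⟩ : ∃ ε > 0, n * (ε * Fr.Z) ≤ η' := by
    have hZ := Fr.Z_nonneg
    refine ⟨η' / (n * Fr.Z + 1), by positivity, ?_⟩
    rw [show n * (η' / (n * Fr.Z + 1) * Fr.Z) = η' * (n * Fr.Z / (n * Fr.Z + 1)) by ring]
    exact mul_le_of_le_one_right hη'.le ((div_le_one (by positivity)).2 (by linarith))
  obtain ⟨ν, hν, hνC⟩ : ∃ ν > 0, n * (Fr.C / ε ^ n * ν) ≤ η' := by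
    have hC := Fr.C_nonneg
    refine ⟨η' / (n * (Fr.C / ε ^ n) + 1), by positivity, ?_⟩
    rw [show n * (Fr.C / ε ^ n * (η' / (n * (Fr.C / ε ^ n) + 1))) =
      η' * (n * (Fr.C / ε ^ n) / (n * (Fr.C / ε ^ n) + 1)) by ring]
    exact mul_le_of_le_one_right hη'.le ((div_le_one (by positivity)).2 (by linarith))
  obtain ⟨j0, hj0⟩ := exists_forall_ge_sub_le hemono (fun j =>
    (hle j _ hIne.1 hIne.2).trans (hadm j _ hIne.1 hIne.2).energy_le) hη'
  refine ⟨j0, fun j hj => ?_⟩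
  obtain ⟨τ, hτ, hτR, hEτ⟩ := hex j ν hν
  obtain ⟨M, hM0, hM⟩ := hWs.integral_glue_sub_mul_le hR hs hΩ hb ha
    (hadm j τ hτ hτR)
  have hlim := (SubMean.tendsto_integral hΩ hb hw hW).const_mul M
  rw [mul_zero] at hlim
  obtain ⟨k, hkη, hkj⟩ := ((hlim.eventually (eventually_le_nhds hη')).and
    (eventually_ge_atTop j)).exists
  obtain ⟨σ, hσ, hσR, hEσ⟩ := hex k η' hη'
  refine ⟨min τ σ, lt_min hτ hσ, fun δ hδ hδle T hT => ?_⟩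
  have hδτ := hδle.trans (min_le_left _ _)
  have hδσ := hδle.trans (min_le_right _ _)
  have hδR := hδτ.trans hτR
  refine ((hadm j δ hδ hδR).integral_pow_le_of_chain (hadm j τ hτ hτR) (hWs.adm hR hs hΩ ha hδ hδR)
    (hadm k δ hδ hδR) ((hw j).glue_moll_mono hR hs hΩ ha hδ hδτ hτR)
    (fun x => hglue j k δ x hkj) (fun x => glue_mono x (moll_mono (hw k).meas (hw k).abs_le
      hWs.meas hWs.abs_le (hwW k) δ x)) hε fun _ => hT).trans ?_
  refine (mul_le_mul_of_nonneg_left ?_ Fr.C_nonneg).trans hη'C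
  have b1 : energy Fr.ψ (glue a R s (moll (w k) δ)) - energy Fr.ψ (glue a R s (moll (w j) δ)) ≤
      2 * η' := by
    have h1 := hEδ k δ σ hδ hδσ hσR
    have h2 := hle j δ hδ hδR
    have h3 := hj0 j k hj
    simp only [hE] at h1 h2 hEσ
    linarith
  have b2 : n * (Fr.C / ε ^ n * (energy Fr.ψ (glue a R s (moll (w j) τ)) -
      energy Fr.ψ (glue a R s (moll (w j) δ)))) ≤ η' := by
    refine le_trans ?_ hνC
    have h2 := hle j δ hδ hδR
    have := Fr.C_nonneg
    simp only [hE] at h2 hEτ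
    gcongr
    linarith
  have b3 := (hM δ hδ hδR (w k) (hw k) (hwW k)).trans hkη
  rw [mul_add]
  linarith

end

section
variable {n : ℕ} {Ω : Set (Cn n)} {s : ℝ} {a : Cn n} {R : ℝ}

theorem IsMAMeasure.integral_le (hR : 0 < R) (hs : 0 ≤ s) (hΩ : IsOpen Ω)
    (ha : Metric.closedBall a R ⊆ Ω) {u : Cn n → EReal} {μ : Measure (Cn n)}
    (hμ : IsMAMeasure n u Ω μ) (hu : PlurisubharmonicOn u Ω) (hb : ∀ z ∈ Ω, -1 ≤ u z ∧ u z ≤ 0)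
    {F : Cn n → ℝ} (hF : Continuous F) (hF0 : ∀ x ∉ (locFrame a R s hR hs).L', F x = 0) {η : ℝ}
    (hη : ∀ T : Cn n → ℝ, (locFrame a R s hR hs).Bdd T →
      ∫ x, F x * mixedMA (fun _ => T) x ≤ η) : ∫ x, F x ∂μ ≤ 4 ^ n * η := by
  have hb' : ∀ z ∈ Ω, ((-1 : ℝ) : EReal) ≤ u z ∧ u z ≤ 0 := hb
  obtain ⟨husc, hcoe⟩ := upperSemicontinuousOn_rl hu.1 hb'
  have hsm := subMean_rl hΩ zero_le_one hu hb'
  set r : ℕ → ℝ := fun k => R / 8 / (k + 1) with hr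
  have hr0 : ∀ k, 0 < r k := fun k => by positivity
  have hr1 : ∀ k, r k ≤ R / 8 := fun k => div_le_self (by positivity) (by simp)
  have hrmono : ∀ k, r (k + 1) ≤ r k := fun k => by
    simp only [hr]
    gcongr
    simp
  have hU : ∀ z ∈ Metric.ball a (7 / 8 * R), Metric.closedBall z (R / 8) ⊆ Ω := fun z hz =>
    (Metric.closedBall_subset_closedBall' (by linarith [Metric.mem_ball.1 hz])).trans ha
  have hUk : ∀ k, ∀ z ∈ Metric.ball a (7 / 8 * R), Metric.closedBall z (r k) ⊆ Ω := fun k z hz =>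
    (Metric.closedBall_subset_closedBall (hr1 k)).trans (hU z hz)
  have hUΩ : Metric.ball a (7 / 8 * R) ⊆ Ω := fun z hz =>
    hU z hz (Metric.mem_closedBall_self (by positivity))
  have hLU : (locFrame a R s hR hs).L ⊆ Metric.ball a (7 / 8 * R) := fun z hz => by
    rw [Metric.mem_ball, dist_eq_norm]
    linarith [norm_le_of_quad_le hR hs (show quad a R s z ≤ 2 from hz)]
  have hcl : IsClosed (locFrame a R s hR hs).L' :=
    isClosed_le (ContDiff.continuous (spsh_quad ∅ hR hs).1) continuous_const
  have hsupp : tsupport F ⊆ (locFrame a R s hR hs).L' :=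
    closure_minimal (fun x hx => by_contra fun h => hx (hF0 x h)) hcl
  have hlim := hμ.2.2 (Metric.ball a (7 / 8 * R)) Metric.isOpen_ball hUΩ
    (fun k => moll (rl Ω u) (r k)) (fun k => (hsm.smooth (hr0 k)).contDiffOn)
    (fun k => hsm.plurisubharmonicOn hΩ (hr0 k) (hUk k))
    (fun k z hz => hsm.moll_le_moll (hr0 _).le (hrmono k) (hUk k z hz))
    (fun z hz => ?_) F hF ((locFrame a R s hR hs).cL.of_isClosed_subset (isClosed_tsupport F)
      (hsupp.trans (locFrame a R s hR hs).sub))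
    (hsupp.trans ((locFrame a R s hR hs).sub.trans hLU))
  · refine le_of_tendsto' hlim fun k => ?_
    have h1 := hη _ ⟨hsm.spsh hR hs hΩ ha (hr0 k) (by linarith [hr1 k]), fun x _ =>
      ⟨le_trans (show -(2 * (s + 2)) ≤ -1 by linarith) (hsm.le_moll_const _ x),
        (hsm.moll_nonpos _ x).trans (show (0 : ℝ) ≤ 2 by norm_num)⟩⟩
    simp only [maDensity_eq_mixedMA (hsm.smooth (hr0 k))]
    calc _ = 4 ^ n * ∫ x, F x * mixedMA (fun _ => moll (rl Ω u) (r k)) x := by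
          rw [← integral_const_mul]
          congr 1; ext x; ring
      _ ≤ _ := by gcongr
  · rw [← hcoe z (hUΩ hz)]
    refine le_antisymm (le_of_forall_gt_imp_ge_of_dense fun c hc => ?_)
      (le_iInf fun k => EReal.coe_le_coe_iff.2 (hsm.le_moll (hr0 k).le (hUk k z hz)))
    obtain ⟨q, hq1, hq2⟩ := EReal.lt_iff_exists_real_btwn.1 hc
    obtain ⟨δ0, hδ0, hδ⟩ := eventually_moll_le hΩ hsm husc (hUΩ hz) (EReal.coe_lt_coe_iff.1 hq1)
    have hr2 : Tendsto r atTop (𝓝 0) := by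
      simpa [hr, div_eq_mul_one_div (R / 8)] using
        tendsto_one_div_add_atTop_nhds_zero_nat.const_mul (R / 8)
    obtain ⟨k, hk⟩ := (hr2.eventually (ge_mem_nhds hδ0)).exists
    exact (iInf_le _ k).trans ((EReal.coe_le_coe_iff.2 (hδ _ (hr0 k).le hk)).trans hq2.le)

theorem IsMAMeasure.measure_le (hR : 0 < R) (hs : 0 ≤ s) (hΩ : IsOpen Ω)
    (ha : Metric.closedBall a R ⊆ Ω) {u : Cn n → EReal} {μ : Measure (Cn n)}
    (hμ : IsMAMeasure n u Ω μ) (hu : PlurisubharmonicOn u Ω) (hb : ∀ z ∈ Ω, -1 ≤ u z ∧ u z ≤ 0)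
    {F : Cn n → ℝ} (hF : Continuous F) (hF0 : ∀ x ∉ (locFrame a R s hR hs).L', F x = 0)
    (hFnn : ∀ x, 0 ≤ F x) {η : ℝ}
    (hη : ∀ T : Cn n → ℝ, (locFrame a R s hR hs).Bdd T →
      ∫ x, F x * mixedMA (fun _ => T) x ≤ η) {c : ℝ} (hc : 0 < c) :
    μ {x | c ≤ F x} ≤ ENNReal.ofReal (4 ^ n * η / c) := by
  have hLΩ : (locFrame a R s hR hs).L ⊆ Ω := fun z hz =>
    ha (closedBall_subset_of_mem_L hR hs hz (Metric.mem_closedBall_self (by positivity)))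
  have hL := hμ.2.1 _ (locFrame a R s hR hs).cL hLΩ
  have hsubL : ∀ x, F x ≠ 0 → x ∈ (locFrame a R s hR hs).L := fun x hx =>
    (locFrame a R s hR hs).sub (by_contra fun h => hx (hF0 x h))
  have hfin : μ {x | c ≤ F x} ≠ ⊤ := ne_top_of_le_ne_top hL
    (measure_mono fun x hx => hsubL x (hc.trans_le hx).ne')
  have hInt : Integrable F μ := by
    rw [← integrableOn_iff_integrable_of_support_subset (s := (locFrame a R s hR hs).L) hsubL]
    obtain ⟨M, hM⟩ := (locFrame a R s hR hs).cL.exists_bound_of_continuousOn hF.continuousOn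
    exact IntegrableOn.of_bound (lt_top_iff_ne_top.2 hL) hF.aestronglyMeasurable M
      (ae_restrict_of_forall_mem (locFrame a R s hR hs).cL.measurableSet hM)
  have h1 := mul_meas_ge_le_integral_of_nonneg (Eventually.of_forall hFnn) hInt c
  have h2 := hμ.integral_le hR hs hΩ ha hu hb hF hF0 hη
  rw [ENNReal.le_ofReal_iff_toReal_le hfin]
  · rw [le_div_iff₀ hc, mul_comm]
    exact h1.trans h2
  · exact div_nonneg ((integral_nonneg hFnn).trans h2) hc.le

theorem exists_measure_ball_le (hR : 0 < R) (hs : 0 ≤ s) (hΩ : IsOpen Ω)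
    (hb : Bornology.IsBounded Ω) (ha : Metric.closedBall a R ⊆ Ω) {w : ℕ → Cn n → ℝ}
    {W : Cn n → ℝ} (hw : ∀ j, SubMean Ω s (w j)) (hwusc : ∀ j, UpperSemicontinuousOn (w j) Ω)
    (hmono : ∀ z, Monotone fun j => w j z)
    (hW : ∀ z, Tendsto (fun k => w k z) atTop (𝓝 (W z))) {g : Cn n → EReal}
    (hg : ∀ δ, 0 < δ → ∀ z, Metric.closedBall z δ ⊆ Ω → g z ≤ (moll W δ z : ℝ))
    {ε η : ℝ} (hε : 0 < ε) (hη : 0 < η) :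
    ∃ j0, ∀ j, j0 ≤ j → ∀ u : Cn n → EReal, PlurisubharmonicOn u Ω →
      (∀ z ∈ Ω, -1 ≤ u z ∧ u z ≤ 0) → ∀ μ, IsMAMeasure n u Ω μ →
      μ {z | sqn (z - a) ≤ R ^ 2 / 8 ∧ ((w j z + ε : ℝ) : EReal) < g z} ≤ ENNReal.ofReal η := by
  have hWs := SubMean.of_tendsto hw hW
  have hwW : ∀ j z, w j z ≤ W z := fun j z => (hmono z).ge_of_tendsto (hW z) j
  obtain ⟨j0, hj0⟩ := exists_pow_mul_mixedMA_le hR hs hΩ hb ha hw hmono hW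
    (η := η * (ε / 2) ^ (n + 1) / 4 ^ n) (by positivity)
  refine ⟨j0, fun j hj u hu hub μ hμ => ?_⟩
  obtain ⟨δ0, hδ0, hδ⟩ := hj0 j hj
  set r : ℕ → ℝ := fun k => min δ0 (R / 4) / (k + 1) with hr
  have hm0 : 0 < min δ0 (R / 4) := lt_min hδ0 (by positivity)
  have hr0 : ∀ k, 0 < r k := fun k => by positivity
  have hr1 : ∀ k, r k ≤ min δ0 (R / 4) := fun k => div_le_self hm0.le (by simp)
  have hr2 : Tendsto r atTop (𝓝 0) := by
    simpa [hr, div_eq_mul_one_div (min δ0 (R / 4))] using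
      tendsto_one_div_add_atTop_nhds_zero_nat.const_mul (min δ0 (R / 4))
  set D : ℕ → Cn n → ℝ := fun k x => glue a R s (moll W (r k)) x - glue a R s (moll (w j) (r k)) x
    with hD
  have hmm : ∀ k x, moll (w j) (r k) x ≤ moll W (r k) x := fun k x =>
    moll_mono (hw j).meas (hw j).abs_le hWs.meas hWs.abs_le (hwW j) _ x
  have hB : ∀ k, μ {x | (ε / 2) ^ (n + 1) ≤ D k x ^ (n + 1)} ≤ ENNReal.ofReal η := fun k => by
    have hA := (hw j).adm hR hs hΩ ha (hr0 k) ((hr1 k).trans (min_le_right _ _))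
    have hA' := hWs.adm hR hs hΩ ha (hr0 k) ((hr1 k).trans (min_le_right _ _))
    have h := hμ.measure_le hR hs hΩ ha hu hub (F := fun x => D k x ^ (n + 1))
      ((hA'.cont.sub hA.cont).pow _)
      (fun x hx => by
        simp only [hD]
        rw [hA.sub_eq_zero hA' x hx]; simp)
      (fun x => pow_nonneg (sub_nonneg.2 (glue_mono x (hmm k x))) _)
      (hδ _ (hr0 k) ((hr1 k).trans (min_le_left _ _))) (c := (ε / 2) ^ (n + 1)) (by positivity)
    refine h.trans_eq ?_
    congr 1
    field_simp
  have hsub : {z | sqn (z - a) ≤ R ^ 2 / 8 ∧ ((w j z + ε : ℝ) : EReal) < g z} ⊆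
      ⋃ N, ⋂ k, {x | (ε / 2) ^ (n + 1) ≤ D (N + k) x ^ (n + 1)} := by
    rintro z ⟨hz, hgz⟩
    have hq := quad_le_of_sqn_le hR hs hz
    have hzL : z ∈ (locFrame a R s hR hs).L := show quad a R s z ≤ 2 by linarith
    have hzb := (closedBall_subset_of_mem_L hR hs hzL).trans ha
    obtain ⟨δ1, hδ1, h1⟩ := eventually_moll_le hΩ (hw j) (hwusc j)
      (hzb (Metric.mem_closedBall_self (by positivity))) (c := w j z + ε / 2) (by linarith)
    obtain ⟨N, hN⟩ := eventually_atTop.1 (hr2.eventually (ge_mem_nhds hδ1))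
    refine Set.mem_iUnion.2 ⟨N, Set.mem_iInter.2 fun k => ?_⟩
    have h2 := h1 _ (hr0 (N + k)).le (hN _ (Nat.le_add_right N k))
    have h3 := EReal.coe_lt_coe_iff.1 (hgz.trans_le (hg _ (hr0 (N + k)) z
      ((Metric.closedBall_subset_closedBall ((hr1 _).trans (min_le_right _ _))).trans hzb)))
    have h4 : D (N + k) z = moll W (r (N + k)) z - moll (w j) (r (N + k)) z :=
      glue_sub_eq hR hs hz ((hw j).le_moll_const _ z) (hWs.le_moll_const _ z)
    refine pow_le_pow_left₀ (show (0 : ℝ) ≤ ε / 2 by positivity) ?_ _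
    rw [h4]; linarith
  have hmn : Monotone fun N => ⋂ k, {x | (ε / 2) ^ (n + 1) ≤ D (N + k) x ^ (n + 1)} :=
    fun N M hNM x hx => Set.mem_iInter.2 fun k => by
      have := Set.mem_iInter.1 hx (M - N + k)
      rwa [← add_assoc, Nat.add_sub_cancel' hNM] at this
  refine (measure_mono hsub).trans ?_
  rw [hmn.measure_iUnion]
  exact iSup_le fun N => (measure_mono (Set.iInter_subset _ 0)).trans (hB N)

theorem exists_measure_compact_le (hs : 0 ≤ s) (hΩ : IsOpen Ω) (hb : Bornology.IsBounded Ω)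
    {w : ℕ → Cn n → ℝ} {W : Cn n → ℝ} (hw : ∀ j, SubMean Ω s (w j))
    (hwusc : ∀ j, UpperSemicontinuousOn (w j) Ω) (hmono : ∀ z, Monotone fun j => w j z)
    (hW : ∀ z, Tendsto (fun k => w k z) atTop (𝓝 (W z))) {g : Cn n → EReal}
    (hg : ∀ δ, 0 < δ → ∀ z, Metric.closedBall z δ ⊆ Ω → g z ≤ (moll W δ z : ℝ))
    {ε : ℝ} (hε : 0 < ε) {K : Set (Cn n)} (hK : IsCompact K) (hKΩ : K ⊆ Ω) :
    ∀ η : ℝ, 0 < η → ∃ j0, ∀ j, j0 ≤ j → ∀ u : Cn n → EReal, PlurisubharmonicOn u Ω →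
      (∀ z ∈ Ω, -1 ≤ u z ∧ u z ≤ 0) → ∀ μ, IsMAMeasure n u Ω μ →
      μ {z | z ∈ K ∧ ((w j z + ε : ℝ) : EReal) < g z} ≤ ENNReal.ofReal η := by
  refine hK.induction_on (p := fun K => ∀ η : ℝ, 0 < η → ∃ j0, ∀ j, j0 ≤ j → ∀ u : Cn n → EReal,
      PlurisubharmonicOn u Ω → (∀ z ∈ Ω, -1 ≤ u z ∧ u z ≤ 0) → ∀ μ, IsMAMeasure n u Ω μ →
      μ {z | z ∈ K ∧ ((w j z + ε : ℝ) : EReal) < g z} ≤ ENNReal.ofReal η) ?_ ?_ ?_ ?_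
  · exact fun η _ => ⟨0, fun j _ u _ _ μ _ => by simp⟩
  · intro A B hAB h η hη
    obtain ⟨j0, hj0⟩ := h η hη
    refine ⟨j0, fun j hj u hu hub μ hμ => (measure_mono ?_).trans (hj0 j hj u hu hub μ hμ)⟩
    exact fun z hz => ⟨hAB hz.1, hz.2⟩
  · intro A B hA hB η hη
    obtain ⟨j1, h1⟩ := hA (η / 2) (half_pos hη)
    obtain ⟨j2, h2⟩ := hB (η / 2) (half_pos hη)
    refine ⟨max j1 j2, fun j hj u hu hub μ hμ => ?_⟩
    have h1 := h1 j ((le_max_left _ _).trans hj) u hu hub μ hμ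
    have h2 := h2 j ((le_max_right _ _).trans hj) u hu hub μ hμ
    calc _ ≤ μ ({z | z ∈ A ∧ ((w j z + ε : ℝ) : EReal) < g z} ∪
          {z | z ∈ B ∧ ((w j z + ε : ℝ) : EReal) < g z}) := measure_mono fun z hz =>
            hz.1.imp (fun h => ⟨h, hz.2⟩) fun h => ⟨h, hz.2⟩
      _ ≤ _ := measure_union_le _ _
      _ ≤ ENNReal.ofReal (η / 2) + ENNReal.ofReal (η / 2) := add_le_add h1 h2
      _ = _ := by rw [← ENNReal.ofReal_add (by positivity) (by positivity), add_halves]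
  · intro a haK
    obtain ⟨R, hR, ha⟩ := Metric.nhds_basis_closedBall.mem_iff.1 (hΩ.mem_nhds (hKΩ haK))
    have hc : Continuous fun z : Cn n => sqn (z - a) :=
      (ContDiff.continuous smooth_sqn).comp (continuous_id.sub continuous_const)
    refine ⟨{z | sqn (z - a) < R ^ 2 / 8}, mem_nhdsWithin_of_mem_nhds
      ((isOpen_lt hc continuous_const).mem_nhds ?_), fun η hη => ?_⟩
    · change sqn (a - a) < R ^ 2 / 8
      simp only [sqn, sub_self, Pi.zero_apply, map_zero, Finset.sum_const_zero]
      positivity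
    · obtain ⟨j0, hj0⟩ := exists_measure_ball_le hR hs hΩ hb ha hw hwusc hmono hW hg hε hη
      refine ⟨j0, fun j hj u hu hub μ hμ => (measure_mono ?_).trans (hj0 j hj u hu hub μ hμ)⟩
      exact fun z hz => ⟨(show sqn (z - a) < _ from hz.1).le, hz.2⟩

theorem exists_MACap_le (hs : 0 ≤ s) (hΩ : IsOpen Ω) (hb : Bornology.IsBounded Ω)
    {w : ℕ → Cn n → ℝ} {W : Cn n → ℝ} (hw : ∀ j, SubMean Ω s (w j))
    (hwusc : ∀ j, UpperSemicontinuousOn (w j) Ω) (hmono : ∀ z, Monotone fun j => w j z)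
    (hW : ∀ z, Tendsto (fun k => w k z) atTop (𝓝 (W z))) {g : Cn n → EReal}
    (hg : ∀ δ, 0 < δ → ∀ z, Metric.closedBall z δ ⊆ Ω → g z ≤ (moll W δ z : ℝ))
    {ε : ℝ} (hε : 0 < ε) {K : Set (Cn n)} (hK : IsCompact K) (hKΩ : K ⊆ Ω) {η : ℝ} (hη : 0 < η) :
    ∃ j, MACap n Ω {z | z ∈ K ∧ ((w j z + ε : ℝ) : EReal) < g z} ≤ ENNReal.ofReal η := by
  obtain ⟨j0, hj0⟩ := exists_measure_compact_le hs hΩ hb hw hwusc hmono hW hg hε hK hKΩ η hη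
  exact ⟨j0, iSup₂_le fun u hu => iSup₂_le fun μ hμ => hj0 j0 le_rfl u hu.1 hu.2 μ hμ⟩
end

section
variable {E : Type*} [NormedAddCommGroup E] [NormedSpace ℂ E] {Ω : Set E} {u v : E → EReal}

theorem PlurisubharmonicOn.max (hu : PlurisubharmonicOn u Ω) (hv : PlurisubharmonicOn v Ω) :
    PlurisubharmonicOn (fun z => max (u z) (v z)) Ω :=
  ⟨hu.1.sup hv.1, fun a b r hr hd p hp ζ hζ => max_le
    (hu.2 a b r hr hd p (fun ξ hξ => (le_max_left _ _).trans (hp ξ hξ)) ζ hζ)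
    (hv.2 a b r hr hd p (fun ξ hξ => (le_max_right _ _).trans (hp ξ hξ)) ζ hζ)⟩

theorem le_re_eval_of_sphere {r c : ℝ} (hr : 0 < r) (p : Polynomial ℂ)
    (hp : ∀ ζ : ℂ, ‖ζ‖ = r → c ≤ (p.eval ζ).re) {ζ : ℂ} (hζ : ‖ζ‖ ≤ r) : c ≤ (p.eval ζ).re := by
  have h := Complex.norm_le_of_forall_mem_frontier_norm_le (U := Metric.ball (0 : ℂ) r)
    (f := fun ζ => Complex.exp (-p.eval ζ)) (C := Real.exp (-c)) Metric.isBounded_ball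
    (Differentiable.diffContOnCl (by fun_prop)) (fun ξ hξ => by
      rw [frontier_ball 0 hr.ne', mem_sphere_zero_iff_norm] at hξ
      rw [Complex.norm_exp, Complex.neg_re, Real.exp_le_exp]
      exact neg_le_neg (hp ξ hξ)) (z := ζ) (by
      rw [closure_ball 0 hr.ne', mem_closedBall_zero_iff]; exact hζ)
  rw [Complex.norm_exp, Complex.neg_re, Real.exp_le_exp] at h
  exact neg_le_neg_iff.1 h

theorem plurisubharmonicOn_const (c : ℝ) (Ω : Set E) :
    PlurisubharmonicOn (fun _ => (c : EReal)) Ω :=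
  ⟨upperSemicontinuousOn_const, fun _ _ _ hr _ p hp _ hζ => EReal.coe_le_coe_iff.2
    (le_re_eval_of_sphere hr p (fun ξ hξ => EReal.coe_le_coe_iff.1 (hp ξ hξ)) hζ)⟩

theorem exists_polynomial_log {α β : ℂ} {r : ℝ} (hr : 0 ≤ r) (h : r * ‖β‖ < ‖α‖) {θ : ℝ}
    (hθ : 0 < θ) : ∃ q : Polynomial ℂ, ∀ ζ : ℂ, ‖ζ‖ ≤ r →
      |(q.eval ζ).re - Real.log ‖α + ζ * β‖| ≤ θ := by
  have hα : α ≠ 0 := norm_pos_iff.1 ((by positivity : 0 ≤ r * ‖β‖).trans_lt h)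
  have hα' : 0 < ‖α‖ := norm_pos_iff.2 hα
  set k := r * ‖β‖ / ‖α‖ with hk
  have hk0 : 0 ≤ k := by positivity
  have hk1 : k < 1 := (div_lt_one hα').2 h
  obtain ⟨N, hN⟩ := exists_pow_lt_of_lt_one (mul_pos hθ (sub_pos.2 hk1)) hk1
  refine ⟨Polynomial.C ((Real.log ‖α‖ : ℝ) : ℂ) + ∑ j ∈ Finset.range (N + 1),
    Polynomial.C ((-1) ^ (j + 1) * (β / α) ^ j / j) * Polynomial.X ^ j, fun ζ hζ => ?_⟩
  set w := ζ * β / α with hw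
  have hwk : ‖w‖ ≤ k := by
    rw [hw, norm_div, norm_mul, hk]
    gcongr
  have hw1 : ‖w‖ < 1 := hwk.trans_lt hk1
  have hT : (∑ j ∈ Finset.range (N + 1),
      Polynomial.C ((-1) ^ (j + 1) * (β / α) ^ j / j) * Polynomial.X ^ j).eval ζ =
      Complex.logTaylor (N + 1) w := by
    rw [Polynomial.eval_finsetSum, Complex.logTaylor]
    refine Finset.sum_congr rfl fun j _ => ?_
    rw [Polynomial.eval_mul, Polynomial.eval_C, Polynomial.eval_pow, Polynomial.eval_X, hw]
    rw [mul_div_assoc ζ, mul_pow]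
    ring
  have h1w : (1 + w) ≠ 0 := fun h0 => by
    rw [eq_neg_of_add_eq_zero_right h0, norm_neg, norm_one] at hw1
    exact lt_irrefl _ hw1
  have hlog : Real.log ‖α + ζ * β‖ = Real.log ‖α‖ + (Complex.log (1 + w)).re := by
    rw [Complex.log_re, ← Real.log_mul hα'.ne' (norm_ne_zero_iff.2 h1w), ← norm_mul, hw]
    congr 2
    field_simp
  rw [Polynomial.eval_add, Polynomial.eval_C, hT, hlog, Complex.add_re, Complex.ofReal_re,
    add_sub_add_left_eq_sub, ← Complex.sub_re]
  refine (Complex.abs_re_le_norm _).trans ?_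
  rw [norm_sub_rev]
  refine (Complex.norm_log_sub_logTaylor_le N hw1).trans ?_
  have e1 : ‖w‖ ^ (N + 1) ≤ θ * (1 - k) := by
    refine (pow_le_pow_of_le_one (norm_nonneg _) hw1.le (Nat.le_succ N)).trans ?_
    exact (pow_le_pow_left₀ (norm_nonneg _) hwk N).trans hN.le
  have e2 : 0 < 1 - ‖w‖ := sub_pos.2 hw1
  calc _ ≤ ‖w‖ ^ (N + 1) * (1 - ‖w‖)⁻¹ :=
        div_le_self (by positivity) (by simp)
    _ ≤ (θ * (1 - k)) * (1 - k)⁻¹ := by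
        have : 0 < 1 - k := sub_pos.2 hk1
        gcongr
    _ = θ := by
        rw [mul_assoc, mul_inv_cancel₀ (sub_pos.2 hk1).ne', mul_one]
end

section
variable {n : ℕ} {Ω : Set (Cn n)} {φ : Cn n → EReal}

/-- The trace on `annA` of the neighbourhoods of the circle of radius `c`. -/
def annF (c : ℝ) : Filter ℂ := (𝓝 c).comap (fun ζ : ℂ => ‖ζ‖) ⊓ 𝓟 annA

theorem tendsto_log_norm {c : ℝ} (hc : c ≠ 0) :
    Tendsto (fun ζ : ℂ => Real.log ‖ζ‖) (annF c) (𝓝 (Real.log c)) :=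
  (Real.continuousAt_log hc).tendsto.comp (tendsto_comap.mono_left inf_le_left)

theorem log_norm_mem {ζ : ℂ} (h : ζ ∈ annA) : 0 < Real.log ‖ζ‖ ∧ Real.log ‖ζ‖ < 1 :=
  ⟨Real.log_pos h.1, by
    rw [Real.log_lt_iff_lt_exp (one_pos.trans h.1)]
    exact h.2⟩

theorem norm_lt_of_disc_subset {α β : ℂ} {r : ℝ} (hr : 0 ≤ r)
    (h : ∀ ζ : ℂ, ‖ζ‖ ≤ r → α + ζ * β ∈ annA) : r * ‖β‖ < ‖α‖ := by
  by_contra! hle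
  rcases eq_or_ne β 0 with rfl | hβ
  · have h0 := (h 0 (by simpa using hr)).1
    simp only [norm_zero, mul_zero, add_zero] at h0 hle
    linarith
  · have h0 := (h (-(α / β)) (by
      rw [norm_neg, norm_div]
      exact div_le_of_le_mul₀ (norm_nonneg _) hr hle)).1
    rw [neg_mul, div_mul_cancel₀ _ hβ, add_neg_cancel, norm_zero] at h0
    linarith

theorem tendsto_add_coe {ι : Type*} {l : Filter ι} {e : EReal} (he : e ≤ 0) {h : ι → ℝ} {c : ℝ}
    (hh : Tendsto h l (𝓝 c)) : Tendsto (fun x => e + (h x : EReal)) l (𝓝 (e + (c : EReal))) :=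
  (EReal.continuousAt_add (p := (e, (c : EReal))) (Or.inl (ne_top_of_le_ne_top EReal.zero_ne_top he))
    (Or.inr (EReal.coe_ne_top c))).tendsto.comp
    (tendsto_const_nhds.prodMk_nhds ((continuous_coe_real_ereal.tendsto c).comp hh))

theorem limsup_le_of_eventually_le_add {l : Filter ℂ} {f : ℂ → EReal} {e d : EReal} (he : e ≤ 0)
    {h : ℂ → ℝ} {c : ℝ} (hh : Tendsto h l (𝓝 c)) (hf : ∀ᶠ ζ in l, f ζ ≤ e + (h ζ : EReal))
    (hd : e + (c : EReal) ≤ d) : limsup f l ≤ d := by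
  refine le_of_forall_gt_imp_ge_of_dense fun q hq => limsup_le_of_le (by isBoundedDefault) ?_
  filter_upwards [hf, (tendsto_add_coe he hh).eventually (gt_mem_nhds (hd.trans_lt hq))]
    with ζ h1 h2 using h1.trans h2.le

/-- The subgeodesic attached to a competitor for the residual function. -/
def subgeo (w : Cn n → EReal) (C : ℝ) (p : Cn n × ℂ) : EReal :=
  w p.1 + ((C * (Real.log ‖p.2‖ - 1) : ℝ) : EReal)

theorem add_coe_le_coe_iff {e : EReal} {x y : ℝ} :
    e + (x : EReal) ≤ (y : EReal) ↔ e ≤ ((y - x : ℝ) : EReal) := by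
  induction e with
  | bot => simp
  | top =>
    rw [EReal.top_add_coe, top_le_iff, top_le_iff]
    exact iff_of_false (EReal.coe_ne_top _) (EReal.coe_ne_top _)
  | coe e => norm_cast; exact le_sub_iff_add_le.symm

theorem PSHNeg.subgeo {w : Cn n → EReal} (hw : PSHNeg w Ω) {C : ℝ} (hC : 0 ≤ C) :
    PSHNeg (subgeo w C) (Ω ×ˢ annA) := by
  refine ⟨⟨?_, fun a b r hr hd p hp ζ hζ => ?_⟩, fun z hz => ?_⟩
  · refine UpperSemicontinuousOn.add' (f := fun p : Cn n × ℂ => w p.1)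
      (hw.1.1.comp continuousOn_fst fun p hp => hp.1)
      (ContinuousOn.upperSemicontinuousOn ?_) fun p hp => ?_
    · refine continuous_coe_real_ereal.comp_continuousOn ?_
      refine continuousOn_const.mul (ContinuousOn.sub (ContinuousOn.log (by fun_prop) ?_)
        continuousOn_const)
      exact fun p hp => (one_pos.trans hp.2.1).ne'
    · exact EReal.continuousAt_add (Or.inl (ne_top_of_le_ne_top EReal.zero_ne_top (hw.2 _ hp.1)))
        (Or.inr (EReal.coe_ne_top _))
  · have hdisc : ∀ ζ : ℂ, ‖ζ‖ ≤ r → a.2 + ζ * b.2 ∈ annA := fun ζ hζ => (hd ζ hζ).2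
    refine EReal.le_of_forall_lt_iff_le.1 fun x hx => ?_
    rw [EReal.coe_lt_coe_iff] at hx
    set θ := (x - (p.eval ζ).re) / (2 * (C + 1)) with hθ
    have hθ0 : 0 < θ := div_pos (sub_pos.2 hx) (by linarith)
    obtain ⟨q, hq⟩ := exists_polynomial_log hr.le (norm_lt_of_disc_subset hr.le hdisc) hθ0
    have h := hw.1.2 a.1 b.1 r hr (fun ζ hζ => (hd ζ hζ).1)
      (p - Polynomial.C (C : ℂ) * q + Polynomial.C ((C * θ + C : ℝ) : ℂ)) (fun ξ hξ => ?_) ζ hζ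
    · change w (a.1 + ζ • b.1) + ((C * (Real.log ‖a.2 + ζ * b.2‖ - 1) : ℝ) : EReal) ≤ x
      rw [add_coe_le_coe_iff]
      refine h.trans (EReal.coe_le_coe_iff.2 ?_)
      simp only [Polynomial.eval_add, Polynomial.eval_sub, Polynomial.eval_mul, Polynomial.eval_C,
        Complex.add_re, Complex.sub_re, Complex.re_ofReal_mul, Complex.ofReal_re]
      have h1 := mul_le_mul_of_nonneg_left (neg_le_of_abs_le (hq ζ hζ)) hC
      have h2 : 2 * C * θ ≤ x - (p.eval ζ).re := by
        have : θ * (2 * (C + 1)) = x - (p.eval ζ).re := div_mul_cancel₀ _ (by positivity)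
        linarith
      linarith
    · have h0 := hp ξ hξ
      change w (a.1 + ξ • b.1) + ((C * (Real.log ‖a.2 + ξ * b.2‖ - 1) : ℝ) : EReal) ≤ _ at h0
      rw [add_coe_le_coe_iff] at h0
      refine h0.trans (EReal.coe_le_coe_iff.2 ?_)
      simp only [Polynomial.eval_add, Polynomial.eval_sub, Polynomial.eval_mul, Polynomial.eval_C,
        Complex.add_re, Complex.sub_re, Complex.re_ofReal_mul, Complex.ofReal_re]
      have h1 := mul_le_mul_of_nonneg_left (le_of_abs_le (hq ξ hξ.le)) hC
      linarith
  · refine add_nonpos (hw.2 _ hz.1) (EReal.coe_nonpos.2 (mul_nonpos_of_nonneg_of_nonpos hC ?_))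
    linarith [(log_norm_mem hz.2).2]

theorem le_uscReg {E : Type*} [NormedAddCommGroup E] [NormedSpace ℂ E] {Ω : Set E} {f : E → EReal}
    {z : E} (hz : z ∈ Ω) : f z ≤ uscReg f Ω z := by
  refine le_of_forall_gt_imp_ge_of_dense fun c hc => ?_
  exact (eventually_lt_of_limsup_lt hc).self_of_nhdsWithin hz |>.le

theorem le_gp {w : Cn n → EReal} (hw : PSHNeg w Ω) {C : ℝ} (hC : ∀ x ∈ Ω, w x ≤ φ x + (C : EReal))
    {z : Cn n} (hz : z ∈ Ω) : w z ≤ gp φ Ω z := by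
  refine le_trans (le_iSup₂_of_le (f := fun (w : Cn n → EReal) (_ : w ∈ {w : Cn n → EReal |
    PSHNeg w Ω ∧ ∃ C : ℝ, ∀ x ∈ Ω, w x ≤ φ x + (C : EReal)}) => w z) w ⟨hw, C, hC⟩ le_rfl)
    (le_uscReg (f := fun z => ⨆ w ∈ {w : Cn n → EReal |
      PSHNeg w Ω ∧ ∃ C : ℝ, ∀ x ∈ Ω, w x ≤ φ x + (C : EReal)}, w z) hz)

theorem gp_nonpos (z : Cn n) : gp φ Ω z ≤ 0 := by
  by_cases hz : 𝓝[Ω] z = ⊥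
  · rw [gp, uscReg, hz, limsup_bot]; exact bot_le
  · refine limsup_le_of_le (by isBoundedDefault) (eventually_nhdsWithin_of_forall fun y hy =>
      iSup₂_le fun w hw => hw.1.2 y hy)

theorem subgeo_mem_geodClass {w : Cn n → EReal} (hw : PSHNeg w Ω) {C : ℝ} (h0 : 0 ≤ C)
    (hC : ∀ x ∈ Ω, w x ≤ φ x + (C : EReal)) : subgeo w C ∈ geodClass n Ω φ (gp φ Ω) := by
  have ht : ∀ c : ℝ, c ≠ 0 → Tendsto (fun ζ : ℂ => C * (Real.log ‖ζ‖ - 1)) (annF c)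
      (𝓝 (C * (Real.log c - 1))) := fun c hc => ((tendsto_log_norm hc).sub_const 1).const_mul C
  refine ⟨hw.subgeo h0, fun z hz => limsup_le_of_eventually_le_add (hw.2 z hz) (ht 1 one_ne_zero)
    (Eventually.of_forall fun ζ => le_rfl) ?_, fun z hz => limsup_le_of_eventually_le_add
    (hw.2 z hz) (ht _ (Real.exp_pos 1).ne') (Eventually.of_forall fun ζ => le_rfl) ?_⟩
  · have := hC z hz
    rw [Real.log_one, show C * (0 - 1) = -C by ring]
    generalize w z = e at *
    generalize φ z = d at *
    induction e with
    | bot => simp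
    | top => induction d with
      | bot => simp at this
      | top => simp
      | coe d => norm_cast at this
    | coe e => induction d with
      | bot => simp at this
      | top => simp
      | coe d => norm_cast at *; linarith
  · rw [Real.log_exp, sub_self, mul_zero, EReal.coe_zero, add_zero]
    exact le_gp hw hC hz

theorem sub_le_geodesic {w : Cn n → EReal} (hw : PSHNeg w Ω) {C : ℝ} (h0 : 0 ≤ C)
    (hC : ∀ x ∈ Ω, w x ≤ φ x + (C : EReal)) (t : ℝ) (z : Cn n) :
    w z + ((C * (t - 1) : ℝ) : EReal) ≤ geodesic n Ω φ (gp φ Ω) t z := by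
  refine le_iSup₂_of_le _ (subgeo_mem_geodClass hw h0 hC) ?_
  simp only [subgeo]
  rw [Complex.norm_real, Real.norm_of_nonneg (Real.exp_pos t).le, Real.log_exp]
end

section
variable {n : ℕ} {Ω : Set (Cn n)} {φ : Cn n → EReal}

theorem exists_pos_of_eventually_annF {c : ℝ} {P : ℂ → Prop} (h : ∀ᶠ ζ in annF c, P ζ) :
    ∃ δ : ℝ, 0 < δ ∧ ∀ ζ ∈ annA, |‖ζ‖ - c| < δ → P ζ := by
  rw [annF, eventually_inf_principal, eventually_comap, Metric.eventually_nhds_iff] at h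
  obtain ⟨δ, hδ, h⟩ := h
  exact ⟨δ, hδ, fun ζ hζ hd => h (by rwa [Real.dist_eq]) ζ rfl hζ⟩

theorem isOpen_annA : IsOpen annA :=
  (isOpen_lt continuous_const continuous_norm).inter (isOpen_lt continuous_norm continuous_const)

theorem eventually_lt_of_limsup_annF {v : ℂ → EReal} {c d : ℝ} (h : limsup v (annF c) < d)
    {L : ℂ → ℝ} (hL : Tendsto L (annF c) (𝓝 d)) : ∀ᶠ ζ in annF c, v ζ < L ζ := by
  obtain ⟨q, hq, hqd⟩ := EReal.lt_iff_exists_real_btwn.1 h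
  filter_upwards [eventually_lt_of_limsup_lt hq,
    hL.eventually (lt_mem_nhds (EReal.coe_lt_coe_iff.1 hqd))] with ζ h1 h2
  exact h1.trans (EReal.coe_lt_coe_iff.2 h2)

theorem norm_add_sq_complex (a b : ℂ) :
    ‖a + b‖ ^ 2 = ‖a‖ ^ 2 + 2 * ((starRingEnd ℂ) a * b).re + ‖b‖ ^ 2 := by
  simp only [← Complex.normSq_eq_norm_sq, Complex.normSq_apply, Complex.add_re, Complex.add_im,
    Complex.mul_re, Complex.conj_re, Complex.conj_im]
  ring

/-- A subharmonic function cannot touch from below, at an interior point, a logarithmic function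
minus a strictly convex quadratic. -/
theorem not_forall_le_log_sub_sq {v : ℂ → EReal} (hv : PlurisubharmonicOn v annA) {ζ₁ : ℂ}
    (h₁ : ζ₁ ∈ annA) {x c ε : ℝ} (hε : 0 < ε) (hx : v ζ₁ = x)
    (h : ∀ ζ ∈ annA, v ζ ≤
      ((x + c * (Real.log ‖ζ‖ - Real.log ‖ζ₁‖) - ε * (‖ζ‖ ^ 2 - ‖ζ₁‖ ^ 2) : ℝ) : EReal)) :
    False := by
  obtain ⟨r, hr, hd⟩ := Metric.nhds_basis_closedBall.mem_iff.1 (isOpen_annA.mem_nhds h₁)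
  have hdisc : ∀ ζ : ℂ, ‖ζ‖ ≤ r → ζ₁ + ζ * 1 ∈ annA := fun ζ hζ => hd (by
    rw [mem_closedBall_iff_norm]; simpa using hζ)
  set θ := ε * r ^ 2 / (4 * (|c| + 1)) with hθ
  have hθ0 : 0 < θ := by positivity
  obtain ⟨q, hq⟩ := exists_polynomial_log hr.le (norm_lt_of_disc_subset hr.le hdisc) hθ0
  have habs : ∀ y : ℝ, |y| ≤ θ → |c * y| ≤ |c| * θ := fun y hy => by
    rw [abs_mul]; gcongr
  have h0 := hv.2 ζ₁ 1 r hr (fun ζ hζ => hdisc ζ hζ)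
    (Polynomial.C ((x - c * Real.log ‖ζ₁‖ + |c| * θ - ε * r ^ 2 : ℝ) : ℂ)
      + Polynomial.C (c : ℂ) * q
      - Polynomial.C ((2 * ε : ℝ) : ℂ) * (Polynomial.C ((starRingEnd ℂ) ζ₁) * Polynomial.X))
    (fun ξ hξ => ?_) 0 (by simpa using hr.le)
  · simp only [zero_smul, add_zero, hx, EReal.coe_le_coe_iff, Polynomial.eval_add,
      Polynomial.eval_sub, Polynomial.eval_mul, Polynomial.eval_C, Polynomial.eval_X, mul_zero,
      Complex.add_re, Complex.re_ofReal_mul, Complex.ofReal_re, sub_zero] at h0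
    have h2 := habs _ (hq 0 (by simpa using hr.le))
    rw [zero_mul, add_zero] at h2
    have h3 := le_of_abs_le h2
    have h4 : θ * (4 * (|c| + 1)) = ε * r ^ 2 := div_mul_cancel₀ _ (by positivity)
    have h5 : 0 < ε * r ^ 2 := by positivity
    nlinarith
  · refine (h _ (hdisc ξ hξ.le)).trans (EReal.coe_le_coe_iff.2 ?_)
    simp only [Polynomial.eval_add,
      Polynomial.eval_sub, Polynomial.eval_mul, Polynomial.eval_C, Polynomial.eval_X,
      Complex.add_re, Complex.sub_re, Complex.re_ofReal_mul, Complex.ofReal_re]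
    have h2 := neg_le_of_abs_le (habs _ (hq ξ hξ.le))
    have h3 := norm_add_sq_complex ζ₁ ξ
    rw [hξ] at h3
    rw [mul_one] at *
    rw [h3]
    nlinarith

theorem le_log_of_limsup_lt {v : ℂ → EReal} (hv : PSHNeg v annA) {c₀ c₁ : ℝ}
    (h₀ : limsup v (annF 1) < c₀) (h₁ : limsup v (annF (Real.exp 1)) < c₁) {ζ : ℂ}
    (hζ : ζ ∈ annA) : v ζ ≤ ((c₀ + (c₁ - c₀) * Real.log ‖ζ‖ : ℝ) : EReal) := by
  have hlim : ∀ c : ℝ, c ≠ 0 → Tendsto (fun ζ : ℂ => c₀ + (c₁ - c₀) * Real.log ‖ζ‖) (annF c)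
      (𝓝 (c₀ + (c₁ - c₀) * Real.log c)) := fun c hc => ((tendsto_log_norm hc).const_mul _).const_add _
  set L : ℂ → ℝ := fun ζ => c₀ + (c₁ - c₀) * Real.log ‖ζ‖ with hL
  obtain ⟨δ, hδ, hin⟩ := exists_pos_of_eventually_annF (eventually_lt_of_limsup_annF
    (L := L) h₀ (by simpa using hlim 1 one_ne_zero))
  obtain ⟨δ', hδ', hout⟩ := exists_pos_of_eventually_annF (eventually_lt_of_limsup_annF
    (L := L) h₁ (by simpa using hlim _ (Real.exp_pos 1).ne'))
  by_contra! hlt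
  set K : Set ℂ := {ξ | 1 + δ ≤ ‖ξ‖ ∧ ‖ξ‖ ≤ Real.exp 1 - δ'} with hK
  have hKA : K ⊆ annA := fun ξ h => ⟨by linarith [h.1], by linarith [h.2]⟩
  have hKc : IsCompact K := Metric.isCompact_of_isClosed_isBounded
    ((isClosed_le continuous_const continuous_norm).inter
      (isClosed_le continuous_norm continuous_const))
    (isBounded_iff_forall_norm_le.2 ⟨_, fun ξ h => h.2⟩)
  have hoff : ∀ ξ ∈ annA, ξ ∉ K → v ξ < L ξ := fun ξ hξ hn => by
    by_cases h : 1 + δ ≤ ‖ξ‖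
    · have h' : Real.exp 1 - δ' < ‖ξ‖ := not_le.1 fun h' => hn ⟨h, h'⟩
      exact hout ξ hξ (abs_lt.2 ⟨by linarith, by linarith [hξ.2]⟩)
    · exact hin ξ hξ (abs_lt.2 ⟨by linarith [hξ.1], by linarith⟩)
  have hζK : ζ ∈ K := by_contra fun h => lt_asymm hlt (hoff ζ hζ h)
  obtain ⟨x₀, hx₀, hx₀v⟩ := EReal.lt_iff_exists_real_btwn.1 hlt
  have hx₀' : L ζ < x₀ := EReal.coe_lt_coe_iff.1 hx₀
  set ε := (x₀ - L ζ) / Real.exp 1 ^ 2 with hε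
  have hε0 : 0 < ε := div_pos (sub_pos.2 hx₀') (by positivity)
  have hεe : ε * Real.exp 1 ^ 2 = x₀ - L ζ := div_mul_cancel₀ _ (by positivity)
  set k : ℂ → ℝ := fun ξ => ε * ‖ξ‖ ^ 2 - L ξ with hk
  have hkc : ContinuousOn k annA := by
    refine ContinuousOn.sub (by fun_prop) (continuousOn_const.add (continuousOn_const.mul
      (ContinuousOn.log (by fun_prop) fun ξ hξ => (one_pos.trans hξ.1).ne')))
  have husc : UpperSemicontinuousOn (fun ξ => v ξ + (k ξ : EReal)) annA := by
    refine UpperSemicontinuousOn.add' hv.1.1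
      (continuous_coe_real_ereal.comp_continuousOn hkc).upperSemicontinuousOn fun ξ hξ => ?_
    exact EReal.continuousAt_add (Or.inl (ne_top_of_le_ne_top EReal.zero_ne_top (hv.2 _ hξ)))
        (Or.inr (EReal.coe_ne_top _))
  obtain ⟨ζ₁, h1K, hmax⟩ := (husc.mono hKA).exists_isMaxOn ⟨ζ, hζK⟩ hKc
  have hζ₁ : ((x₀ + k ζ : ℝ) : EReal) ≤ v ζ₁ + (k ζ₁ : EReal) := by
    refine le_trans ?_ (hmax hζK)
    rw [EReal.coe_add]
    exact add_le_add_left hx₀v.le _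
  have hbot : v ζ₁ ≠ ⊥ := fun h => by
    rw [h, EReal.bot_add, le_bot_iff] at hζ₁
    exact EReal.coe_ne_bot _ hζ₁
  have htop : v ζ₁ ≠ ⊤ := ne_top_of_le_ne_top EReal.zero_ne_top (hv.2 _ (hKA h1K))
  lift v ζ₁ to ℝ using ⟨htop, hbot⟩ with x hx
  rw [← EReal.coe_add, EReal.coe_le_coe_iff] at hζ₁
  have hall : ∀ ξ ∈ annA, v ξ ≤ ((x + k ζ₁ - k ξ : ℝ) : EReal) := fun ξ hξ => by
    by_cases h : ξ ∈ K
    · have : v ξ + (k ξ : EReal) ≤ v ζ₁ + (k ζ₁ : EReal) := hmax h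
      rwa [← hx, ← EReal.coe_add, add_coe_le_coe_iff] at this
    · refine (hoff ξ hξ h).le.trans (EReal.coe_le_coe_iff.2 ?_)
      have h1 : ‖ξ‖ ^ 2 ≤ Real.exp 1 ^ 2 := pow_le_pow_left₀ (norm_nonneg _) hξ.2.le 2
      have h2 := mul_le_mul_of_nonneg_left h1 hε0.le
      have h3 : 0 ≤ ε * ‖ζ‖ ^ 2 := by positivity
      simp only [hk] at hζ₁ ⊢
      linarith
  refine not_forall_le_log_sub_sq hv.1 (hKA h1K) (c := c₁ - c₀) hε0 hx.symm fun ξ hξ =>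
    (hall ξ hξ).trans (EReal.coe_le_coe_iff.2 (le_of_eq ?_))
  simp only [hk, hL]
  ring

theorem PSHNeg.slice {u : Cn n × ℂ → EReal} (hu : PSHNeg u (Ω ×ˢ annA)) {z : Cn n} (hz : z ∈ Ω) :
    PSHNeg (fun ζ => u (z, ζ)) annA := by
  refine ⟨⟨hu.1.1.comp (by fun_prop) fun ζ hζ => ⟨hz, hζ⟩, fun a b r hr hd p hp ζ hζ => ?_⟩,
    fun ζ hζ => hu.2 _ ⟨hz, hζ⟩⟩
  have e : ∀ ξ : ℂ, ((z, a) : Cn n × ℂ) + ξ • ((0, b) : Cn n × ℂ) = (z, a + ξ • b) := fun ξ => by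
    simp
  have h := hu.1.2 (z, a) (0, b) r hr (fun ξ hξ => by rw [e]; exact ⟨hz, hd ξ hξ⟩) p
    (fun ξ hξ => by rw [e]; exact hp ξ hξ) ζ hζ
  rwa [e] at h

theorem geodesic_le {u₀ u₁ : Cn n → EReal} {t : ℝ} (ht : t ∈ Set.Ioo (0 : ℝ) 1) {z : Cn n}
    (hz : z ∈ Ω) {c₀ c₁ : ℝ} (h₀ : u₀ z < c₀) (h₁ : u₁ z < c₁) :
    geodesic n Ω u₀ u₁ t z ≤ ((c₀ + (c₁ - c₀) * t : ℝ) : EReal) := by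
  refine iSup₂_le fun u hu => ?_
  have hn : ‖((Real.exp t : ℝ) : ℂ)‖ = Real.exp t := by
    rw [Complex.norm_real, Real.norm_of_nonneg (Real.exp_pos t).le]
  have h := le_log_of_limsup_lt (hu.1.slice hz) ((hu.2.1 z hz).trans_lt h₀)
    ((hu.2.2 z hz).trans_lt h₁) (ζ := ((Real.exp t : ℝ) : ℂ)) (by
      change 1 < _ ∧ _ < _
      rw [hn]
      exact ⟨Real.one_lt_exp_iff.2 ht.1, Real.exp_lt_exp.2 ht.2⟩)
  rwa [hn, Real.log_exp] at h

theorem geodesic_le_gp (hφ : PSHNeg φ Ω) {t : ℝ} (ht : t ∈ Set.Ioo (0 : ℝ) 1) {z : Cn n}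
    (hz : z ∈ Ω) : geodesic n Ω φ (gp φ Ω) t z ≤ gp φ Ω z := by
  refine EReal.le_of_forall_lt_iff_le.1 fun c hc => ?_
  have h := geodesic_le ht hz ((le_gp hφ (C := 0) (by simp) hz).trans_lt hc) hc
  rwa [sub_self, zero_mul, add_zero] at h

theorem geodesic_eq_bot {t : ℝ} (ht : t ∈ Set.Ioo (0 : ℝ) 1) {z : Cn n}
    (hz : z ∈ Ω) (h : φ z = ⊥) : geodesic n Ω φ (gp φ Ω) t z = ⊥ := by
  refine (EReal.eq_bot_iff_forall_lt _).2 fun y => ?_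
  have h1 : 0 < 1 - t := sub_pos.2 ht.2
  refine (geodesic_le ht hz (c₀ := (y - t - 1) / (1 - t)) (c₁ := 1) (by rw [h]; exact EReal.bot_lt_coe _)
    ((gp_nonpos z).trans_lt (by norm_num))).trans_lt (EReal.coe_lt_coe_iff.2 ?_)
  have : (y - t - 1) / (1 - t) * (1 - t) = y - t - 1 := div_mul_cancel₀ _ h1.ne'
  linarith

theorem geodesic_le_of_le {t : ℝ} (ht : t ∈ Set.Ioo (0 : ℝ) 1) {z : Cn n}
    (hz : z ∈ Ω) {x : ℝ} (h : φ z ≤ x) :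
    geodesic n Ω φ (gp φ Ω) t z ≤ (((1 - t) * x : ℝ) : EReal) := by
  refine EReal.le_of_forall_lt_iff_le.1 fun y hy => ?_
  have hd : 0 < y - (1 - t) * x := sub_pos.2 (EReal.coe_lt_coe_iff.1 hy)
  refine (geodesic_le ht hz (c₀ := x + (y - (1 - t) * x)) (c₁ := y - (1 - t) * x)
    (h.trans_lt (EReal.coe_lt_coe_iff.2 (by linarith)))
    ((gp_nonpos z).trans_lt (EReal.coe_pos.2 hd))).trans (EReal.coe_le_coe_iff.2 (le_of_eq ?_))
  ring
end

section
variable {n : ℕ} {Ω : Set (Cn n)} {φ w : Cn n → EReal} {s : ℝ}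

theorem MACap_mono {S T : Set (Cn n)} (h : S ⊆ T) : MACap n Ω S ≤ MACap n Ω T :=
  iSup₂_mono fun _ _ => iSup₂_mono fun _ _ => measure_mono h

theorem MACap_union_le (S T : Set (Cn n)) : MACap n Ω (S ∪ T) ≤ MACap n Ω S + MACap n Ω T := by
  refine iSup₂_le fun u hu => iSup₂_le fun μ hμ => (measure_union_le S T).trans (add_le_add ?_ ?_)
  · exact (le_iSup₂_of_le (f := fun (μ : Measure (Cn n)) (_ : μ ∈ {μ | IsMAMeasure n u Ω μ}) => μ S)
      μ hμ le_rfl).trans (le_iSup₂_of_le u hu le_rfl)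
  · exact (le_iSup₂_of_le (f := fun (μ : Measure (Cn n)) (_ : μ ∈ {μ | IsMAMeasure n u Ω μ}) => μ T)
      μ hμ le_rfl).trans (le_iSup₂_of_le u hu le_rfl)

theorem MACap_empty : MACap n Ω ∅ = 0 := by simp [MACap]

theorem PSHNeg.sup (hφ : PSHNeg φ Ω) (hw : PSHNeg w Ω) : PSHNeg (fun z => max (φ z) (w z)) Ω :=
  ⟨hφ.1.max hw.1, fun z hz => max_le (hφ.2 z hz) (hw.2 z hz)⟩

/-- The truncation of `w` at level `-s`, extended by zero off `Ω`. -/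
def trunc (Ω : Set (Cn n)) (w : Cn n → EReal) (s : ℝ) : Cn n → ℝ :=
  rl Ω fun z => max (w z) ((-s : ℝ) : EReal)

theorem PSHNeg.max_const (hw : PSHNeg w Ω) (s : ℝ) (hs : 0 ≤ s) :
    PlurisubharmonicOn (fun z => max (w z) ((-s : ℝ) : EReal)) Ω ∧
      ∀ z ∈ Ω, ((-s : ℝ) : EReal) ≤ max (w z) ((-s : ℝ) : EReal) ∧
        max (w z) ((-s : ℝ) : EReal) ≤ 0 :=
  ⟨hw.1.max (plurisubharmonicOn_const _ _), fun z hz => ⟨le_max_right _ _,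
    max_le (hw.2 z hz) (EReal.coe_nonpos.2 (neg_nonpos.2 hs))⟩⟩

theorem PSHNeg.subMean_trunc (hw : PSHNeg w Ω) (hΩ : IsOpen Ω) (hs : 0 ≤ s) :
    SubMean Ω s (trunc Ω w s) :=
  subMean_rl hΩ hs (hw.max_const s hs).1 (hw.max_const s hs).2

theorem PSHNeg.upperSemicontinuousOn_trunc (hw : PSHNeg w Ω) (hs : 0 ≤ s) :
    UpperSemicontinuousOn (trunc Ω w s) Ω :=
  (upperSemicontinuousOn_rl (hw.max_const s hs).1.1 (hw.max_const s hs).2).1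

theorem PSHNeg.coe_trunc (hw : PSHNeg w Ω) (hs : 0 ≤ s) {z : Cn n} (hz : z ∈ Ω) :
    (trunc Ω w s z : EReal) = max (w z) ((-s : ℝ) : EReal) :=
  (upperSemicontinuousOn_rl (hw.max_const s hs).1.1 (hw.max_const s hs).2).2 z hz

theorem trunc_of_notMem {z : Cn n} (hz : z ∉ Ω) : trunc Ω w s z = 0 := if_neg hz

theorem PSHNeg.trunc_of_le (hw : PSHNeg w Ω) (hs : 0 ≤ s) {z : Cn n} (hz : z ∈ Ω)
    (h : w z ≤ ((-s : ℝ) : EReal)) : trunc Ω w s z = -s := by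
  have := hw.coe_trunc hs hz
  rwa [max_eq_right h, EReal.coe_eq_coe_iff] at this

theorem PSHNeg.trunc_of_eq (hw : PSHNeg w Ω) (hs : 0 ≤ s) {z : Cn n} (hz : z ∈ Ω) {x : ℝ}
    (h : w z = x) : trunc Ω w s z = max x (-s) := by
  have := hw.coe_trunc hs hz
  rwa [h, ← EReal.coe_strictMono.monotone.map_max, EReal.coe_eq_coe_iff] at this

theorem SubMean.const_mul {f : Cn n → ℝ} (hf : SubMean Ω s f) {c : ℝ} (hc : 0 ≤ c) :
    SubMean Ω (c * s) fun z => c * f z where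
  meas := hf.meas.const_mul c
  low z := by have := mul_le_mul_of_nonneg_left (hf.low z) hc; linarith
  high z := mul_nonpos_of_nonneg_of_nonpos hc (hf.high z)
  off z hz := by rw [hf.off z hz, mul_zero]
  mean a b h t ht := by
    have e : ∀ b, cm (fun z => c * f z) a b = c * cm f a b := fun b => integral_const_mul _ _
    rw [e, e]
    exact fun h1 => mul_le_mul_of_nonneg_left (hf.mean a b h t ht h1) hc

theorem kern_pos {δ : ℝ} (hδ : 0 < δ) {z : Cn n} (hz : sqn z < δ ^ 2) : 0 < kern δ z := by
  refine mul_pos (abs_pos.2 (by positivity)) (mul_pos (inv_pos.2 integral_rho0_pos)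
    (Real.smoothTransition.pos_of_pos (sub_pos.2 ?_)))
  have h : ((-δ⁻¹ : ℝ)) • z = ((-δ⁻¹ : ℝ) : ℂ) • z := (Complex.coe_smul _ _).symm
  rw [h, sqn_smul, Complex.normSq_ofReal, neg_mul_neg, ← mul_inv, inv_mul_lt_one₀ (by positivity)]
  linarith [sq δ]

theorem SubMean.ae_eq_zero {f : Cn n → ℝ} (hf : SubMean Ω s f) {δ : ℝ} (hδ : 0 < δ) {z : Cn n}
    (hz : Metric.closedBall z δ ⊆ Ω) (h0 : f z = 0) :
    ∀ᵐ y, sqn (z - y) < δ ^ 2 → f y = 0 := by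
  have hk : Integrable fun y : Cn n => kern δ (z - y) :=
    ((ContDiff.continuous (smooth_kern δ)).integrable_of_hasCompactSupport
      (hasCompactSupport_kern hδ)).comp_sub_left z
  have hi : Integrable fun y => f y * kern δ (z - y) :=
    hk.bdd_mul hf.meas.aestronglyMeasurable (Eventually.of_forall fun y => hf.abs_le y)
  have hm : ∫ y, f y * kern δ (z - y) = 0 := by
    rw [← moll_eq f hδ]
    exact le_antisymm (hf.moll_nonpos δ z) (h0 ▸ hf.le_moll hδ.le hz)
  have hm' : ∫ y, -(f y * kern δ (z - y)) = 0 := by rw [integral_neg, hm, neg_zero]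
  have h := (integral_eq_zero_iff_of_nonneg (fun y => neg_nonneg.2
    (mul_nonpos_of_nonpos_of_nonneg (hf.high y) (kern_nonneg δ _))) hi.neg).1 hm'
  filter_upwards [h] with y hy hlt
  have hy : -(f y * kern δ (z - y)) = 0 := hy
  exact (mul_eq_zero.1 (neg_eq_zero.1 hy)).resolve_right (kern_pos hδ hlt).ne'

theorem PSHNeg.trunc_div_eq (hφ : PSHNeg φ Ω) (j : ℕ) {z : Cn n} (hz : z ∈ Ω) {x : ℝ}
    (h : φ z = x) : ((j : ℝ) + 1)⁻¹ * trunc Ω φ (j + 1) z = max (x / (j + 1)) (-1) := by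
  have hj : (0 : ℝ) < j + 1 := by positivity
  rw [hφ.trunc_of_eq hj.le hz h, mul_max_of_nonneg _ _ (inv_nonneg.2 hj.le), mul_neg,
    inv_mul_cancel₀ hj.ne', inv_mul_eq_div]

theorem PSHNeg.trunc_div_eq_neg_one (hφ : PSHNeg φ Ω) (j : ℕ) {z : Cn n} (hz : z ∈ Ω)
    (h : φ z ≤ ((-(j + 1) : ℝ) : EReal)) : ((j : ℝ) + 1)⁻¹ * trunc Ω φ (j + 1) z = -1 := by
  have hj : (0 : ℝ) < j + 1 := by positivity
  rw [hφ.trunc_of_le hj.le hz h, mul_neg, inv_mul_cancel₀ hj.ne']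

theorem PSHNeg.monotone_trunc_div (hφ : PSHNeg φ Ω) (z : Cn n) :
    Monotone fun j : ℕ => ((j : ℝ) + 1)⁻¹ * trunc Ω φ (j + 1) z := by
  intro i j hij
  by_cases hz : z ∈ Ω
  · have h0 := hφ.2 z hz
    by_cases hb : φ z = ⊥
    · simp only [hφ.trunc_div_eq_neg_one _ hz (hb ▸ bot_le), le_refl]
    · lift φ z to ℝ using ⟨ne_top_of_le_ne_top EReal.zero_ne_top h0, hb⟩ with x hx
      have hx0 : x ≤ 0 := EReal.coe_nonpos.1 h0
      simp only [hφ.trunc_div_eq _ hz hx.symm]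
      refine max_le_max ?_ le_rfl
      have hij' : (i : ℝ) ≤ j := Nat.cast_le.2 hij
      rw [div_le_div_iff₀ (by positivity) (by positivity)]
      exact mul_le_mul_of_nonpos_left (by linarith) hx0
  · simp only [trunc_of_notMem hz, mul_zero, le_refl]

theorem PSHNeg.tendsto_trunc_div (hφ : PSHNeg φ Ω) (z : Cn n) :
    Tendsto (fun j : ℕ => ((j : ℝ) + 1)⁻¹ * trunc Ω φ (j + 1) z) atTop
      (𝓝 ({z | z ∈ Ω ∧ φ z = ⊥}.indicator (fun _ => -1) z)) := by
  by_cases hz : z ∈ Ω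
  · by_cases hb : φ z = ⊥
    · rw [Set.indicator_of_mem (show z ∈ {z | z ∈ Ω ∧ φ z = ⊥} from ⟨hz, hb⟩)]
      simp only [hφ.trunc_div_eq_neg_one _ hz (hb ▸ bot_le), tendsto_const_nhds]
    · rw [Set.indicator_of_notMem (show z ∉ {z | z ∈ Ω ∧ φ z = ⊥} from fun h => hb h.2)]
      lift φ z to ℝ using ⟨ne_top_of_le_ne_top EReal.zero_ne_top (hφ.2 z hz), hb⟩ with x hx
      simp only [hφ.trunc_div_eq _ hz hx.symm]
      have h := ((tendsto_const_div_atTop_nhds_zero_nat x).comp (tendsto_add_atTop_nat 1)).max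
        (tendsto_const_nhds (x := (-1 : ℝ)))
      rw [max_eq_left (by norm_num)] at h
      refine h.congr fun j => ?_
      simp
  · rw [Set.indicator_of_notMem (show z ∉ {z | z ∈ Ω ∧ φ z = ⊥} from fun h => hz h.1)]
    simp only [trunc_of_notMem hz, mul_zero, tendsto_const_nhds]

theorem PSHNeg.subMean_trunc_div (hφ : PSHNeg φ Ω) (hΩ : IsOpen Ω) (j : ℕ) :
    SubMean Ω 1 fun z => ((j : ℝ) + 1)⁻¹ * trunc Ω φ (j + 1) z := by
  have hj : (0 : ℝ) < j + 1 := by positivity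
  have := (hφ.subMean_trunc hΩ hj.le).const_mul (inv_nonneg.2 hj.le)
  rwa [inv_mul_cancel₀ hj.ne'] at this

theorem PSHNeg.measure_bot_eq_zero (hφ : PSHNeg φ Ω) (hc : IsConnected Ω) (hΩ : IsOpen Ω)
    (hne : ∃ z ∈ Ω, φ z ≠ ⊥) : volume {z | z ∈ Ω ∧ φ z = ⊥} = 0 := by
  set P : Set (Cn n) := {z | z ∈ Ω ∧ φ z = ⊥} with hP
  have hW : SubMean Ω 1 (P.indicator fun _ => -1) :=
    SubMean.of_tendsto (fun j => hφ.subMean_trunc_div hΩ j) hφ.tendsto_trunc_div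
  set A : Set (Cn n) := {z | ∃ U, IsOpen U ∧ z ∈ U ∧ volume (U ∩ P) = 0} with hA
  have hAo : IsOpen A := isOpen_iff_forall_mem_open.2 fun z ⟨U, hU, hz, h0⟩ =>
    ⟨U, fun y hy => ⟨U, hU, hy, h0⟩, hU, hz⟩
  have hcov : Ω ⊆ A ∪ interior P := fun z hz => by
    obtain ⟨R, hR, hd⟩ := Metric.nhds_basis_closedBall.mem_iff.1 (hΩ.mem_nhds hz)
    have hU : ∀ y : Cn n, IsOpen {x : Cn n | sqn (y - x) < (R / 2) ^ 2} := fun y => isOpen_lt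
      ((ContDiff.continuous smooth_sqn).comp (continuous_const.sub continuous_id)) continuous_const
    by_cases h : ∃ y, y ∉ P ∧ sqn (y - z) < (R / 2) ^ 2
    · obtain ⟨y, hyP, hy⟩ := h
      have hyn : ‖y - z‖ < R / 2 :=
        lt_of_pow_lt_pow_left₀ 2 (by positivity) ((norm_sq_le_sqn _).trans_lt hy)
      have hyd : Metric.closedBall y (R / 2) ⊆ Ω := fun x hx => hd (by
        rw [mem_closedBall_iff_norm] at hx ⊢
        linarith [norm_sub_le_norm_sub_add_norm_sub x y z])
      have hae := hW.ae_eq_zero (half_pos hR) hyd (Set.indicator_of_notMem hyP _)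
      refine Or.inl ⟨_, hU y, hy, measure_mono_null ?_ hae⟩
      rintro x ⟨hx, hxP⟩ h0
      have := h0 hx
      rw [Set.indicator_of_mem hxP] at this
      norm_num at this
    · push Not at h
      refine Or.inr (mem_interior.2 ⟨{x | sqn (x - z) < (R / 2) ^ 2}, fun x hx => ?_,
        isOpen_lt ((ContDiff.continuous smooth_sqn).comp (continuous_id.sub continuous_const))
          continuous_const, ?_⟩)
      · by_contra hn
        exact absurd hx (not_lt.2 (h x hn))
      · change sqn (z - z) < _
        rw [sub_self, show sqn (0 : Cn n) = 0 by simp [sqn]]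
        positivity
  have hdisj : Disjoint A (interior P) := Set.disjoint_left.2 fun z ⟨U, hU, hz, h0⟩ hzP => by
    have h1 : 0 < volume (U ∩ interior P) := (hU.inter isOpen_interior).measure_pos _ ⟨z, hz, hzP⟩
    exact h1.ne' (measure_mono_null (Set.inter_subset_inter_right _ interior_subset) h0)
  have hsub : Ω ⊆ A := hc.isPreconnected.subset_left_of_subset_union hAo isOpen_interior hdisj hcov (by
    obtain ⟨z, hz, hb⟩ := hne
    exact ⟨z, hz, (hcov hz).resolve_right fun h => hb (interior_subset h).2⟩)
  refine measure_null_of_locally_null P fun z hz => ?_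
  obtain ⟨U, hU, hzU, h0⟩ := hsub hz.1
  exact ⟨U ∩ P, inter_mem (mem_nhdsWithin_of_mem_nhds (hU.mem_nhds hzU)) self_mem_nhdsWithin, h0⟩

theorem PSHNeg.exists_MACap_sublevel_le (hφ : PSHNeg φ Ω) (hc : IsConnected Ω) (hΩ : IsOpen Ω)
    (hb : Bornology.IsBounded Ω) (hne : ∃ z ∈ Ω, φ z ≠ ⊥) {K : Set (Cn n)} (hK : IsCompact K)
    (hKΩ : K ⊆ Ω) {η : ℝ} (hη : 0 < η) :
    ∃ c : ℝ, 0 < c ∧ MACap n Ω {z | z ∈ K ∧ φ z < ((-c : ℝ) : EReal)} ≤ ENNReal.ofReal η := by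
  have hW : SubMean Ω 1 ({z | z ∈ Ω ∧ φ z = ⊥}.indicator fun _ => -1) :=
    SubMean.of_tendsto (fun j => hφ.subMean_trunc_div hΩ j) hφ.tendsto_trunc_div
  have hae : ∀ᵐ z, (0 : ℝ) ≤ {z | z ∈ Ω ∧ φ z = ⊥}.indicator (fun _ => -1) z := by
    filter_upwards [measure_eq_zero_iff_ae_notMem.1 (hφ.measure_bot_eq_zero hc hΩ hne)] with z hz
    rw [Set.indicator_of_notMem (show z ∉ {z | z ∈ Ω ∧ φ z = ⊥} from hz)]
  have husc : ∀ j : ℕ, UpperSemicontinuousOn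
      (fun z => ((j : ℝ) + 1)⁻¹ * trunc Ω φ (j + 1) z) Ω := fun j z hz y hy => by
    have hj : (0 : ℝ) < j + 1 := by positivity
    have hy' : trunc Ω φ (j + 1) z < (j + 1) * y := by
      have hy : ((j : ℝ) + 1)⁻¹ * trunc Ω φ (j + 1) z < y := hy
      rwa [inv_mul_lt_iff₀ hj] at hy
    filter_upwards [hφ.upperSemicontinuousOn_trunc hj.le z hz _ hy'] with x hx
    exact (inv_mul_lt_iff₀ hj).2 hx
  have hg : ∀ δ, 0 < δ → ∀ z, Metric.closedBall z δ ⊆ Ω →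
      (0 : EReal) ≤ (moll ({z | z ∈ Ω ∧ φ z = ⊥}.indicator fun _ => -1) δ z : ℝ) :=
    fun δ hδ z _ => EReal.coe_nonneg.2 (by
      have := moll_mono_ae (f := fun _ => (0 : ℝ)) measurable_const (s := 0) (by simp) hW.meas
        hW.abs_le hae hδ z
      rwa [moll_const] at this)
  obtain ⟨j, hj⟩ := exists_MACap_le zero_le_one hΩ hb (fun j => hφ.subMean_trunc_div hΩ j)
    husc hφ.monotone_trunc_div hφ.tendsto_trunc_div (g := fun _ => 0) hg one_half_pos hK hKΩ hη
  refine ⟨j + 1, by positivity, (MACap_mono ?_).trans hj⟩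
  rintro z ⟨hz, hlt⟩
  refine ⟨hz, ?_⟩
  rw [hφ.trunc_div_eq_neg_one j (hKΩ hz) hlt.le]
  exact EReal.coe_neg'.2 (by norm_num)
end

section

theorem lintegral_exp_iSup {α : Type*} [MeasurableSpace α] {μ : Measure α} {w : ℕ → α → EReal}
    (hw : ∀ j, AEMeasurable (w j) μ) (hm : Monotone w) :
    ∫⁻ z, (⨆ j, w j z).exp ∂μ = ⨆ j, ∫⁻ z, (w j z).exp ∂μ := by
  rw [← lintegral_iSup' (f := fun j z => (w j z).exp) (fun j => EReal.measurable_exp.comp_aemeasurable (hw j))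
    (Eventually.of_forall fun z i j hij => EReal.exp_monotone (hm hij z))]
  exact lintegral_congr fun z => EReal.expOrderIso.map_iSup fun j => w j z

/-- A directed family of nonpositive functions contains an increasing sequence whose supremum
dominates every member almost everywhere. -/
theorem exists_seq_ae_le_iSup {α : Type*} [MeasurableSpace α] {μ : Measure α} [IsFiniteMeasure μ]
    {F : Set (α → EReal)} (hne : F.Nonempty) (hsup : ∀ v ∈ F, ∀ w ∈ F, v ⊔ w ∈ F)
    (hmeas : ∀ v ∈ F, AEMeasurable v μ) (h0 : ∀ v ∈ F, ∀ᵐ z ∂μ, v z ≤ 0) :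
    ∃ w : ℕ → α → EReal, (∀ j, w j ∈ F) ∧ Monotone w ∧
      ∀ v ∈ F, ∀ᵐ z ∂μ, v z ≤ ⨆ j, w j z := by
  set I : (α → EReal) → ℝ≥0∞ := fun v => ∫⁻ z, (v z).exp ∂μ with hI
  have hIle : ∀ v ∈ F, I v ≤ μ Set.univ := fun v hv => by
    refine (lintegral_mono_ae (g := fun _ => 1) ?_).trans (by simp)
    filter_upwards [h0 v hv] with z hz
    simpa using EReal.exp_monotone hz
  obtain ⟨x, -, hx, hxF⟩ := exists_seq_tendsto_sSup (hne.image I) (OrderTop.bddAbove _)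
  choose v hvF hvx using hxF
  set w : ℕ → α → EReal := fun j => partialSups v j with hw
  have hwF : ∀ j, w j ∈ F := fun j => by
    induction j with
    | zero => simpa [hw] using hvF 0
    | succ j ih => simp only [hw, partialSups_add_one]; exact hsup _ ih _ (hvF _)
  have hmono : Monotone w := (partialSups v).monotone
  have hS : ∀ j, I (w j) ≤ sSup (I '' F) := fun j => le_sSup ⟨_, hwF j, rfl⟩
  have hWI : ∫⁻ z, (⨆ j, w j z).exp ∂μ = sSup (I '' F) := by
    rw [lintegral_exp_iSup (fun j => hmeas _ (hwF j)) hmono]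
    refine le_antisymm (iSup_le hS) (le_of_tendsto' hx fun k => ?_)
    rw [← hvx k]
    exact (lintegral_mono fun z => EReal.exp_monotone (le_partialSups v k z)).trans
      (le_iSup (fun j => ∫⁻ z, (w j z).exp ∂μ) k)
  refine ⟨w, hwF, hmono, fun u hu => ?_⟩
  have huF : ∀ j, w j ⊔ u ∈ F := fun j => hsup _ (hwF j) _ hu
  have humono : Monotone fun j => w j ⊔ u := fun i j hij => sup_le_sup_right (hmono hij) u
  have hae := ae_eq_of_ae_le_of_lintegral_le (μ := μ) (f := fun z => (⨆ j, w j z).exp)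
    (g := fun z => (⨆ j, (w j ⊔ u) z).exp)
    (Eventually.of_forall fun z => EReal.exp_monotone (iSup_mono fun j => le_sup_left))
    (by
      rw [hWI]
      refine ((sSup_le ?_).trans_lt (measure_lt_top μ Set.univ)).ne
      rintro _ ⟨v, hv, rfl⟩
      exact hIle v hv)
    (EReal.measurable_exp.comp_aemeasurable (AEMeasurable.iSup fun j => hmeas _ (huF j)))
    (by
      rw [hWI, lintegral_exp_iSup (fun j => hmeas _ (huF j)) humono]
      exact iSup_le fun j => le_sSup ⟨_, huF j, rfl⟩)
  filter_upwards [hae] with z hz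
  have hz : (⨆ j, w j z) = ⨆ j, (w j ⊔ u) z := EReal.exp_strictMono.injective hz
  rw [hz]
  exact le_iSup_of_le 0 le_sup_right

variable {n : ℕ} {Ω : Set (Cn n)} {φ w : Cn n → EReal} {s : ℝ}

theorem PSHNeg.aemeasurable (hw : PSHNeg w Ω) (hΩ : IsOpen Ω) :
    AEMeasurable w (volume.restrict Ω) := by
  refine ⟨Ω.indicator w, measurable_of_usc hΩ (fun z hz c hc => ?_)
    (fun z hz => Set.indicator_of_notMem hz w), ?_⟩
  · have hc : Ω.indicator w z < c := hc
    rw [Set.indicator_of_mem hz] at hc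
    filter_upwards [hw.1.1 z hz c hc, self_mem_nhdsWithin] with y hy hyΩ
    rwa [Set.indicator_of_mem hyΩ]
  · filter_upwards [ae_restrict_mem hΩ.measurableSet] with z hz
    rw [Set.indicator_of_mem hz]

theorem PSHNeg.exists_seq_residual (hφ : PSHNeg φ Ω) (hΩ : IsOpen Ω)
    (hb : Bornology.IsBounded Ω) : ∃ w : ℕ → Cn n → EReal,
      (∀ j, PSHNeg (w j) Ω ∧ ∃ C : ℝ, ∀ x ∈ Ω, w j x ≤ φ x + (C : EReal)) ∧ Monotone w ∧
      ∀ v, PSHNeg v Ω → ∀ C : ℝ, (∀ x ∈ Ω, v x ≤ φ x + (C : EReal)) →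
        ∀ᵐ z, z ∈ Ω → v z ≤ ⨆ j, w j z := by
  have : IsFiniteMeasure (volume.restrict Ω) := ⟨by
    rw [Measure.restrict_apply_univ]; exact hb.measure_lt_top⟩
  have hne : {w | PSHNeg w Ω ∧ ∃ C : ℝ, ∀ x ∈ Ω, w x ≤ φ x + (C : EReal)}.Nonempty :=
    ⟨φ, hφ, 0, by simp⟩
  have hsup : ∀ v ∈ {w | PSHNeg w Ω ∧ ∃ C : ℝ, ∀ x ∈ Ω, w x ≤ φ x + (C : EReal)},
      ∀ w ∈ {w | PSHNeg w Ω ∧ ∃ C : ℝ, ∀ x ∈ Ω, w x ≤ φ x + (C : EReal)},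
        v ⊔ w ∈ {w | PSHNeg w Ω ∧ ∃ C : ℝ, ∀ x ∈ Ω, w x ≤ φ x + (C : EReal)} := by
    rintro v ⟨hv, C, hC⟩ w ⟨hw, C', hC'⟩
    refine ⟨hv.sup hw, max C C', fun x hx => sup_le ?_ ?_⟩
    · exact (hC x hx).trans (add_le_add_right (EReal.coe_le_coe_iff.2 (le_max_left _ _)) _)
    · exact (hC' x hx).trans (add_le_add_right (EReal.coe_le_coe_iff.2 (le_max_right _ _)) _)
  obtain ⟨w, hw, hm, hae⟩ := exists_seq_ae_le_iSup (μ := volume.restrict Ω)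
    hne hsup (fun v hv => hv.1.aemeasurable hΩ) fun v hv => by
      filter_upwards [ae_restrict_mem hΩ.measurableSet] with z hz using hv.1.2 z hz
  exact ⟨w, hw, hm, fun v hv C hC => (ae_restrict_iff' hΩ.measurableSet).1 (hae v ⟨hv, C, hC⟩)⟩

theorem PSHNeg.trunc_mono {v : Cn n → EReal} (hv : PSHNeg v Ω) (hw : PSHNeg w Ω) (hs : 0 ≤ s)
    {z : Cn n} (h : v z ≤ w z) : trunc Ω v s z ≤ trunc Ω w s z := by
  by_cases hz : z ∈ Ω
  · rw [← EReal.coe_le_coe_iff, hv.coe_trunc hs hz, hw.coe_trunc hs hz]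
    exact max_le_max h le_rfl
  · rw [trunc_of_notMem hz, trunc_of_notMem hz]

theorem gp_le_moll (hΩ : IsOpen Ω) (hs : 0 ≤ s) {w : ℕ → Cn n → EReal} {W : Cn n → ℝ}
    (hw : ∀ j, PSHNeg (w j) Ω) (hm : Monotone w)
    (hW : ∀ z, Tendsto (fun j => trunc Ω (w j) s z) atTop (𝓝 (W z)))
    (hae : ∀ v, PSHNeg v Ω → ∀ C : ℝ, (∀ x ∈ Ω, v x ≤ φ x + (C : EReal)) →
      ∀ᵐ z, z ∈ Ω → v z ≤ ⨆ j, w j z) {δ : ℝ} (hδ : 0 < δ) {z : Cn n}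
    (hz : Metric.closedBall z δ ⊆ Ω) : gp φ Ω z ≤ (moll W δ z : ℝ) := by
  have hWs : SubMean Ω s W := SubMean.of_tendsto (fun j => (hw j).subMean_trunc hΩ hs) hW
  refine EReal.le_of_forall_lt_iff_le.1 fun c hc => ?_
  have hc : moll W (δ / 2) z < c :=
    (hWs.moll_le_moll (half_pos hδ).le (half_le_self hδ.le) hz).trans_lt (EReal.coe_lt_coe_iff.1 hc)
  have hcont : Continuous (moll W (δ / 2)) := ContDiff.continuous (hWs.smooth (half_pos hδ))
  refine limsup_le_of_le (by isBoundedDefault) (Eventually.filter_mono nhdsWithin_le_nhds ?_)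
  filter_upwards [hcont.continuousAt.eventually (gt_mem_nhds hc),
    Metric.closedBall_mem_nhds z (half_pos hδ)] with y hy hyz
  refine iSup₂_le fun v hv => ?_
  obtain ⟨hv, C, hC⟩ := hv
  have hyd : Metric.closedBall y (δ / 2) ⊆ Ω := (Metric.closedBall_subset_closedBall' (by
    rw [Metric.mem_closedBall] at hyz; linarith)).trans hz
  have hyΩ : y ∈ Ω := hyd (Metric.mem_closedBall_self (half_pos hδ).le)
  have hvs := hv.subMean_trunc hΩ hs
  have hle : ∀ᵐ x, trunc Ω v s x ≤ W x := by
    filter_upwards [hae v hv C hC] with x hx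
    by_cases hxΩ : x ∈ Ω
    · rw [← EReal.coe_le_coe_iff, hv.coe_trunc hs hxΩ]
      refine max_le ((hx hxΩ).trans (iSup_le fun j => ?_)) (EReal.coe_le_coe_iff.2 (hWs.low x))
      have h1 : trunc Ω (w j) s x ≤ W x := ge_of_tendsto (hW x) (by
        filter_upwards [eventually_ge_atTop j] with k hk
        exact (hw j).trunc_mono (hw k) hs (hm hk x))
      refine le_trans ?_ (EReal.coe_le_coe_iff.2 h1)
      rw [(hw j).coe_trunc hs hxΩ]
      exact le_max_left _ _
    · rw [hvs.off x hxΩ, hWs.off x hxΩ]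
  have h1 : trunc Ω v s y ≤ c := (hvs.le_moll (half_pos hδ).le hyd).trans
    ((moll_mono_ae hvs.meas hvs.abs_le hWs.meas hWs.abs_le hle (half_pos hδ) y).trans hy.le)
  refine le_trans ?_ (EReal.coe_le_coe_iff.2 h1)
  rw [hv.coe_trunc hs hyΩ]
  exact le_max_left _ _

theorem exists_tendsto_trunc (hΩ : IsOpen Ω) (hs : 0 ≤ s) {w : ℕ → Cn n → EReal}
    (hw : ∀ j, PSHNeg (w j) Ω) (hm : Monotone w) :
    ∃ W : Cn n → ℝ, ∀ z, Tendsto (fun j => trunc Ω (w j) s z) atTop (𝓝 (W z)) :=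
  ⟨_, fun z => tendsto_atTop_ciSup (fun i j hij => (hw i).trunc_mono (hw j) hs (hm hij z))
    ⟨0, by rintro _ ⟨j, rfl⟩; exact ((hw j).subMean_trunc hΩ hs).high z⟩⟩
end

section
variable {n : ℕ} {Ω : Set (Cn n)} {φ : Cn n → EReal}

theorem le_geodesic (hφ : PSHNeg φ Ω) (t : ℝ) (z : Cn n) :
    φ z ≤ geodesic n Ω φ (gp φ Ω) t z := by
  simpa using sub_le_geodesic hφ le_rfl (by simp) t z

theorem gp_eq_bot (h : ∀ z ∈ Ω, φ z = ⊥) (z : Cn n) : gp φ Ω z = ⊥ := by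
  rw [← le_bot_iff]
  by_cases hz : 𝓝[Ω] z = ⊥
  · rw [gp, uscReg, hz, limsup_bot]
  · refine limsup_le_of_le (by isBoundedDefault) (eventually_nhdsWithin_of_forall fun y hy =>
      iSup₂_le fun w hw => ?_)
    obtain ⟨-, C, hC⟩ := hw
    simpa [h y hy] using hC y hy

theorem exists_ofReal_le {η : ℝ≥0∞} (hη : 0 < η) : ∃ r : ℝ, 0 < r ∧ ENNReal.ofReal r ≤ η := by
  obtain ⟨r, hr, hrη⟩ := ENNReal.lt_iff_exists_nnreal_btwn.1 hη
  exact ⟨r, NNReal.coe_pos.2 (ENNReal.coe_pos.1 hr), by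
    rw [ENNReal.ofReal_coe_nnreal]; exact hrη.le⟩

theorem tendstoInCap_zero (hφ : PSHNeg φ Ω) (hc : IsConnected Ω) (hΩ : IsOpen Ω)
    (hb : Bornology.IsBounded Ω) (hne : ∃ z ∈ Ω, φ z ≠ ⊥) :
    TendstoInCap n Ω (geodesic n Ω φ (gp φ Ω)) φ 0 := by
  refine fun ε hε K hK hKΩ => ENNReal.tendsto_nhds_zero.2 fun η hη => ?_
  obtain ⟨r, hr, hrη⟩ := exists_ofReal_le hη
  obtain ⟨c, hc0, hcap⟩ := hφ.exists_MACap_sublevel_le hc hΩ hb hne hK hKΩ hr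
  filter_upwards [self_mem_nhdsWithin, mem_nhdsWithin_of_mem_nhds
    (gt_mem_nhds (div_pos hε hc0))] with t ht htc
  have htc : t * c < ε := (lt_div_iff₀ hc0).1 htc
  refine (MACap_mono ?_).trans (hcap.trans hrη)
  rintro z ⟨hz, hn⟩
  refine ⟨hz, not_le.1 fun hle => hn ⟨?_, ?_⟩⟩
  · have hbot : φ z ≠ ⊥ := ne_bot_of_le_ne_bot (EReal.coe_ne_bot _) hle
    have htop : φ z ≠ ⊤ := ne_top_of_le_ne_top EReal.zero_ne_top (hφ.2 z (hKΩ hz))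
    lift φ z to ℝ using ⟨htop, hbot⟩ with x hx
    refine (geodesic_le_of_le ht (hKΩ hz) hx.ge).trans ?_
    rw [← EReal.coe_add, EReal.coe_le_coe_iff]
    have := EReal.coe_le_coe_iff.1 hle
    nlinarith [ht.1]
  · exact (le_geodesic hφ t z).trans (le_add_of_nonneg_right (EReal.coe_nonneg.2 hε.le))

theorem tendstoInCap_one (hφ : PSHNeg φ Ω) (hc : IsConnected Ω) (hΩ : IsOpen Ω)
    (hb : Bornology.IsBounded Ω) (hne : ∃ z ∈ Ω, φ z ≠ ⊥) :
    TendstoInCap n Ω (geodesic n Ω φ (gp φ Ω)) (gp φ Ω) 1 := by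
  refine fun ε hε K hK hKΩ => ENNReal.tendsto_nhds_zero.2 fun η hη => ?_
  obtain ⟨r, hr, hrη⟩ := exists_ofReal_le hη
  obtain ⟨s, hs, hcap⟩ := hφ.exists_MACap_sublevel_le hc hΩ hb hne hK hKΩ (half_pos hr)
  obtain ⟨w, hw, hm, hae⟩ := hφ.exists_seq_residual hΩ hb
  obtain ⟨W, hW⟩ := exists_tendsto_trunc hΩ hs.le (fun j => (hw j).1) hm
  obtain ⟨j, hj⟩ := exists_MACap_le hs.le hΩ hb (fun j => (hw j).1.subMean_trunc hΩ hs.le)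
    (fun j => (hw j).1.upperSemicontinuousOn_trunc hs.le)
    (fun z i j hij => (hw i).1.trunc_mono (hw j).1 hs.le (hm hij z)) hW
    (fun δ hδ z hz => gp_le_moll hΩ hs.le (fun j => (hw j).1) hm hW hae hδ hz) (half_pos hε)
    hK hKΩ (half_pos hr)
  obtain ⟨hwj, C, hC⟩ := hw j
  have hlim : Tendsto (fun t : ℝ => max C 0 * (t - 1) + ε / 2) (𝓝 1) (𝓝 (ε / 2)) := by
    have h : Continuous fun t : ℝ => max C 0 * (t - 1) + ε / 2 := by fun_prop
    simpa using h.tendsto 1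
  filter_upwards [self_mem_nhdsWithin, mem_nhdsWithin_of_mem_nhds
    (hlim.eventually (lt_mem_nhds (half_pos hε)))] with t ht htC
  have htC : 0 < max C 0 * (t - 1) + ε / 2 := htC
  refine (MACap_mono (T := {z | z ∈ K ∧ φ z < ((-s : ℝ) : EReal)} ∪
    {z | z ∈ K ∧ ((trunc Ω (w j) s z + ε / 2 : ℝ) : EReal) < gp φ Ω z}) ?_).trans
    ((MACap_union_le _ _).trans ((add_le_add hcap hj).trans ?_))
  · rintro z ⟨hz, hn⟩
    by_contra hnot
    have h1 : ((-s : ℝ) : EReal) ≤ φ z := not_lt.1 fun h => hnot (Or.inl ⟨hz, h⟩)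
    have h2 : gp φ Ω z ≤ ((trunc Ω (w j) s z + ε / 2 : ℝ) : EReal) :=
      not_lt.1 fun h => hnot (Or.inr ⟨hz, h⟩)
    refine hn ⟨(geodesic_le_gp hφ ht (hKΩ hz)).trans
      (le_add_of_nonneg_right (EReal.coe_nonneg.2 hε.le)), h2.trans ?_⟩
    rw [EReal.coe_add, hwj.coe_trunc hs.le (hKΩ hz)]
    have h3 : max (w j z) ((-s : ℝ) : EReal) ≤
        geodesic n Ω φ (gp φ Ω) t z + ((ε / 2 : ℝ) : EReal) := by
      refine max_le ?_ ((h1.trans (le_geodesic hφ t z)).trans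
        (le_add_of_nonneg_right (EReal.coe_nonneg.2 (half_pos hε).le)))
      refine (le_add_of_nonneg_right (EReal.coe_nonneg.2 htC.le)).trans ?_
      rw [EReal.coe_add, ← add_assoc]
      exact add_le_add_left (sub_le_geodesic hwj (le_max_right C 0) (fun x hx => (hC x hx).trans
        (add_le_add_right (EReal.coe_le_coe_iff.2 (le_max_left C 0)) _)) t z) _
    refine (add_le_add_left h3 _).trans (le_of_eq ?_)
    rw [add_assoc, ← EReal.coe_add, add_halves]
  · rwa [← ENNReal.ofReal_add (half_pos hr).le (half_pos hr).le, add_halves]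

theorem tendstoInCap_of_eq_bot {g : Cn n → EReal} {t₀ : ℝ} (h : ∀ z ∈ Ω, φ z = ⊥)
    (hg : ∀ z ∈ Ω, g z = ⊥) : TendstoInCap n Ω (geodesic n Ω φ (gp φ Ω)) g t₀ := by
  refine fun ε _ K _ hKΩ => ENNReal.tendsto_nhds_zero.2 fun η _ => ?_
  filter_upwards [self_mem_nhdsWithin] with t ht
  refine (MACap_mono (T := ∅) ?_).trans (MACap_empty.trans_le zero_le)
  rintro z ⟨hz, hn⟩
  refine hn ⟨?_, ?_⟩
  · rw [geodesic_eq_bot ht (hKΩ hz) (h z (hKΩ hz))]; exact bot_le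
  · rw [hg z (hKΩ hz)]; exact bot_le
end

/-- Corollary 8.2: any `φ ∈ PSH⁻(D)` can be connected with its Green–Poisson residual
function `g_φ` by the geodesic: `u_t → u_j` in capacity as `t → j`, `j = 0, 1`, where
`u₀ = φ` and `u₁ = g_φ`. -/
theorem statement18 {n : ℕ} (Ω : Set (Cn n)) (hΩconn : IsConnected Ω) (hΩopen : IsOpen Ω)
    (hΩbd : Bornology.IsBounded Ω) (hΩhc : Hyperconvex Ω)
    (φ : Cn n → EReal) (hφ : PSHNeg φ Ω) :
    TendstoInCap n Ω (geodesic n Ω φ (gp φ Ω)) φ 0 ∧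
    TendstoInCap n Ω (geodesic n Ω φ (gp φ Ω)) (gp φ Ω) 1 := by
  by_cases hne : ∃ z ∈ Ω, φ z ≠ ⊥
  · exact ⟨tendstoInCap_zero hφ hΩconn hΩopen hΩbd hne,
      tendstoInCap_one hφ hΩconn hΩopen hΩbd hne⟩
  · push Not at hne
    exact ⟨tendstoInCap_of_eq_bot hne hne,
      tendstoInCap_of_eq_bot hne fun z _ => gp_eq_bot hne z⟩
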